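/- Let a ∈ [1,3]. Let R ∈ ℛ be such that Leb(R) < a and such that R = hull(λ) for a rectifiable Jordan curve λ ⊆ [-1,1]². Then there exists R' ∈ ℛ with Leb(R') = a and R' = hull(λ') for a rectifiable Jordan curve λ' ⊆ [-1,1]², such that I_τ(∂R)/Leb(R) > I_τ(∂R')/Leb(R'). -/

import Mathlib

open MeasureTheory Set Filter ENNReal

noncomputable section

/-- The closed square `[-1,1]²` in `ℝ × ℝ`. -/
def Isq : Set (ℝ × ℝ) := Set.Icc (-1, -1) (1, 1)

/-- The open square `(-1,1)²` in `ℝ × ℝ`. -/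
def Osq : Set (ℝ × ℝ) := Set.Ioo (-1, -1) (1, 1)

/-- `τ` is a norm on `ℝ²`. -/
def IsNorm2 (τ : ℝ × ℝ → ℝ) : Prop :=
  (∀ x, τ x = 0 ↔ x = 0) ∧ (∀ (c : ℝ) (x), τ (c • x) = |c| * τ x) ∧
    ∀ x y, τ (x + y) ≤ τ x + τ y

/-- The Euclidean norm on `ℝ × ℝ`. -/
def eNorm2 (v : ℝ × ℝ) : ℝ := Real.sqrt (v.1 ^ 2 + v.2 ^ 2)

/-- The dual norm `τ*` of a norm `τ` on `ℝ²`. -/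
def dualNorm (τ : ℝ × ℝ → ℝ) (w : ℝ × ℝ) : ℝ :=
  sSup {x | ∃ v : ℝ × ℝ, τ v ≤ 1 ∧ x = v.1 * w.1 + v.2 * w.2}

/-- The divergence of a vector field on `ℝ²`. -/
def div2 (f : ℝ × ℝ → ℝ × ℝ) (x : ℝ × ℝ) : ℝ :=
  (fderiv ℝ f x (1, 0)).1 + (fderiv ℝ f x (0, 1)).2

/-- The perimeter `per(∂E)` of a set `E ⊆ ℝ²`, as the supremum of `∫_E div f`
over smooth compactly supported vector fields with `|f|₂ ≤ 1`. -/
def per (E : Set (ℝ × ℝ)) : ℝ≥0∞ :=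
  ⨆ f ∈ {f : ℝ × ℝ → ℝ × ℝ |
      ContDiff ℝ (⊤ : ℕ∞) f ∧ HasCompactSupport f ∧ ∀ x, eNorm2 (f x) ≤ 1},
    ENNReal.ofReal (∫ x in E, div2 f x)

/-- The restricted surface energy `I_τ(∂E)`: the supremum of `∫_E div f` over smooth
vector fields compactly supported in the open square with `τ*(f) ≤ 1`. -/
def surfE (τ : ℝ × ℝ → ℝ) (E : Set (ℝ × ℝ)) : ℝ≥0∞ :=
  ⨆ f ∈ {f : ℝ × ℝ → ℝ × ℝ |
      ContDiff ℝ (⊤ : ℕ∞) f ∧ HasCompactSupport f ∧ tsupport f ⊆ Osq ∧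
        ∀ x, dualNorm τ (f x) ≤ 1},
    ENNReal.ofReal (∫ x in E, div2 f x)

/-- `E ∈ 𝒞`: `E` is a subset of `[-1,1]²` of finite perimeter. -/
def MemC (E : Set (ℝ × ℝ)) : Prop := E ⊆ Isq ∧ per E ≠ ⊤

open Classical in
/-- The conductance `I_τ(∂E)/Leb(E)` of `E`, with the convention `0/0 = ∞`. -/
def conduct (τ : ℝ × ℝ → ℝ) (E : Set (ℝ × ℝ)) : ℝ≥0∞ :=
  if volume E = 0 then ⊤ else surfE τ E / volume E

/-- The optimal conductance `ψ_τ^(a)` over sets of finite perimeter in the square. -/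
def psi (τ : ℝ × ℝ → ℝ) (a : ℝ) : ℝ≥0∞ :=
  ⨅ E ∈ {E : Set (ℝ × ℝ) | MemC E ∧ volume E ≤ ENNReal.ofReal a}, conduct τ E

/-- The set of optimizers `𝒞_τ^(a)`. -/
def Copt (τ : ℝ × ℝ → ℝ) (a : ℝ) : Set (Set (ℝ × ℝ)) :=
  {E | MemC E ∧ volume E ≤ ENNReal.ofReal a ∧ conduct τ E = psi τ a}

/-- A set of finite perimeter is decomposable if it can be split into two parts of positive
measure whose perimeters add up to the perimeter of the whole. -/
def Decomposable (E : Set (ℝ × ℝ)) : Prop :=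
  ∃ A B : Set (ℝ × ℝ), E = A ∪ B ∧ Disjoint A B ∧ 0 < volume A ∧ 0 < volume B ∧
    per E = per A + per B

/-- The length of the curve `γ` measured with the gauge `β`: the supremum, over partitions
`0 = t₀ ≤ t₁ ≤ ⋯ ≤ t_n = 1`, of `∑ β(γ(t_j) - γ(t_{j-1}))`. -/
def varLength (β : ℝ × ℝ → ℝ) (γ : ℝ → ℝ × ℝ) : ℝ≥0∞ :=
  ⨆ (n : ℕ) (t : Fin (n + 1) → ℝ)
    (_ : Monotone t ∧ t 0 = 0 ∧ t (Fin.last n) = 1),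
    ENNReal.ofReal (∑ i : Fin n, β (γ (t i.succ) - γ (t i.castSucc)))

/-- `C` is a rectifiable Jordan curve: the image of a continuous injective map of the unit
circle (equivalently, a continuous `1`-periodic map injective on `[0,1)`) of finite length. -/
def IsRectJordanCurve (C : Set (ℝ × ℝ)) : Prop :=
  ∃ γ : ℝ → ℝ × ℝ, Continuous γ ∧ (∀ t, γ (t + 1) = γ t) ∧
    Set.InjOn γ (Set.Ico 0 1) ∧ C = γ '' Set.Icc 0 1 ∧ varLength eNorm2 γ ≠ ⊤

/-- The hull of a curve `C`: the union of `C` with all bounded connected components of its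
complement. -/
def hullSet (C : Set (ℝ × ℝ)) : Set (ℝ × ℝ) :=
  C ∪ {x | x ∉ C ∧ Bornology.IsBounded (connectedComponentIn Cᶜ x)}

/-- `R ∈ ℛ`: `R` is a compact subset of the square with nonempty interior whose boundary is
a finite union of rectifiable Jordan curves, any two of which have `ℋ¹`-null intersection. -/
def MemR (R : Set (ℝ × ℝ)) : Prop :=
  IsCompact R ∧ R ⊆ Isq ∧ (interior R).Nonempty ∧
    ∃ F : Finset (Set (ℝ × ℝ)),
      (∀ C ∈ F, IsRectJordanCurve C) ∧ frontier R = ⋃ C ∈ F, C ∧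
        ∀ C ∈ F, ∀ C' ∈ F, C ≠ C' →
          (MeasureTheory.Measure.hausdorffMeasure 1 : Measure (ℝ × ℝ)) (C ∩ C') = 0

/-- The optimal conductance `φ_τ^(a)` over the class `ℛ`. -/
def phiR (τ : ℝ × ℝ → ℝ) (a : ℝ) : ℝ≥0∞ :=
  ⨅ R ∈ {R : Set (ℝ × ℝ) | MemR R ∧ volume R ≤ ENNReal.ofReal a}, conduct τ R

/-- The set of optimizers `ℛ_τ^(a)`. -/
def Ropt (τ : ℝ × ℝ → ℝ) (a : ℝ) : Set (Set (ℝ × ℝ)) :=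
  {R | MemR R ∧ volume R ≤ ENNReal.ofReal a ∧ conduct τ R = phiR τ a}

/-- `L¹` convergence of sets: `Leb(E_k Δ E₀) → 0`. -/
def TendstoL1 (E : ℕ → Set (ℝ × ℝ)) (E₀ : Set (ℝ × ℝ)) : Prop :=
  Tendsto (fun k => volume (symmDiff (E k) E₀)) atTop (nhds 0)

/-- `ρ` is a (piecewise-linear) polygonal curve on `[0,1]`. -/
def IsPolygonal (ρ : ℝ → ℝ × ℝ) : Prop :=
  ∃ (n : ℕ) (s : Fin (n + 1) → ℝ), Monotone s ∧ s 0 = 0 ∧ s (Fin.last n) = 1 ∧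
    ∀ i : Fin n, ∀ t ∈ Set.Icc (s i.castSucc) (s i.succ),
      ρ t = ρ (s i.castSucc) +
        ((t - s i.castSucc) / (s i.succ - s i.castSucc)) • (ρ (s i.succ) - ρ (s i.castSucc))

end

section
open MeasureTheory Set Filter ENNReal Topology

noncomputable section

/-- The Wulff shape (unit ball of the dual norm). -/
def KK (τ : ℝ × ℝ → ℝ) : Set (ℝ × ℝ) := {z | ∀ v : ℝ × ℝ, v.1 * z.1 + v.2 * z.2 ≤ τ v}

lemma IsNorm2.nonneg {τ : ℝ × ℝ → ℝ} (hτ : IsNorm2 τ) (x : ℝ × ℝ) : 0 ≤ τ x := by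
  have h1 := hτ.2.2 x (-x)
  have h2 := hτ.2.1 (-1) x
  have h3 := (hτ.1 (x + -x)).2 (by simp)
  simp at h2 h3
  rw [h2] at h1
  simp at h1
  rw [h3] at h1
  linarith

lemma IsNorm2.neg {τ : ℝ × ℝ → ℝ} (hτ : IsNorm2 τ) (x : ℝ × ℝ) : τ (-x) = τ x := by
  have h2 := hτ.2.1 (-1) x
  simpa using h2

lemma IsNorm2.upper {τ : ℝ × ℝ → ℝ} (hτ : IsNorm2 τ) :
    ∃ C > 0, ∀ v, τ v ≤ C * ‖v‖ := by
  refine ⟨τ (1, 0) + τ (0, 1) + 1, by linarith [hτ.nonneg (1, 0), hτ.nonneg (0, 1)], fun v => ?_⟩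
  have h1 : v = v.1 • ((1 : ℝ), (0 : ℝ)) + v.2 • ((0 : ℝ), (1 : ℝ)) := by ext <;> simp
  have h2 := hτ.2.2 (v.1 • ((1 : ℝ), (0 : ℝ))) (v.2 • ((0 : ℝ), (1 : ℝ)))
  rw [← h1, hτ.2.1, hτ.2.1] at h2
  have h3 : |v.1| ≤ ‖v‖ := norm_fst_le v
  have h4 : |v.2| ≤ ‖v‖ := norm_snd_le v
  nlinarith [hτ.nonneg (1, 0), hτ.nonneg (0, 1), norm_nonneg v]

lemma IsNorm2.continuous {τ : ℝ × ℝ → ℝ} (hτ : IsNorm2 τ) : Continuous τ := by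
  obtain ⟨C, hC, h⟩ := hτ.upper
  have : LipschitzWith (Real.toNNReal C) τ := by
    apply LipschitzWith.of_dist_le_mul
    intro x y
    rw [Real.coe_toNNReal _ hC.le, Real.dist_eq, dist_eq_norm, abs_le]
    have h1 := hτ.2.2 (x - y) y
    have h2 := hτ.2.2 (y - x) x
    have h3 := h (x - y)
    have h4 := h (y - x)
    rw [norm_sub_rev] at h4
    simp at h1 h2
    constructor <;> linarith
  exact this.continuous

lemma IsNorm2.lower {τ : ℝ × ℝ → ℝ} (hτ : IsNorm2 τ) :
    ∃ c > 0, ∀ v, c * ‖v‖ ≤ τ v := by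
  have hne : (Metric.sphere (0 : ℝ × ℝ) 1).Nonempty := NormedSpace.sphere_nonempty.2 zero_le_one
  obtain ⟨x, hx, hmin⟩ := (isCompact_sphere (0 : ℝ × ℝ) 1).exists_isMinOn hne
    hτ.continuous.continuousOn
  have hx0 : x ≠ 0 := by
    rintro rfl
    simp at hx
  refine ⟨τ x, lt_of_le_of_ne (hτ.nonneg x) (fun h => hx0 ((hτ.1 x).1 h.symm)), fun v => ?_⟩
  by_cases hv : v = 0
  · subst hv
    simp [(hτ.1 0).2 rfl]
  have hv' : 0 < ‖v‖ := norm_pos_iff.2 hv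
  have := hmin (a := ‖v‖⁻¹ • v) (by simp [norm_smul, hv])
  simp only [Set.mem_ofPred_eq] at this
  rw [hτ.2.1, abs_of_pos (inv_pos.2 hv')] at this
  calc τ x * ‖v‖ ≤ (‖v‖⁻¹ * τ v) * ‖v‖ := by gcongr
    _ = τ v := by field_simp

lemma dot_le_norm (v w : ℝ × ℝ) : v.1 * w.1 + v.2 * w.2 ≤ 2 * ‖v‖ * ‖w‖ := by
  have h1 : |v.1| ≤ ‖v‖ := norm_fst_le v
  have h2 : |v.2| ≤ ‖v‖ := norm_snd_le v
  have h3 : |w.1| ≤ ‖w‖ := norm_fst_le w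
  have h4 : |w.2| ≤ ‖w‖ := norm_snd_le w
  have h5 : v.1 * w.1 ≤ |v.1| * |w.1| := by rw [← abs_mul]; exact le_abs_self _
  have h6 : v.2 * w.2 ≤ |v.2| * |w.2| := by rw [← abs_mul]; exact le_abs_self _
  have h7 : |v.1| * |w.1| ≤ ‖v‖ * ‖w‖ := by gcongr
  have h8 : |v.2| * |w.2| ≤ ‖v‖ * ‖w‖ := by gcongr
  linarith

lemma dual_bdd {τ : ℝ × ℝ → ℝ} (hτ : IsNorm2 τ) (w : ℝ × ℝ) :
    BddAbove {x | ∃ v : ℝ × ℝ, τ v ≤ 1 ∧ x = v.1 * w.1 + v.2 * w.2} := by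
  obtain ⟨c, hc, h⟩ := hτ.lower
  refine ⟨2 * c⁻¹ * ‖w‖, ?_⟩
  rintro x ⟨v, hv, rfl⟩
  have h1 : ‖v‖ ≤ c⁻¹ := by
    rw [← one_div, le_div_iff₀ hc]
    linarith [h v]
  refine (dot_le_norm v w).trans ?_
  gcongr

lemma dualNorm_le_iff {τ : ℝ × ℝ → ℝ} (hτ : IsNorm2 τ) {r : ℝ} (hr : 0 ≤ r) (w : ℝ × ℝ) :
    dualNorm τ w ≤ r ↔ ∀ v : ℝ × ℝ, v.1 * w.1 + v.2 * w.2 ≤ r * τ v := by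
  constructor
  · intro h v
    by_cases hv : v = 0
    · subst hv
      simp [(hτ.1 0).2 rfl]
    have hp : 0 < τ v := lt_of_le_of_ne (hτ.nonneg v) (fun h => hv ((hτ.1 v).1 h.symm))
    have h1 : (τ v)⁻¹ * (v.1 * w.1 + v.2 * w.2) ≤ r := by
      refine le_trans (le_csSup (dual_bdd hτ w) ⟨(τ v)⁻¹ • v, ?_, ?_⟩) h
      · rw [hτ.2.1, abs_of_pos (inv_pos.2 hp), inv_mul_cancel₀ hp.ne']
      · simp; ring
    rw [inv_mul_le_iff₀ hp] at h1
    linarith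
  · intro h
    refine csSup_le (show Set.Nonempty _ from ⟨0, 0, by simp [(hτ.1 0).2 rfl], by simp⟩) ?_
    rintro x ⟨v, hv, rfl⟩
    refine (h v).trans ?_
    nlinarith

lemma mem_KK_iff {τ : ℝ × ℝ → ℝ} (hτ : IsNorm2 τ) (w : ℝ × ℝ) : dualNorm τ w ≤ 1 ↔ w ∈ KK τ := by
  rw [dualNorm_le_iff hτ zero_le_one]
  simp [KK]

lemma dual_pair {τ : ℝ × ℝ → ℝ} (hτ : IsNorm2 τ) {v w : ℝ × ℝ} (hv : τ v ≤ 1) :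
    v.1 * w.1 + v.2 * w.2 ≤ dualNorm τ w := le_csSup (dual_bdd hτ w) ⟨v, hv, rfl⟩

lemma dualNorm_nonneg {τ : ℝ × ℝ → ℝ} (hτ : IsNorm2 τ) (w : ℝ × ℝ) : 0 ≤ dualNorm τ w := by
  have := dual_pair hτ (v := 0) (w := w) (by simp [(hτ.1 0).2 rfl])
  simpa using this

lemma dual_dot {τ : ℝ × ℝ → ℝ} (hτ : IsNorm2 τ) (v w : ℝ × ℝ) :
    v.1 * w.1 + v.2 * w.2 ≤ dualNorm τ w * τ v :=
  (dualNorm_le_iff hτ (dualNorm_nonneg hτ w) w).1 le_rfl v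

lemma isNorm2_dualNorm {τ : ℝ × ℝ → ℝ} (hτ : IsNorm2 τ) : IsNorm2 (dualNorm τ) := by
  have hsub : ∀ (c : ℝ) (x), dualNorm τ (c • x) ≤ |c| * dualNorm τ x := by
    intro c x
    rw [dualNorm_le_iff hτ (mul_nonneg (abs_nonneg _) (dualNorm_nonneg hτ x))]
    intro v
    have := dual_dot hτ (c • v) x
    rw [hτ.2.1] at this
    simp at this ⊢
    linarith
  refine ⟨fun x => ⟨fun h => ?_, ?_⟩, fun c x => ?_, fun x y => ?_⟩
  · have h1 := dual_dot hτ x x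
    rw [h] at h1
    have h2 : x.1 = 0 := by nlinarith [sq_nonneg x.1, sq_nonneg x.2]
    have h3 : x.2 = 0 := by nlinarith [sq_nonneg x.1, sq_nonneg x.2]
    exact Prod.ext h2 h3
  · rintro rfl
    apply le_antisymm _ (dualNorm_nonneg hτ _)
    rw [dualNorm_le_iff hτ le_rfl]
    simp
  · apply le_antisymm (hsub c x)
    by_cases hc : c = 0
    · subst hc
      simpa using dualNorm_nonneg hτ _
    have := hsub c⁻¹ (c • x)
    rw [smul_smul, inv_mul_cancel₀ hc, one_smul, abs_inv] at this
    rwa [inv_mul_eq_div, le_div_iff₀ (abs_pos.2 hc), mul_comm] at this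
  · rw [dualNorm_le_iff hτ (add_nonneg (dualNorm_nonneg hτ x) (dualNorm_nonneg hτ y))]
    intro v
    have h1 := dual_dot hτ v x
    have h2 := dual_dot hτ v y
    simp
    linarith

lemma KK_convex (τ : ℝ × ℝ → ℝ) : Convex ℝ (KK τ) := by
  intro x hx y hy a b ha hb hab v
  have h1 := mul_le_mul_of_nonneg_left (hx v) ha
  have h2 := mul_le_mul_of_nonneg_left (hy v) hb
  have : a * τ v + b * τ v = τ v := by rw [← add_mul, hab, one_mul]
  simp
  linarith

lemma KK_closed (τ : ℝ × ℝ → ℝ) : IsClosed (KK τ) := by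
  have : KK τ = ⋂ v : ℝ × ℝ, {z | v.1 * z.1 + v.2 * z.2 ≤ τ v} := by
    ext z; simp [KK]
  rw [this]
  exact isClosed_iInter fun v => isClosed_le (by fun_prop) (by fun_prop)

lemma KK_zero {τ : ℝ × ℝ → ℝ} (hτ : IsNorm2 τ) : (0 : ℝ × ℝ) ∈ KK τ := by
  intro v
  simpa using hτ.nonneg v

lemma KK_neg {τ : ℝ × ℝ → ℝ} (hτ : IsNorm2 τ) {z : ℝ × ℝ} (hz : z ∈ KK τ) : -z ∈ KK τ := by
  intro v
  have := hz (-v)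
  rw [hτ.neg] at this
  simp at this ⊢
  linarith

lemma KK_smul {τ : ℝ × ℝ → ℝ} (hτ : IsNorm2 τ) {z : ℝ × ℝ} (hz : z ∈ KK τ) {s : ℝ}
    (h0 : 0 ≤ s) (h1 : s ≤ 1) : s • z ∈ KK τ :=
  (KK_convex τ).smul_mem_of_zero_mem (KK_zero hτ) hz ⟨h0, h1⟩

lemma KK_bdd {τ : ℝ × ℝ → ℝ} (hτ : IsNorm2 τ) : ∃ C > 0, ∀ z ∈ KK τ, ‖z‖ ≤ C := by
  obtain ⟨C, hC, h⟩ := hτ.upper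
  refine ⟨C, hC, fun z hz => ?_⟩
  have e1 : τ (1, 0) ≤ C := by simpa using h (1, 0)
  have e2 : τ (0, 1) ≤ C := by simpa using h (0, 1)
  have e3 : τ (-1, 0) ≤ C := by simpa using h (-1, 0)
  have e4 : τ (0, -1) ≤ C := by simpa using h (0, -1)
  have h1 := hz (1, 0)
  have h2 := hz (0, 1)
  have h3 := hz (-1, 0)
  have h4 := hz (0, -1)
  simp at h1 h2 h3 h4
  rw [Prod.norm_def, max_le_iff]
  constructor <;> rw [Real.norm_eq_abs, abs_le] <;> constructor <;> linarith

lemma KK_nhds {τ : ℝ × ℝ → ℝ} (hτ : IsNorm2 τ) : ∃ c > 0, ∀ z : ℝ × ℝ, ‖z‖ ≤ c → z ∈ KK τ := by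
  obtain ⟨c, hc, h⟩ := hτ.lower
  refine ⟨c / 2, by positivity, fun z hz v => ?_⟩
  refine (dot_le_norm v z).trans (le_trans ?_ (h v))
  nlinarith [norm_nonneg v]

end

end

section
open MeasureTheory Set Filter ENNReal Topology

noncomputable section

lemma det_prod (L : (ℝ × ℝ) →L[ℝ] (ℝ × ℝ)) :
    L.det = (L (1, 0)).1 * (L (0, 1)).2 - (L (0, 1)).1 * (L (1, 0)).2 := by
  rw [ContinuousLinearMap.det, ← LinearMap.det_toMatrix (Module.Basis.finTwoProd ℝ),
    Matrix.det_fin_two]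
  simp [LinearMap.toMatrix_apply]

lemma div2_continuous {f : ℝ × ℝ → ℝ × ℝ} (hf : ContDiff ℝ (⊤ : ℕ∞) f) : Continuous (div2 f) := by
  have h : Continuous (fderiv ℝ f) := hf.continuous_fderiv (by simp)
  unfold div2
  fun_prop

lemma div2_zero_of {f : ℝ × ℝ → ℝ × ℝ} {x : ℝ × ℝ} (hx : x ∉ tsupport f) : div2 f x = 0 := by
  have : fderiv ℝ f x = 0 := by
    have h := support_fderiv_subset ℝ (f := f)
    by_contra hne
    exact hx (h hne)
  simp [div2, this]

lemma div2_cpt {f : ℝ × ℝ → ℝ × ℝ} (hc : HasCompactSupport f) : HasCompactSupport (div2 f) :=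
  HasCompactSupport.intro hc (fun _ hx => div2_zero_of hx)

lemma div2_integrable {f : ℝ × ℝ → ℝ × ℝ} (hf : ContDiff ℝ (⊤ : ℕ∞) f)
    (hc : HasCompactSupport f) : Integrable (div2 f) :=
  (div2_continuous hf).integrable_of_hasCompactSupport (div2_cpt hc)

lemma energy_upper {f : ℝ × ℝ → ℝ × ℝ} (hf : ContDiff ℝ (⊤ : ℕ∞) f)
    (hc : HasCompactSupport f) {A : Set (ℝ × ℝ)} (hA : MeasurableSet A) (hfin : volume A ≠ ⊤)
    {M C ε0 : ℝ} (hM : 0 ≤ M) (hC : 0 ≤ C) (hε0 : 0 < ε0)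
    (h : ∀ ε ∈ Ioo 0 ε0, volume ((fun z => z + ε • f z) '' A) ≤
      ENNReal.ofReal (volume.real A + ε * M + C * ε ^ 2)) : ∫ x in A, div2 f x ≤ M := by
  have hder : ∀ x, HasFDerivAt f (fderiv ℝ f x) x := fun x =>
    (hf.differentiable (by simp) x).hasFDerivAt
  have hcf : Continuous (fderiv ℝ f) := hf.continuous_fderiv (by simp)
  obtain ⟨B, hB⟩ : ∃ B, ∀ x, ‖fderiv ℝ f x‖ ≤ B := (hc.fderiv ℝ).exists_bound_of_continuous hcf
  have hB0 : 0 ≤ B := (norm_nonneg _).trans (hB 0)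
  have hlip : LipschitzWith (Real.toNNReal B) f := by
    apply lipschitzWith_of_nnnorm_fderiv_le (hf.differentiable (by simp))
    intro x
    rw [← NNReal.coe_le_coe, Real.coe_toNNReal _ hB0]
    exact hB x
  -- the determinant function
  set D : ℝ × ℝ → ℝ := fun x => (fderiv ℝ f x (1, 0)).1 * (fderiv ℝ f x (0, 1)).2
    - (fderiv ℝ f x (0, 1)).1 * (fderiv ℝ f x (1, 0)).2 with hD
  have hDc : Continuous D := by rw [hD]; fun_prop
  have hent : ∀ x, ‖fderiv ℝ f x (1, 0)‖ ≤ B ∧ ‖fderiv ℝ f x (0, 1)‖ ≤ B := by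
    intro x
    constructor
    · refine ((fderiv ℝ f x).le_opNorm _).trans ?_
      simpa using hB x
    · refine ((fderiv ℝ f x).le_opNorm _).trans ?_
      simpa using hB x
  have hdivb : ∀ x, |div2 f x| ≤ 2 * B := by
    intro x
    have h1 : |(fderiv ℝ f x (1, 0)).1| ≤ B := (norm_fst_le _).trans (hent x).1
    have h2 : |(fderiv ℝ f x (0, 1)).2| ≤ B := (norm_snd_le _).trans (hent x).2
    refine (abs_add_le _ _).trans ?_
    linarith
  have hDb : ∀ x, |D x| ≤ 2 * B ^ 2 := by
    intro x
    have h1 : |(fderiv ℝ f x (1, 0)).1| ≤ B := (norm_fst_le _).trans (hent x).1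
    have h2 : |(fderiv ℝ f x (0, 1)).2| ≤ B := (norm_snd_le _).trans (hent x).2
    have h3 : |(fderiv ℝ f x (0, 1)).1| ≤ B := (norm_fst_le _).trans (hent x).2
    have h4 : |(fderiv ℝ f x (1, 0)).2| ≤ B := (norm_snd_le _).trans (hent x).1
    refine (abs_sub _ _).trans ?_
    rw [abs_mul, abs_mul]
    have h5 : |(fderiv ℝ f x (1, 0)).1| * |(fderiv ℝ f x (0, 1)).2| ≤ B * B := by gcongr
    have h6 : |(fderiv ℝ f x (0, 1)).1| * |(fderiv ℝ f x (1, 0)).2| ≤ B * B := by gcongr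
    linarith
  have hdivI : IntegrableOn (div2 f) A := (div2_integrable hf hc).integrableOn
  have hDI : IntegrableOn D A := by
    refine Measure.integrableOn_of_bounded (M := 2 * B ^ 2) hfin hDc.aestronglyMeasurable ?_
    exact Filter.Eventually.of_forall fun x => hDb x
  -- main inequality
  have key : ∀ ε ∈ Ioo (0 : ℝ) (min ε0 (1 / (4 * B + 4))),
      (∫ x in A, div2 f x) - M ≤ ε * (C + 2 * B ^ 2 * volume.real A) := by
    intro ε hε
    have hε1 : 0 < ε := hε.1
    have hε2 : ε < ε0 := hε.2.trans_le (min_le_left _ _)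
    have hε3 : ε * (4 * B + 4) < 1 := by
      have := hε.2.trans_le (min_le_right _ _)
      rwa [lt_div_iff₀ (by positivity)] at this
    have hinj : InjOn (fun z => z + ε • f z) A := by
      intro x _ y _ hxy
      simp only at hxy
      have h1 : x - y = ε • (f y - f x) := by
        rw [smul_sub, sub_eq_sub_iff_add_eq_add, hxy, add_comm]
      have h2 : ‖f y - f x‖ ≤ B * ‖x - y‖ := by
        have := hlip.dist_le_mul y x
        rw [Real.coe_toNNReal _ hB0, dist_eq_norm, dist_eq_norm, norm_sub_rev y x] at this
        exact this
      have h3 : ‖x - y‖ ≤ ε * (B * ‖x - y‖) := by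
        calc ‖x - y‖ = ‖ε • (f y - f x)‖ := by rw [← h1]
          _ = ε * ‖f y - f x‖ := by rw [norm_smul, Real.norm_of_nonneg hε1.le]
          _ ≤ _ := by gcongr
      have h4 : ‖x - y‖ ≤ 0 := by
        have := norm_nonneg (x - y)
        by_contra hcon
        push Not at hcon
        have : ε * B < 1 := by nlinarith
        nlinarith
      exact sub_eq_zero.1 (norm_le_zero_iff.1 h4)
    have hd : ∀ x ∈ A, HasFDerivWithinAt (fun z => z + ε • f z)
        (ContinuousLinearMap.id ℝ (ℝ × ℝ) + ε • fderiv ℝ f x) A x := fun x _ =>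
      ((hasFDerivAt_id x).add ((hder x).const_smul ε)).hasFDerivWithinAt
    have hv := lintegral_abs_det_fderiv_eq_addHaar_image volume hA hd hinj
    have hdet : ∀ x, (ContinuousLinearMap.id ℝ (ℝ × ℝ) + ε • fderiv ℝ f x).det
        = 1 + ε * div2 f x + ε ^ 2 * D x := by
      intro x
      rw [det_prod]
      simp [div2, hD]
      ring
    have hpos : ∀ x, 0 ≤ 1 + ε * div2 f x + ε ^ 2 * D x := by
      intro x
      have h1 := (abs_le.1 (hdivb x)).1
      have h2 := (abs_le.1 (hDb x)).1
      have h3 : ε * B ≤ 1 / 4 := by nlinarith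
      have h4 : (ε * B) ^ 2 ≤ 1 / 16 := by
        have : 0 ≤ ε * B := by positivity
        nlinarith
      have h5 : ε * div2 f x ≥ ε * (-(2 * B)) := by gcongr
      have h6 : ε ^ 2 * D x ≥ ε ^ 2 * (-(2 * B ^ 2)) := by gcongr
      nlinarith
    have hitg : IntegrableOn (fun x => 1 + ε * div2 f x + ε ^ 2 * D x) A := by
      refine Integrable.add (Integrable.add ?_ ?_) ?_
      · exact integrableOn_const hfin
      · exact hdivI.const_mul ε
      · exact hDI.const_mul _
    have hv2 : ENNReal.ofReal (∫ x in A, (1 + ε * div2 f x + ε ^ 2 * D x)) ≤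
        ENNReal.ofReal (volume.real A + ε * M + C * ε ^ 2) := by
      rw [ofReal_integral_eq_lintegral_ofReal hitg (Filter.Eventually.of_forall fun x => hpos x)]
      refine le_trans (le_of_eq ?_) (h ε ⟨hε1, hε2⟩)
      rw [← hv]
      refine lintegral_congr fun x => ?_
      rw [hdet, abs_of_nonneg (hpos x)]
    have hI : ∫ x in A, (1 + ε * div2 f x + ε ^ 2 * D x) =
        volume.real A + ε * (∫ x in A, div2 f x) + ε ^ 2 * ∫ x in A, D x := by
      rw [integral_add, integral_add, integral_const_mul, integral_const_mul]
      · simp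
      · exact integrableOn_const hfin
      · exact hdivI.const_mul ε
      · exact Integrable.add (integrableOn_const hfin) (hdivI.const_mul ε)
      · exact hDI.const_mul _
    have hDint : |∫ x in A, D x| ≤ 2 * B ^ 2 * volume.real A := by
      have := norm_setIntegral_le_of_norm_le_const (f := D) (C := 2 * B ^ 2) hfin.lt_top
        (fun x _ => hDb x)
      simpa using this
    rw [hI] at hv2
    have hpos' : 0 ≤ volume.real A + ε * M + C * ε ^ 2 := by positivity
    have hv3 := (ENNReal.ofReal_le_ofReal_iff hpos').1 hv2
    have h7 := (abs_le.1 hDint).1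
    have h8 : ε ^ 2 * ∫ x in A, D x ≥ ε ^ 2 * (-(2 * B ^ 2 * volume.real A)) := by gcongr
    have h9 : ε * ((∫ x in A, div2 f x) - M) ≤ ε * (ε * (C + 2 * B ^ 2 * volume.real A)) := by
      nlinarith
    exact le_of_mul_le_mul_left h9 hε1
  have hm : 0 < min ε0 (1 / (4 * B + 4)) := lt_min hε0 (by positivity)
  have hT : Tendsto (fun ε : ℝ => ε * (C + 2 * B ^ 2 * volume.real A)) (𝓝[>] 0) (𝓝 0) := by
    have : Continuous (fun ε : ℝ => ε * (C + 2 * B ^ 2 * volume.real A)) := by fun_prop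
    have h0 := this.tendsto 0
    simp only [zero_mul] at h0
    exact h0.mono_left nhdsWithin_le_nhds
  have := ge_of_tendsto hT (by
    filter_upwards [Ioo_mem_nhdsGT hm] with ε hε using key ε hε)
  linarith


/-- Admissible fields for the energy in an open set `U`. -/
def adm (τ : ℝ × ℝ → ℝ) (U : Set (ℝ × ℝ)) : Set (ℝ × ℝ → ℝ × ℝ) :=
  {f : ℝ × ℝ → ℝ × ℝ |
      ContDiff ℝ (⊤ : ℕ∞) f ∧ HasCompactSupport f ∧ tsupport f ⊆ U ∧
        ∀ x, dualNorm τ (f x) ≤ 1}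

/-- The surface energy localised to `U`. -/
def surfU (τ : ℝ × ℝ → ℝ) (U E : Set (ℝ × ℝ)) : ℝ≥0∞ :=
  ⨆ f ∈ adm τ U, ENNReal.ofReal (∫ x in E, div2 f x)

lemma surfE_eq (τ : ℝ × ℝ → ℝ) (E : Set (ℝ × ℝ)) : surfE τ E = surfU τ Osq E := rfl

lemma le_surfU {τ : ℝ × ℝ → ℝ} {U E : Set (ℝ × ℝ)} {f : ℝ × ℝ → ℝ × ℝ} (hf : f ∈ adm τ U) :
    ENNReal.ofReal (∫ x in E, div2 f x) ≤ surfU τ U E :=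
  le_iSup₂ (f := fun f (_ : f ∈ adm τ U) => ENNReal.ofReal (∫ x in E, div2 f x)) f hf

lemma surfU_congr {τ : ℝ × ℝ → ℝ} {U E F : Set (ℝ × ℝ)} (h : E =ᵐ[volume] F) :
    surfU τ U E = surfU τ U F := by
  unfold surfU
  simp_rw [setIntegral_congr_set h]

lemma mem_Isq {z : ℝ × ℝ} : z ∈ Isq ↔ (-1 ≤ z.1 ∧ z.1 ≤ 1) ∧ (-1 ≤ z.2 ∧ z.2 ≤ 1) := by
  simp only [Isq, Set.mem_Icc, Prod.le_def]
  tauto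

end

end

section
open MeasureTheory Set Filter ENNReal Topology

noncomputable section

/-- The true open square. -/
def Oq : Set (ℝ × ℝ) := Ioo (-1) 1 ×ˢ Ioo (-1) 1

lemma Oq_sub : Oq ⊆ Osq := by
  rintro ⟨x, y⟩ hz
  simp only [Oq, Set.mem_prod, Set.mem_Ioo] at hz
  simp only [Osq, Set.mem_Ioo, Prod.lt_iff]
  exact ⟨Or.inl ⟨hz.1.1, hz.2.1.le⟩, Or.inl ⟨hz.1.2, hz.2.2.le⟩⟩

lemma Osq_sub : Osq ⊆ Isq := fun _ hz => ⟨hz.1.le, hz.2.le⟩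

lemma Isq_prod : Isq = Icc (-1) 1 ×ˢ Icc (-1) 1 := by
  ext z; rw [mem_Isq, Set.mem_prod, Set.mem_Icc, Set.mem_Icc]

lemma isCompact_Isq : IsCompact Isq := by
  rw [Isq_prod]; exact isCompact_Icc.prod isCompact_Icc

lemma convex_Isq : Convex ℝ Isq := by
  rw [Isq_prod]; exact (convex_Icc _ _).prod (convex_Icc _ _)

lemma measurable_Isq : MeasurableSet Isq := isCompact_Isq.measurableSet

lemma volume_Isq : volume Isq = 4 := by
  rw [Isq_prod, Measure.volume_eq_prod, Measure.prod_prod, Real.volume_Icc,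
    ← ENNReal.ofReal_mul (by norm_num)]
  norm_num

lemma adm_mono {τ : ℝ × ℝ → ℝ} {U V : Set (ℝ × ℝ)} (h : U ⊆ V) : adm τ U ⊆ adm τ V :=
  fun _ hf => ⟨hf.1, hf.2.1, hf.2.2.1.trans h, hf.2.2.2⟩

lemma surfU_mono {τ : ℝ × ℝ → ℝ} {U V E : Set (ℝ × ℝ)} (h : U ⊆ V) :
    surfU τ U E ≤ surfU τ V E :=
  iSup₂_le fun _ hf => le_surfU (adm_mono h hf)

lemma surfE_le (τ : ℝ × ℝ → ℝ) (E : Set (ℝ × ℝ)) : surfE τ E ≤ surfU τ Isq E := by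
  rw [surfE_eq]; exact surfU_mono Osq_sub

lemma le_surfE (τ : ℝ × ℝ → ℝ) (E : Set (ℝ × ℝ)) : surfU τ Oq E ≤ surfE τ E := by
  rw [surfE_eq]; exact surfU_mono Oq_sub

lemma adm_neg {τ : ℝ × ℝ → ℝ} (hτ : IsNorm2 τ) {U : Set (ℝ × ℝ)} {f : ℝ × ℝ → ℝ × ℝ}
    (hf : f ∈ adm τ U) : (fun z => -f z) ∈ adm τ U := by
  have hs : Function.support (fun z => -f z) = Function.support f := by
    ext z; simp
  have ht : tsupport (fun z => -f z) = tsupport f := by simp only [tsupport, hs]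
  refine ⟨hf.1.neg, ?_, by rw [ht]; exact hf.2.2.1, fun x => ?_⟩
  · have := hf.2.1
    rw [HasCompactSupport] at this ⊢
    rwa [ht]
  · rw [(isNorm2_dualNorm hτ).neg]; exact hf.2.2.2 x

lemma div2_neg (f : ℝ × ℝ → ℝ × ℝ) (x : ℝ × ℝ) : div2 (fun z => -f z) x = - div2 f x := by
  have : fderiv ℝ (fun z => -f z) x = - fderiv ℝ f x := fderiv_neg
  simp [div2, this]; ring

/-- The flow of an admissible field preserves the square. -/
lemma flow_Isq {τ : ℝ × ℝ → ℝ} {U : Set (ℝ × ℝ)} (hU : U ⊆ Isq) {f : ℝ × ℝ → ℝ × ℝ}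
    (hf : f ∈ adm τ U) : ∃ ε0 : ℝ, 0 < ε0 ∧ ∀ ε ∈ Ioo 0 ε0, ∀ z ∈ Isq, z + ε • f z ∈ Isq := by
  obtain ⟨hfs, hc, hsub, -⟩ := hf
  have hcf : Continuous (fderiv ℝ f) := hfs.continuous_fderiv (by simp)
  obtain ⟨B, hB⟩ : ∃ B, ∀ x, ‖fderiv ℝ f x‖ ≤ B := (hc.fderiv ℝ).exists_bound_of_continuous hcf
  have hB0 : 0 ≤ B := (norm_nonneg _).trans (hB 0)
  have hlip : LipschitzWith (Real.toNNReal B) f := by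
    apply lipschitzWith_of_nnnorm_fderiv_le (hfs.differentiable (by simp))
    intro x
    rw [← NNReal.coe_le_coe, Real.coe_toNNReal _ hB0]
    exact hB x
  refine ⟨1 / (B + 1), by positivity, fun ε hε z hz => ?_⟩
  by_contra hcon
  have hε1 := hε.1
  have hε3 : ε * (B + 1) < 1 := by
    have := hε.2
    rwa [lt_div_iff₀ (by positivity)] at this
  have h0 : f (z + ε • f z) = 0 := by
    by_contra hne
    exact hcon (hU (hsub (subset_tsupport f hne)))
  have h1 := hlip.dist_le_mul (z + ε • f z) z
  rw [h0, Real.coe_toNNReal _ hB0, dist_eq_norm, dist_eq_norm, zero_sub, norm_neg,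
    add_sub_cancel_left, norm_smul, Real.norm_of_nonneg hε1.le] at h1
  have h2 : ‖f z‖ ≤ 0 := by
    by_contra h
    push Not at h
    nlinarith
  rw [norm_le_zero_iff.1 h2] at hcon
  simp at hcon
  exact hcon hz

/-- General upper bound on the energy through expansion of sets. -/
lemma surfU_upper {τ : ℝ × ℝ → ℝ} {A : Set (ℝ × ℝ)} (hA : MeasurableSet A) (hAI : A ⊆ Isq)
    {M C : ℝ} (hM : 0 ≤ M) (hC : 0 ≤ C) (B : ℝ → Set (ℝ × ℝ))
    (h1 : ∀ ε > 0, ∀ z ∈ A, ∀ w, dualNorm τ w ≤ 1 → z + ε • w ∈ Isq → z + ε • w ∈ B ε)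
    (h2 : ∀ ε > 0, volume (B ε) ≤ ENNReal.ofReal (volume.real A + ε * M + C * ε ^ 2)) :
    surfU τ Isq A ≤ ENNReal.ofReal M := by
  refine iSup₂_le fun f hf => ENNReal.ofReal_le_ofReal ?_
  obtain ⟨ε0, h0, hflow⟩ := flow_Isq le_rfl hf
  refine energy_upper hf.1 hf.2.1 hA ?_ hM hC h0 ?_
  · exact ((measure_mono hAI).trans_lt (by rw [volume_Isq]; simp)).ne
  · intro ε hε
    refine le_trans (measure_mono ?_) (h2 ε hε.1)
    rintro _ ⟨z, hz, rfl⟩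
    exact h1 ε hε.1 z hz _ (hf.2.2.2 z) (hflow ε hε z (hAI hz))

lemma int_Isq_zero {τ : ℝ × ℝ → ℝ} (hτ : IsNorm2 τ) {U : Set (ℝ × ℝ)} (hU : U ⊆ Isq)
    {f : ℝ × ℝ → ℝ × ℝ} (hf : f ∈ adm τ U) : ∫ x in Isq, div2 f x = 0 := by
  have key : ∀ f ∈ adm τ U, ∫ x in Isq, div2 f x ≤ 0 := by
    intro f hf
    obtain ⟨ε0, h0, hflow⟩ := flow_Isq hU hf
    refine energy_upper hf.1 hf.2.1 measurable_Isq (by rw [volume_Isq]; simp) le_rfl le_rfl h0 ?_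
    intro ε hε
    rw [mul_zero, zero_mul, add_zero, add_zero, measureReal_def, ENNReal.ofReal_toReal
      (by rw [volume_Isq]; simp)]
    refine measure_mono ?_
    rintro _ ⟨z, hz, rfl⟩
    exact hflow ε hε z hz
  have h1 := key f hf
  have h2 := key _ (adm_neg hτ hf)
  simp only [div2_neg, integral_neg] at h2
  linarith

lemma surfU_compl {τ : ℝ × ℝ → ℝ} (hτ : IsNorm2 τ) {U A : Set (ℝ × ℝ)} (hU : U ⊆ Isq)
    (hA : MeasurableSet A) (hAI : A ⊆ Isq) : surfU τ U (Isq \ A) = surfU τ U A := by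
  have key : ∀ f ∈ adm τ U, ∫ x in Isq \ A, div2 f x = - ∫ x in A, div2 f x := by
    intro f hf
    rw [setIntegral_sdiff (μ := volume) (f := div2 f) hA
      (div2_integrable hf.1 hf.2.1).integrableOn hAI,
      int_Isq_zero hτ hU hf, zero_sub]
  apply le_antisymm
  · refine iSup₂_le fun f hf => ?_
    rw [key f hf, ← integral_neg]
    simp_rw [← div2_neg]
    exact le_surfU (adm_neg hτ hf)
  · refine iSup₂_le fun f hf => ?_
    have := key _ (adm_neg hτ hf)
    simp_rw [div2_neg, integral_neg, neg_neg] at this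
    rw [← this]
    have h2 := le_surfU (E := Isq \ A) (adm_neg hτ hf)
    simp_rw [div2_neg, integral_neg] at h2
    exact h2

lemma surfU_inter {τ : ℝ × ℝ → ℝ} {U A B : Set (ℝ × ℝ)} (h : A ∩ U = B ∩ U)
    (hU : MeasurableSet U) :
    surfU τ U A = surfU τ U B := by
  have key : ∀ A : Set (ℝ × ℝ), ∀ f ∈ adm τ U, ∫ x in A, div2 f x = ∫ x in A ∩ U, div2 f x := by
    intro A f hf
    have : ∀ x ∉ U, div2 f x = 0 := fun x hx => div2_zero_of fun h => hx (hf.2.2.1 h)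
    have h2 : div2 f = U.indicator (div2 f) := by
      ext x
      by_cases hx : x ∈ U
      · simp [hx]
      · simp [hx, this x hx]
    conv_lhs => rw [h2, setIntegral_indicator hU]
  unfold surfU
  refine iSup_congr fun f => iSup_congr fun hf => ?_
  rw [key A f hf, key B f hf, h]

lemma div2_add {f g : ℝ × ℝ → ℝ × ℝ} (hf : ContDiff ℝ (⊤ : ℕ∞) f) (hg : ContDiff ℝ (⊤ : ℕ∞) g)
    (x : ℝ × ℝ) : div2 (fun z => f z + g z) x = div2 f x + div2 g x := by
  have : fderiv ℝ (fun z => f z + g z) x = fderiv ℝ f x + fderiv ℝ g x :=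
    fderiv_add (hf.differentiable (by simp) x) (hg.differentiable (by simp) x)
  simp [div2, this]; ring

lemma zero_adm {τ : ℝ × ℝ → ℝ} (hτ : IsNorm2 τ) (U : Set (ℝ × ℝ)) :
    (fun _ => (0 : ℝ × ℝ)) ∈ adm τ U := by
  have hs : tsupport (fun _ : ℝ × ℝ => (0 : ℝ × ℝ)) = ∅ := by
    rw [tsupport_eq_empty_iff]; rfl
  refine ⟨contDiff_const, ?_, ?_, ?_⟩
  · rw [HasCompactSupport, hs]; exact isCompact_empty
  · rw [hs]; exact empty_subset _
  · intro x
    rw [((isNorm2_dualNorm hτ).1 0).2 rfl]; exact zero_le_one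

lemma surfU_add {τ : ℝ × ℝ → ℝ} (hτ : IsNorm2 τ) {U V W E : Set (ℝ × ℝ)} (hUW : U ⊆ W)
    (hVW : V ⊆ W) (hd : Disjoint U V) : surfU τ U E + surfU τ V E ≤ surfU τ W E := by
  unfold surfU
  refine ENNReal.biSup_add_biSup_le ⟨_, zero_adm hτ U⟩ ⟨_, zero_adm hτ V⟩ ?_
  intro f hf g hg
  have hsupp : Function.support (fun z => f z + g z) ⊆ Function.support f ∪ Function.support g :=
    Function.support_add f g
  have ht : tsupport (fun z => f z + g z) ⊆ tsupport f ∪ tsupport g := by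
    rw [tsupport, tsupport, tsupport, ← closure_union]
    exact closure_mono hsupp
  have hadm : (fun z => f z + g z) ∈ adm τ W := by
    refine ⟨hf.1.add hg.1, hf.2.1.add hg.2.1, ht.trans (union_subset (hf.2.2.1.trans hUW)
      (hg.2.2.1.trans hVW)), fun x => ?_⟩
    show dualNorm τ (f x + g x) ≤ 1
    by_cases hx : f x = 0
    · rw [hx, zero_add]; exact hg.2.2.2 x
    · have : g x = 0 := by
        by_contra hne
        exact Set.disjoint_left.1 hd (hf.2.2.1 (subset_tsupport f hx))
          (hg.2.2.1 (subset_tsupport g hne))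
      rw [this, add_zero]; exact hf.2.2.2 x
  -- replace by positive parts
  by_cases h1 : 0 ≤ ∫ x in E, div2 f x
  · by_cases h2 : 0 ≤ ∫ x in E, div2 g x
    · rw [← ENNReal.ofReal_add h1 h2, ← integral_add (div2_integrable hf.1 hf.2.1).integrableOn
        (div2_integrable hg.1 hg.2.1).integrableOn]
      simp_rw [← div2_add hf.1 hg.1]
      exact le_surfU hadm
    · push Not at h2
      rw [ENNReal.ofReal_of_nonpos h2.le, add_zero]
      exact le_surfU (adm_mono hUW hf)
  · push Not at h1
    rw [ENNReal.ofReal_of_nonpos h1.le, zero_add]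
    exact le_surfU (adm_mono hVW hg)

end

end

section
open MeasureTheory Set Filter ENNReal Topology

noncomputable section

lemma div2_trace (f : ℝ × ℝ → ℝ × ℝ) (x : ℝ × ℝ) :
    div2 f x = LinearMap.trace ℝ (ℝ × ℝ) (fderiv ℝ f x : (ℝ × ℝ) →ₗ[ℝ] (ℝ × ℝ)) := by
  rw [LinearMap.trace_eq_matrix_trace ℝ (Module.Basis.finTwoProd ℝ), Matrix.trace_fin_two]
  simp [LinearMap.toMatrix_apply, div2]

/-- Measure preserving linear maps preserving the inner product. -/
structure SymL (σ : (ℝ × ℝ) ≃L[ℝ] (ℝ × ℝ)) : Prop where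
  dot : ∀ v w, (σ v).1 * (σ w).1 + (σ v).2 * (σ w).2 = v.1 * w.1 + v.2 * w.2
  mp : MeasurePreserving σ (volume : Measure (ℝ × ℝ)) volume

lemma SymL.symm {σ : (ℝ × ℝ) ≃L[ℝ] (ℝ × ℝ)} (h : SymL σ) : SymL σ.symm := by
  refine ⟨fun v w => ?_, ?_⟩
  · have := h.dot (σ.symm v) (σ.symm w)
    simpa using this.symm
  · exact MeasurePreserving.symm σ.toHomeomorph.toMeasurableEquiv h.mp

lemma SymL.trans {σ ρ : (ℝ × ℝ) ≃L[ℝ] (ℝ × ℝ)} (h : SymL σ) (h' : SymL ρ) :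
    SymL (σ.trans ρ) := by
  refine ⟨fun v w => ?_, ?_⟩
  · simp only [ContinuousLinearEquiv.trans_apply]
    rw [h'.dot, h.dot]
  · exact h'.mp.comp h.mp

/-- Swapping coordinates. -/
def swL : (ℝ × ℝ) ≃L[ℝ] (ℝ × ℝ) := ContinuousLinearEquiv.prodComm ℝ ℝ ℝ

/-- Reflecting the first coordinate. -/
def rfL : (ℝ × ℝ) ≃L[ℝ] (ℝ × ℝ) :=
  ContinuousLinearEquiv.prodCongr (ContinuousLinearEquiv.neg ℝ) (ContinuousLinearEquiv.refl ℝ ℝ)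

lemma swL_apply (z : ℝ × ℝ) : swL z = (z.2, z.1) := rfl
lemma rfL_apply (z : ℝ × ℝ) : rfL z = (-z.1, z.2) := rfl

lemma swL_sym : SymL swL := by
  refine ⟨fun v w => by simp only [swL_apply]; ring, ?_⟩
  exact Measure.measurePreserving_swap

lemma rfL_sym : SymL rfL := by
  refine ⟨fun v w => by simp only [rfL_apply]; ring, ?_⟩
  exact (Measure.measurePreserving_neg (volume : Measure ℝ)).prod (MeasurePreserving.id _)

lemma IsNorm2.comp {τ : ℝ × ℝ → ℝ} (hτ : IsNorm2 τ) (σ : (ℝ × ℝ) ≃L[ℝ] (ℝ × ℝ)) :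
    IsNorm2 (τ ∘ σ) := by
  refine ⟨fun x => ?_, fun c x => ?_, fun x y => ?_⟩
  · simp [hτ.1]
  · simp [hτ.2.1]
  · simpa using hτ.2.2 (σ x) (σ y)

lemma KK_comp {τ : ℝ × ℝ → ℝ} {σ : (ℝ × ℝ) ≃L[ℝ] (ℝ × ℝ)} (h : SymL σ) (w : ℝ × ℝ) :
    w ∈ KK (τ ∘ σ) ↔ σ w ∈ KK τ := by
  constructor
  · intro hw v
    have := hw (σ.symm v)
    rw [← h.dot] at this
    simpa using this
  · intro hw v
    rw [← h.dot]
    exact hw (σ v)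

/-- The affine homeomorphism `σ z + c`. -/
def affH (σ : (ℝ × ℝ) ≃L[ℝ] (ℝ × ℝ)) (c : ℝ × ℝ) : (ℝ × ℝ) ≃ₜ (ℝ × ℝ) :=
  σ.toHomeomorph.trans (Homeomorph.addRight c)

lemma affH_apply (σ : (ℝ × ℝ) ≃L[ℝ] (ℝ × ℝ)) (c z : ℝ × ℝ) : affH σ c z = σ z + c := rfl

lemma affH_symm_apply (σ : (ℝ × ℝ) ≃L[ℝ] (ℝ × ℝ)) (c z : ℝ × ℝ) :
    (affH σ c).symm z = σ.symm (z - c) := by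
  apply (affH σ c).injective
  simp [affH_apply]

lemma affH_mp {σ : (ℝ × ℝ) ≃L[ℝ] (ℝ × ℝ)} (h : SymL σ) (c : ℝ × ℝ) :
    MeasurePreserving (affH σ c) (volume : Measure (ℝ × ℝ)) volume :=
  (measurePreserving_add_right (volume : Measure (ℝ × ℝ)) c).comp h.mp

lemma surfU_map {τ : ℝ × ℝ → ℝ} (hτ : IsNorm2 τ) {σ : (ℝ × ℝ) ≃L[ℝ] (ℝ × ℝ)} (h : SymL σ)
    (c : ℝ × ℝ) (U E : Set (ℝ × ℝ)) :
    surfU (τ ∘ σ) U E ≤ surfU τ (affH σ c '' U) (affH σ c '' E) := by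
  refine iSup₂_le fun f hf => ?_
  set g : ℝ × ℝ → ℝ × ℝ := fun z => σ (f (σ.symm (z - c))) with hg
  have hga : ∀ z, g (affH σ c z) = σ (f z) := by
    intro z; simp [hg, affH_apply]
  have hgc : ContDiff ℝ (⊤ : ℕ∞) g := by
    have := hf.1
    exact σ.contDiff.comp (this.comp (σ.symm.contDiff.comp (contDiff_id.sub contDiff_const)))
  have hsupp : Function.support g = affH σ c '' Function.support f := by
    ext z
    obtain ⟨w, rfl⟩ := (affH σ c).surjective z
    rw [Function.mem_support, hga, (affH σ c).injective.mem_set_image]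
    simp
  have ht : tsupport g = affH σ c '' tsupport f := by
    rw [tsupport, hsupp, tsupport, Homeomorph.image_closure]
  have hadm : g ∈ adm τ (affH σ c '' U) := by
    refine ⟨hgc, ?_, ?_, ?_⟩
    · rw [HasCompactSupport, ht]; exact hf.2.1.isCompact.image (affH σ c).continuous
    · rw [ht]; exact image_mono hf.2.2.1
    · intro z
      rw [mem_KK_iff hτ, hg, ← KK_comp h, ← mem_KK_iff (hτ.comp σ)]
      exact hf.2.2.2 _
  have hdiv : ∀ z, div2 g (affH σ c z) = div2 f z := by
    intro z
    have hder : HasFDerivAt g ((σ : (ℝ × ℝ) →L[ℝ] (ℝ × ℝ)) ∘L (fderiv ℝ f z) ∘L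
        (σ.symm : (ℝ × ℝ) →L[ℝ] (ℝ × ℝ))) (affH σ c z) := by
      have h1 : HasFDerivAt (fun w => σ.symm (w - c)) (σ.symm : (ℝ × ℝ) →L[ℝ] (ℝ × ℝ))
          (affH σ c z) := by
        have := σ.symm.hasFDerivAt.comp (affH σ c z) ((hasFDerivAt_id (affH σ c z)).sub_const c)
        exact this
      have h2 : HasFDerivAt f (fderiv ℝ f z) (σ.symm (affH σ c z - c)) := by
        have : σ.symm (affH σ c z - c) = z := by simp [affH_apply]
        rw [this]
        exact (hf.1.differentiable (by simp) z).hasFDerivAt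
      exact σ.hasFDerivAt.comp (affH σ c z) (HasFDerivAt.comp (f := fun w => σ.symm (w - c))
        (affH σ c z) h2 h1)
    rw [div2_trace, div2_trace, hder.fderiv]
    rw [← LinearMap.trace_conj' (fderiv ℝ f z : (ℝ × ℝ) →ₗ[ℝ] (ℝ × ℝ)) σ.toLinearEquiv]
    rfl
  have hitg : ∫ x in affH σ c '' E, div2 g x = ∫ x in E, div2 f x := by
    rw [(affH_mp h c).setIntegral_image_emb (affH σ c).measurableEmbedding]
    simp_rw [hdiv]
  rw [← hitg]
  exact le_surfU hadm

lemma affH_symm_eq (σ : (ℝ × ℝ) ≃L[ℝ] (ℝ × ℝ)) (c : ℝ × ℝ) (A : Set (ℝ × ℝ)) :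
    affH σ.symm (-σ.symm c) '' (affH σ c '' A) = A := by
  rw [← image_comp]
  have : ⇑(affH σ.symm (-σ.symm c)) ∘ ⇑(affH σ c) = id := by
    ext1 z; simp [affH_apply]
  rw [this, image_id]

lemma surfU_map' {τ : ℝ × ℝ → ℝ} (hτ : IsNorm2 τ) {σ : (ℝ × ℝ) ≃L[ℝ] (ℝ × ℝ)} (h : SymL σ)
    (c : ℝ × ℝ) (U E : Set (ℝ × ℝ)) :
    surfU τ (affH σ c '' U) (affH σ c '' E) ≤ surfU (τ ∘ σ) U E := by
  have := surfU_map (hτ.comp σ) h.symm (-σ.symm c) (affH σ c '' U) (affH σ c '' E)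
  rw [affH_symm_eq, affH_symm_eq] at this
  refine le_trans (le_of_eq ?_) this
  congr 1
  ext v; simp

lemma swL_Isq : affH swL 0 '' Isq = Isq := by
  rw [Homeomorph.image_eq_preimage_symm]
  ext z
  rw [mem_preimage, affH_symm_apply, mem_Isq, mem_Isq, sub_zero]
  have : swL.symm z = (z.2, z.1) := rfl
  rw [this]; tauto

lemma rfL_Isq : affH rfL 0 '' Isq = Isq := by
  rw [Homeomorph.image_eq_preimage_symm]
  ext z
  rw [mem_preimage, affH_symm_apply, mem_Isq, mem_Isq, sub_zero]
  have : rfL.symm z = (-z.1, z.2) := rfl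
  rw [this]
  constructor <;> rintro ⟨⟨h1, h2⟩, h3⟩ <;> exact ⟨⟨by simp only at *; linarith, by simp only at *; linarith⟩, h3⟩

lemma swL_Oq : affH swL 0 '' Oq = Oq := by
  rw [Homeomorph.image_eq_preimage_symm]
  ext z
  rw [mem_preimage, affH_symm_apply, sub_zero]
  have : swL.symm z = (z.2, z.1) := rfl
  rw [this]
  simp only [Oq, mem_prod]; tauto

/-! Jordan domains -/

lemma eNorm2_le (v : ℝ × ℝ) : eNorm2 v ≤ 2 * ‖v‖ := by
  have h1 : |v.1| ≤ ‖v‖ := norm_fst_le v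
  have h2 : |v.2| ≤ ‖v‖ := norm_snd_le v
  rw [eNorm2]
  apply Real.sqrt_le_iff.2
  refine ⟨by positivity, ?_⟩
  have h3 : v.1 ^ 2 ≤ ‖v‖ ^ 2 := sq_le_sq' (by linarith [(abs_le.1 h1).1]) (abs_le.1 h1).2
  have h4 : v.2 ^ 2 ≤ ‖v‖ ^ 2 := sq_le_sq' (by linarith [(abs_le.1 h2).1]) (abs_le.1 h2).2
  nlinarith [sq_nonneg ‖v‖]

lemma norm_le_eNorm2 (v : ℝ × ℝ) : ‖v‖ ≤ eNorm2 v := by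
  rw [eNorm2, Prod.norm_def]
  apply max_le
  · rw [Real.norm_eq_abs]; apply Real.abs_le_sqrt; nlinarith [sq_nonneg v.2]
  · rw [Real.norm_eq_abs]; apply Real.abs_le_sqrt; nlinarith [sq_nonneg v.1]

lemma varLength_comp {γ δ : ℝ → ℝ × ℝ} {K : ℝ} (hK : 0 ≤ K)
    (h : ∀ s t, ‖δ s - δ t‖ ≤ K * ‖γ s - γ t‖) (hγ : varLength eNorm2 γ ≠ ⊤) :
    varLength eNorm2 δ ≠ ⊤ := by
  have : varLength eNorm2 δ ≤ ENNReal.ofReal (2 * K) * varLength eNorm2 γ := by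
    refine iSup_le fun n => iSup_le fun t => iSup_le fun ht => ?_
    have h1 : ENNReal.ofReal (∑ i : Fin n, eNorm2 (δ (t i.succ) - δ (t i.castSucc))) ≤
        ENNReal.ofReal (2 * K) *
        ENNReal.ofReal (∑ i : Fin n, eNorm2 (γ (t i.succ) - γ (t i.castSucc))) := by
      rw [← ENNReal.ofReal_mul (by positivity), Finset.mul_sum]
      refine ENNReal.ofReal_le_ofReal (Finset.sum_le_sum fun i _ => ?_)
      refine (eNorm2_le _).trans ?_
      have := h (t i.succ) (t i.castSucc)
      have h2 := norm_le_eNorm2 (γ (t i.succ) - γ (t i.castSucc))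
      nlinarith
    refine h1.trans ?_
    gcongr
    exact le_iSup_of_le n (le_iSup_of_le t (le_iSup_of_le ht le_rfl))
  exact (this.trans_lt (ENNReal.mul_lt_top ENNReal.ofReal_lt_top hγ.lt_top)).ne

lemma varLength_lip {γ : ℝ → ℝ × ℝ} {K : ℝ} (hK : 0 ≤ K)
    (h : ∀ s t, ‖γ s - γ t‖ ≤ K * |s - t|) : varLength eNorm2 γ ≠ ⊤ := by
  have : varLength eNorm2 γ ≤ ENNReal.ofReal (2 * K) := by
    refine iSup_le fun n => iSup_le fun t => iSup_le fun ht => ?_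
    refine ENNReal.ofReal_le_ofReal ?_
    have h1 : ∑ i : Fin n, eNorm2 (γ (t i.succ) - γ (t i.castSucc)) ≤
        ∑ i : Fin n, 2 * K * (t i.succ - t i.castSucc) := by
      refine Finset.sum_le_sum fun i _ => ?_
      refine (eNorm2_le _).trans ?_
      have := h (t i.succ) (t i.castSucc)
      rw [abs_of_nonneg (sub_nonneg.2 (ht.1 (Fin.castSucc_lt_succ).le))] at this
      linarith
    refine h1.trans (le_of_eq ?_)
    rw [← Finset.mul_sum, Finset.sum_sub_distrib]
    have e1 := Fin.sum_univ_succ t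
    have e2 := Fin.sum_univ_castSucc t
    rw [ht.2.1] at e1
    rw [ht.2.2] at e2
    have : ∑ i : Fin n, t i.succ - ∑ i : Fin n, t i.castSucc = 1 := by linarith
    rw [this, mul_one]
  exact (this.trans_lt ENNReal.ofReal_lt_top).ne

lemma IsRectJordanCurve.image {C : Set (ℝ × ℝ)} (hC : IsRectJordanCurve C)
    {Φ : ℝ × ℝ → ℝ × ℝ} {K : ℝ} (hK : 0 ≤ K)
    (hΦ : ∀ z ∈ C, ∀ w ∈ C, ‖Φ z - Φ w‖ ≤ K * ‖z - w‖) (hinj : InjOn Φ C) :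
    IsRectJordanCurve (Φ '' C) := by
  obtain ⟨γ, hc, hp, hi, himg, hl⟩ := hC
  have hmem : ∀ t, γ t ∈ C := by
    intro t
    have hper : Function.Periodic γ 1 := hp
    rw [himg]
    obtain ⟨s, hs, hst⟩ := hper.exists_mem_Ico₀ zero_lt_one t
    exact ⟨s, Ico_subset_Icc_self hs, hst.symm⟩
  have hlipOn : LipschitzOnWith (Real.toNNReal K) Φ C := by
    apply LipschitzOnWith.of_dist_le_mul
    intro z hz w hw
    rw [dist_eq_norm, dist_eq_norm, Real.coe_toNNReal _ hK]
    exact hΦ z hz w hw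
  refine ⟨Φ ∘ γ, ?_, fun t => by simp [hp], ?_, ?_, ?_⟩
  · exact hlipOn.continuousOn.comp_continuous hc hmem
  · intro s hs t ht hst
    exact hi hs ht (hinj (hmem s) (hmem t) hst)
  · rw [himg, image_comp]
  · exact varLength_comp hK (fun s t => hΦ _ (hmem s) _ (hmem t)) hl

/-- Jordan domains. -/
structure JD (R : Set (ℝ × ℝ)) : Prop where
  cpt : IsCompact R
  sub : R ⊆ Isq
  int : (interior R).Nonempty
  curve : IsRectJordanCurve (frontier R)
  hull : R = hullSet (frontier R)

lemma JD.memR {R : Set (ℝ × ℝ)} (h : JD R) : MemR R := by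
  refine ⟨h.cpt, h.sub, h.int, {frontier R}, ?_, ?_, ?_⟩
  · intro C hC
    rw [Finset.mem_singleton.1 hC]; exact h.curve
  · simp
  · intro C hC C' hC' hne
    exact absurd ((Finset.mem_singleton.1 hC).trans (Finset.mem_singleton.1 hC').symm) hne

lemma JD.lam {R : Set (ℝ × ℝ)} (h : JD R) :
    ∃ lam' : Set (ℝ × ℝ), IsRectJordanCurve lam' ∧ lam' ⊆ Isq ∧ R = hullSet lam' :=
  ⟨frontier R, h.curve, h.cpt.isClosed.frontier_subset.trans h.sub, h.hull⟩

lemma hullSet_image (σ : (ℝ × ℝ) ≃L[ℝ] (ℝ × ℝ)) (c : ℝ × ℝ) (C : Set (ℝ × ℝ)) :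
    hullSet (affH σ c '' C) = affH σ c '' hullSet C := by
  have hb : ∀ (σ : (ℝ × ℝ) ≃L[ℝ] (ℝ × ℝ)) (c : ℝ × ℝ) (B : Set (ℝ × ℝ)),
      Bornology.IsBounded B → Bornology.IsBounded (affH σ c '' B) := by
    intro σ c B hB
    have hl : LipschitzWith ‖(σ : (ℝ × ℝ) →L[ℝ] (ℝ × ℝ))‖₊ (affH σ c) := by
      apply LipschitzWith.of_dist_le_mul
      intro x y
      have := (σ : (ℝ × ℝ) →L[ℝ] (ℝ × ℝ)).lipschitz.dist_le_mul x y
      simpa [affH_apply] using this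
    exact hl.isBounded_image hB
  ext z
  obtain ⟨w, rfl⟩ := (affH σ c).surjective z
  rw [(affH σ c).injective.mem_set_image]
  simp only [hullSet, mem_union, Set.mem_ofPred_eq, (affH σ c).injective.mem_set_image]
  refine or_congr Iff.rfl (and_congr_right fun hw => ?_)
  rw [← image_compl_eq (affH σ c).bijective, ← Homeomorph.image_connectedComponentIn _ hw]
  constructor
  · intro h
    have := hb σ.symm (-σ.symm c) _ h
    rwa [affH_symm_eq] at this
  · exact hb σ c _

lemma JD.map {R : Set (ℝ × ℝ)} (h : JD R) (σ : (ℝ × ℝ) ≃L[ℝ] (ℝ × ℝ)) (c : ℝ × ℝ)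
    (hI : affH σ c '' Isq = Isq) : JD (affH σ c '' R) := by
  refine ⟨h.cpt.image (affH σ c).continuous, ?_, ?_, ?_, ?_⟩
  · rw [← hI]; exact image_mono h.sub
  · rw [← Homeomorph.image_interior]; exact h.int.image _
  · rw [← Homeomorph.image_frontier]
    refine h.curve.image (K := ‖(σ : (ℝ × ℝ) →L[ℝ] (ℝ × ℝ))‖) (norm_nonneg _) ?_
      (affH σ c).injective.injOn
    intro z _ w _
    have := (σ : (ℝ × ℝ) →L[ℝ] (ℝ × ℝ)).le_opNorm (z - w)
    simpa [affH_apply] using this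
  · rw [← Homeomorph.image_frontier, hullSet_image, ← h.hull]

end

end

section
open MeasureTheory Set Filter ENNReal Topology

noncomputable section

lemma hull_lemma {R : Set (ℝ × ℝ)} (hR : IsCompact R)
    (h : ∀ x ∉ R, ∃ S : Set (ℝ × ℝ), IsPreconnected S ∧ x ∈ S ∧ S ⊆ Rᶜ ∧
      ¬ Bornology.IsBounded S) : R = hullSet (frontier R) := by
  have hfs : frontier R ⊆ R := hR.isClosed.frontier_subset
  ext x
  constructor
  · intro hx
    by_cases hxf : x ∈ frontier R
    · exact Or.inl hxf
    · refine Or.inr ⟨hxf, ?_⟩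
      have hxi : x ∈ interior R := by
        by_contra hn
        exact hxf ⟨subset_closure hx, hn⟩
      refine hR.isBounded.subset (Subset.trans ?_ interior_subset)
      have hsub : connectedComponentIn (frontier R)ᶜ x ⊆ interior R ∪ Rᶜ := by
        refine (connectedComponentIn_subset _ _).trans ?_
        intro y hy
        by_cases hyR : y ∈ R
        · left
          by_contra hn
          exact hy ⟨subset_closure hyR, hn⟩
        · exact Or.inr hyR
      refine IsPreconnected.subset_left_of_subset_union isOpen_interior hR.isClosed.isOpen_compl
        ?_ hsub ⟨x, mem_connectedComponentIn hxf, hxi⟩ isPreconnected_connectedComponentIn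
      exact Set.disjoint_left.2 fun y hy hy' => hy' (interior_subset hy)
  · rintro (hx | ⟨hxf, hb⟩)
    · exact hfs hx
    · by_contra hxR
      obtain ⟨S, hS, hxS, hSR, hun⟩ := h x hxR
      refine hun (hb.subset (hS.subset_connectedComponentIn hxS ?_))
      exact hSR.trans (compl_subset_compl.2 hfs)

lemma ray_unbounded (x u : ℝ × ℝ) (hu : u ≠ 0) :
    ¬ Bornology.IsBounded ((fun t : ℝ => x + t • u) '' Ici 0) := by
  intro hb
  obtain ⟨C, hC⟩ := hb.exists_norm_le
  have hu' : 0 < ‖u‖ := norm_pos_iff.2 hu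
  have hC0 : 0 ≤ C := (norm_nonneg _).trans (hC _ ⟨0, by simp, rfl⟩)
  set t := (C + ‖x‖ + 1) / ‖u‖ with ht
  have ht0 : 0 ≤ t := by positivity
  have h1 := hC _ ⟨t, ht0, rfl⟩
  have h2 : ‖t • u‖ = C + ‖x‖ + 1 := by
    rw [norm_smul, Real.norm_of_nonneg ht0, ht]; field_simp
  have h3 : ‖t • u‖ ≤ ‖x + t • u‖ + ‖x‖ := by
    have := norm_sub_le (x + t • u) x
    simpa using this
  simp only at h1
  linarith

lemma ray_preconnected (x u : ℝ × ℝ) : IsPreconnected ((fun t : ℝ => x + t • u) '' Ici 0) := by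
  apply isPreconnected_Ici.image
  fun_prop

lemma convex_ray {R : Set (ℝ × ℝ)} (hconv : Convex ℝ R) {z0 : ℝ × ℝ} (h0 : z0 ∈ R)
    {x : ℝ × ℝ} (hx : x ∉ R) : (fun t : ℝ => x + t • (x - z0)) '' Ici 0 ⊆ Rᶜ := by
  rintro _ ⟨t, ht, rfl⟩ hmem
  apply hx
  have ht : 0 ≤ t := ht
  have hpos : 0 < 1 + t := by linarith
  have := hconv h0 hmem (a := t / (1 + t)) (b := 1 / (1 + t)) (by positivity) (by positivity)
    (by field_simp; ring)
  convert this using 1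
  ext <;> simp <;> field_simp <;> ring

lemma convex_hull_lemma {R : Set (ℝ × ℝ)} (hR : IsCompact R) (hconv : Convex ℝ R)
    (hne : R.Nonempty) : R = hullSet (frontier R) := by
  obtain ⟨z0, h0⟩ := hne
  refine hull_lemma hR fun x hx => ?_
  refine ⟨_, ray_preconnected x (x - z0), ⟨0, by simp, by simp⟩, convex_ray hconv h0 hx,
    ray_unbounded _ _ ?_⟩
  intro h
  exact hx (by rw [sub_eq_zero.1 h]; exact h0)

/-- unit circle parametrisation -/
def ecirc (t : ℝ) : ℝ × ℝ := (Real.cos (2 * Real.pi * t), Real.sin (2 * Real.pi * t))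

lemma ecirc_sq (t : ℝ) : (ecirc t).1 ^ 2 + (ecirc t).2 ^ 2 = 1 := by
  simp [ecirc]

lemma ecirc_per (t : ℝ) : ecirc (t + 1) = ecirc t := by
  simp only [ecirc, mul_add, mul_one, Real.cos_add_two_pi, Real.sin_add_two_pi]

lemma ecirc_norm (t : ℝ) : 1 / 2 ≤ ‖ecirc t‖ ∧ ‖ecirc t‖ ≤ 1 := by
  constructor
  · have := eNorm2_le (ecirc t)
    rw [eNorm2, ecirc_sq, Real.sqrt_one] at this
    linarith
  · have := norm_le_eNorm2 (ecirc t)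
    rwa [eNorm2, ecirc_sq, Real.sqrt_one] at this

lemma ecirc_lip (s t : ℝ) : ‖ecirc s - ecirc t‖ ≤ 2 * Real.pi * |s - t| := by
  have hp := Real.pi_pos
  have e : |2 * Real.pi * s - 2 * Real.pi * t| = 2 * Real.pi * |s - t| := by
    rw [← mul_sub, abs_mul, abs_of_pos (by positivity)]
  rw [Prod.norm_def]
  apply max_le
  · have := Real.abs_cos_sub_cos_le (2 * Real.pi * s) (2 * Real.pi * t)
    rw [e] at this
    simpa [ecirc] using this
  · have := Real.abs_sin_sub_sin_le (2 * Real.pi * s) (2 * Real.pi * t)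
    rw [e] at this
    simpa [ecirc] using this

lemma ecirc_inj {s t : ℝ} (hs : s ∈ Ico (0 : ℝ) 1) (ht : t ∈ Ico (0 : ℝ) 1)
    (h : ecirc s = ecirc t) : s = t := by
  simp only [ecirc, Prod.mk.injEq] at h
  have := Real.Angle.cos_sin_inj h.1 h.2
  obtain ⟨k, hk⟩ := Real.Angle.angle_eq_iff_two_pi_dvd_sub.1 this
  have hp := Real.pi_pos
  have h1 : s - t = k := by
    have : 2 * Real.pi * (s - t) = 2 * Real.pi * k := by linarith
    exact mul_left_cancel₀ (by positivity) this
  have h2 : (k : ℝ) < 1 := by linarith [hs.2, ht.1]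
  have h3 : (-1 : ℝ) < k := by linarith [hs.1, ht.2]
  have h4 : k = 0 := by
    have a1 : k < 1 := by exact_mod_cast h2
    have a2 : -1 < k := by exact_mod_cast h3
    omega
  rw [h4] at h1
  simp at h1
  linarith

lemma ecirc_surj (u : ℝ × ℝ) (hu : u ≠ 0) : ∃ t ∈ Ico (0 : ℝ) 1, ∃ r : ℝ, 0 < r ∧ u = r • ecirc t := by
  set z : ℂ := ⟨u.1, u.2⟩ with hz
  have hz0 : z ≠ 0 := by
    intro h
    apply hu
    have h1 := congrArg Complex.re h
    have h2 := congrArg Complex.im h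
    simp [hz] at h1 h2
    exact Prod.ext h1 h2
  have hper : Function.Periodic ecirc 1 := ecirc_per
  obtain ⟨s, hs, hst⟩ := hper.exists_mem_Ico₀ zero_lt_one (z.arg / (2 * Real.pi))
  refine ⟨s, hs, ‖z‖, norm_pos_iff.2 hz0, ?_⟩
  rw [← hst]
  have hp := Real.pi_pos
  have e : 2 * Real.pi * (z.arg / (2 * Real.pi)) = z.arg := by field_simp
  have h1 := Complex.norm_mul_cos_arg z
  have h2 := Complex.norm_mul_sin_arg z
  ext
  · simp only [ecirc, e, Prod.smul_fst, smul_eq_mul, h1]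
    rfl
  · simp only [ecirc, e, Prod.smul_snd, smul_eq_mul, h2]
    rfl

lemma convex_curve {R : Set (ℝ × ℝ)} (hR : IsCompact R) (hconv : Convex ℝ R)
    (hitg : (interior R).Nonempty) : IsRectJordanCurve (frontier R) := by
  obtain ⟨z0, h0⟩ := hitg
  set S : Set (ℝ × ℝ) := (fun z => z0 + z) ⁻¹' R with hS
  have hSconv : Convex ℝ S := hconv.translate_preimage_right z0
  have hS0 : S ∈ 𝓝 (0 : ℝ × ℝ) := by
    have : ContinuousAt (fun z : ℝ × ℝ => z0 + z) 0 := by fun_prop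
    apply this.preimage_mem_nhds
    simpa using mem_interior_iff_mem_nhds.1 h0
  have hfr : frontier R = (fun z => z0 + z) '' frontier S := by
    have e1 : S = (Homeomorph.addLeft z0).symm '' R := by
      rw [Homeomorph.image_symm]; rfl
    rw [e1, ← Homeomorph.image_frontier, ← image_comp]
    have : (fun z => z0 + z) ∘ ⇑(Homeomorph.addLeft z0).symm = id := by
      ext1 z; exact (Homeomorph.addLeft z0).apply_symm_apply z
    rw [this, image_id]
  obtain ⟨M, hM0, hM⟩ : ∃ M > 0, S ⊆ Metric.closedBall 0 M := by
    obtain ⟨C, hC⟩ := hR.isBounded.exists_norm_le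
    refine ⟨|C| + ‖z0‖ + 1, by positivity, fun z hz => ?_⟩
    rw [mem_closedBall_zero_iff]
    have h1 := hC _ hz
    have h2 := norm_sub_le (z0 + z) z0
    simp only [add_sub_cancel_left] at h2
    have := le_abs_self C
    simp only at h1
    linarith
  set g := gauge S with hg
  have habs : Absorbent ℝ S := absorbent_nhds_zero hS0
  have hglow : ∀ x, ‖x‖ / M ≤ g x := fun x => le_gauge_of_subset_closedBall habs hM0.le hM
  obtain ⟨K, hK⟩ := hSconv.lipschitz_gauge hS0
  have hgpos : ∀ t, 1 / (2 * M) ≤ g (ecirc t) := by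
    intro t
    refine le_trans ?_ (hglow _)
    rw [div_le_div_iff₀ (by positivity) hM0]
    nlinarith [(ecirc_norm t).1]
  have hgpos' : ∀ t, 0 < g (ecirc t) := fun t => lt_of_lt_of_le (by positivity) (hgpos t)
  have hginv : ∀ t, (g (ecirc t))⁻¹ ≤ 2 * M := by
    intro t
    rw [inv_le_comm₀ (hgpos' t) (by positivity)]
    simpa using hgpos t
  set γ : ℝ → ℝ × ℝ := fun t => z0 + (g (ecirc t))⁻¹ • ecirc t with hγ
  have hlip : ∀ s t, ‖γ s - γ t‖ ≤
      ((2 * M) ^ 2 * K * (2 * Real.pi) + 2 * M * (2 * Real.pi)) * |s - t| := by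
    intro s t
    have e : γ s - γ t = ((g (ecirc s))⁻¹ - (g (ecirc t))⁻¹) • ecirc s
        + (g (ecirc t))⁻¹ • (ecirc s - ecirc t) := by
      simp only [hγ]; module
    have hd := ecirc_lip s t
    have h1 : |(g (ecirc s))⁻¹ - (g (ecirc t))⁻¹| ≤ (2 * M) ^ 2 * K * (2 * Real.pi) * |s - t| := by
      have e2 : (g (ecirc s))⁻¹ - (g (ecirc t))⁻¹ =
          (g (ecirc s))⁻¹ * (g (ecirc t))⁻¹ * (g (ecirc t) - g (ecirc s)) := by
        have a1 := (hgpos' s).ne'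
        have a2 := (hgpos' t).ne'
        field_simp
      have h3 : |g (ecirc t) - g (ecirc s)| ≤ K * (2 * Real.pi * |s - t|) := by
        have := hK.dist_le_mul (ecirc t) (ecirc s)
        rw [Real.dist_eq, dist_eq_norm, norm_sub_rev] at this
        refine this.trans ?_
        gcongr
      rw [e2, abs_mul, abs_mul, abs_of_pos (inv_pos.2 (hgpos' s)), abs_of_pos (inv_pos.2 (hgpos' t))]
      calc _ ≤ (2 * M) * (2 * M) * (K * (2 * Real.pi * |s - t|)) := by
            gcongr
            · exact (inv_pos.2 (hgpos' t)).le
            · exact hginv s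
            · exact hginv t
        _ = _ := by ring
    rw [e]
    refine (norm_add_le _ _).trans ?_
    rw [norm_smul, norm_smul, Real.norm_eq_abs, Real.norm_of_nonneg (inv_pos.2 (hgpos' t)).le]
    have h4 : |(g (ecirc s))⁻¹ - (g (ecirc t))⁻¹| * ‖ecirc s‖ ≤
        ((2 * M) ^ 2 * K * (2 * Real.pi) * |s - t|) * 1 := by
      gcongr
      exact (ecirc_norm s).2
    have h5 : (g (ecirc t))⁻¹ * ‖ecirc s - ecirc t‖ ≤ 2 * M * (2 * Real.pi * |s - t|) := by
      gcongr
      exact hginv t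
    linarith
  have hhom : ∀ (r : ℝ), 0 ≤ r → ∀ x, g (r • x) = r * g x := by
    intro r hr x
    rw [hg, gauge_smul_of_nonneg hr, smul_eq_mul]
  refine ⟨γ, ?_, ?_, ?_, ?_, varLength_lip (by positivity) hlip⟩
  · have : LipschitzWith (Real.toNNReal
        ((2 * M) ^ 2 * K * (2 * Real.pi) + 2 * M * (2 * Real.pi))) γ := by
      apply LipschitzWith.of_dist_le_mul
      intro s t
      rw [Real.coe_toNNReal _ (by positivity), dist_eq_norm, Real.dist_eq]
      exact hlip s t
    exact this.continuous
  · intro t; simp only [hγ, ecirc_per]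
  · intro s hs t ht hst
    apply ecirc_inj hs ht
    have h1 : (g (ecirc s))⁻¹ • ecirc s = (g (ecirc t))⁻¹ • ecirc t := by
      simpa [hγ] using hst
    have a1 := hgpos' s
    have a2 := hgpos' t
    set p := (g (ecirc s))⁻¹ with hp
    set q := (g (ecirc t))⁻¹ with hq
    have hp0 : 0 < p := inv_pos.2 a1
    have hq0 : 0 < q := inv_pos.2 a2
    have f1 : p * (ecirc s).1 = q * (ecirc t).1 := congrArg Prod.fst h1
    have f2 : p * (ecirc s).2 = q * (ecirc t).2 := congrArg Prod.snd h1
    have f3 : p ^ 2 = q ^ 2 := by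
      have b1 := ecirc_sq s
      have b2 := ecirc_sq t
      calc p ^ 2 = (p * (ecirc s).1) ^ 2 + (p * (ecirc s).2) ^ 2 := by
            rw [mul_pow, mul_pow, ← mul_add, b1, mul_one]
        _ = q ^ 2 := by rw [f1, f2, mul_pow, mul_pow, ← mul_add, b2, mul_one]
    have f4 : p = q := by
      rwa [pow_left_inj₀ hp0.le hq0.le (by norm_num)] at f3
    rw [f4] at h1
    exact smul_right_injective _ hq0.ne' h1
  · rw [hfr]
    have hfS : ∀ x, x ∈ frontier S ↔ g x = 1 := fun x =>
      (gauge_eq_one_iff_mem_frontier hSconv hS0).symm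
    ext z
    constructor
    · rintro ⟨u, hu, rfl⟩
      rw [hfS] at hu
      have hu0 : u ≠ 0 := by
        rintro rfl
        simp [hg] at hu
      obtain ⟨t, ht, r, hr, hur⟩ := ecirc_surj u hu0
      refine ⟨t, Ico_subset_Icc_self ht, ?_⟩
      simp only [hγ]
      congr 1
      rw [hur, hhom r hr.le] at hu
      rw [hur, eq_inv_of_mul_eq_one_left hu]
    · rintro ⟨t, ht, rfl⟩
      refine ⟨(g (ecirc t))⁻¹ • ecirc t, ?_, rfl⟩
      rw [hfS, hhom _ (inv_pos.2 (hgpos' t)).le, inv_mul_cancel₀ (hgpos' t).ne']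

lemma JD_convex {R : Set (ℝ × ℝ)} (hR : IsCompact R) (hI : R ⊆ Isq) (hconv : Convex ℝ R)
    (hvol : 0 < volume R) : JD R := by
  have hitg : (interior R).Nonempty := by
    by_contra hn
    rw [Set.not_nonempty_iff_eq_empty] at hn
    have h1 := hconv.addHaar_frontier volume
    rw [frontier, hn, sdiff_empty] at h1
    exact hvol.ne' (measure_mono_null subset_closure h1)
  exact ⟨hR, hI, hitg, convex_curve hR hconv hitg,
    convex_hull_lemma hR hconv (hitg.mono interior_subset)⟩

end

end

section
open MeasureTheory Set Filter ENNReal Topology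
open scoped Pointwise

noncomputable section

lemma exists_slope {τ : ℝ × ℝ → ℝ} (hτ : IsNorm2 τ) :
    ∃ m : ℝ, 0 < τ (-m, 1) ∧ ((0 : ℝ), τ (-m, 1)) ∈ KK τ := by
  obtain ⟨c, hc, hlow⟩ := hτ.lower
  have hcont : Continuous (fun m : ℝ => τ (-m, 1)) := hτ.continuous.comp (by fun_prop)
  have htend : Tendsto (fun m : ℝ => τ (-m, 1)) (cocompact ℝ) atTop := by
    have h1 : Tendsto (fun m : ℝ => c * ‖m‖) (cocompact ℝ) atTop :=
      (tendsto_norm_cocompact_atTop (E := ℝ)).const_mul_atTop hc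
    refine tendsto_atTop_mono (fun m => ?_) h1
    refine le_trans ?_ (hlow (-m, 1))
    have : ‖m‖ ≤ ‖((-m, 1) : ℝ × ℝ)‖ := by
      have := norm_fst_le ((-m, 1) : ℝ × ℝ)
      simpa using this
    gcongr
  obtain ⟨m, hm⟩ := hcont.exists_forall_le htend
  have hpos : 0 < τ (-m, 1) := by
    refine lt_of_lt_of_le ?_ (hlow (-m, 1))
    have : 0 < ‖((-m, 1) : ℝ × ℝ)‖ := norm_pos_iff.2 (by simp)
    positivity
  refine ⟨m, hpos, fun v => ?_⟩
  simp only [mul_zero, zero_add]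
  by_cases hv : v.2 = 0
  · rw [hv, zero_mul]; exact hτ.nonneg v
  · have e : τ v = |v.2| * τ (-(-(v.1 / v.2)), 1) := by
      rw [← hτ.2.1]
      congr 1
      ext
      · simp; field_simp
      · simp
    rw [e]
    calc v.2 * τ (-m, 1) ≤ |v.2| * τ (-m, 1) := by gcongr; exact le_abs_self _
      _ ≤ _ := by gcongr; exact hm _

lemma col_le {S : Set (ℝ × ℝ)} (hS : MeasurableSet S) {a b : ℝ} {c : ℝ≥0∞}
    (h : ∀ x, volume (Prod.mk x ⁻¹' S) ≤ (Icc a b).indicator (fun _ => c) x) :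
    volume S ≤ c * ENNReal.ofReal (b - a) := by
  rw [Measure.volume_eq_prod, Measure.prod_apply hS]
  refine (lintegral_mono h).trans ?_
  rw [lintegral_indicator_const measurableSet_Icc, Real.volume_Icc]

/-- The half-plane sets. -/
def HPs (m h : ℝ) : Set (ℝ × ℝ) := {z | z ∈ Isq ∧ z.2 - m * z.1 ≤ h}

lemma HPs_closed (m h : ℝ) : IsClosed {z : ℝ × ℝ | z.2 - m * z.1 ≤ h} :=
  isClosed_le (by fun_prop) continuous_const

lemma HPs_cpt (m h : ℝ) : IsCompact (HPs m h) := isCompact_Isq.inter_right (HPs_closed m h)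

lemma HPs_conv (m h : ℝ) : Convex ℝ (HPs m h) := by
  refine convex_Isq.inter ?_
  intro x hx y hy a b ha hb hab
  have hx' : x.2 - m * x.1 ≤ h := hx
  have hy' : y.2 - m * y.1 ≤ h := hy
  show (a • x + b • y).2 - m * (a • x + b • y).1 ≤ h
  simp only [Prod.snd_add, Prod.smul_snd, smul_eq_mul, Prod.fst_add, Prod.smul_fst]
  have h1 := mul_le_mul_of_nonneg_left hx' ha
  have h2 := mul_le_mul_of_nonneg_left hy' hb
  have : h = a * h + b * h := by rw [← add_mul, hab, one_mul]
  rw [this]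
  linarith

lemma Isq_fin {A : Set (ℝ × ℝ)} (h : A ⊆ Isq) : volume A ≠ ⊤ :=
  ((measure_mono h).trans_lt (by rw [volume_Isq]; simp)).ne

lemma HPs_sub (m h : ℝ) : HPs m h ⊆ Isq := fun _ hz => hz.1

lemma HPs_vol_le (m h h' : ℝ) (hh : h ≤ h') :
    volume.real (HPs m h') ≤ volume.real (HPs m h) + 2 * (h' - h) := by
  have hsub : HPs m h' ⊆ HPs m h ∪ (HPs m h' \ HPs m h) := by
    intro z hz
    by_cases hz' : z ∈ HPs m h
    · exact Or.inl hz'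
    · exact Or.inr ⟨hz, hz'⟩
  have hd : volume (HPs m h' \ HPs m h) ≤ ENNReal.ofReal (h' - h) * ENNReal.ofReal (1 - (-1)) := by
    refine col_le ((HPs_cpt m h').measurableSet.diff (HPs_cpt m h).measurableSet) fun x => ?_
    by_cases hx : x ∈ Icc (-1 : ℝ) 1
    · rw [indicator_of_mem hx]
      have : Prod.mk x ⁻¹' (HPs m h' \ HPs m h) ⊆ Ioc (m * x + h) (m * x + h') := by
        intro y hy
        obtain ⟨⟨hI, h1⟩, h2⟩ := hy
        have h3 : ¬ (y - m * x ≤ h) := fun h3 => h2 ⟨hI, h3⟩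
        simp only at h1
        push Not at h3
        constructor <;> linarith
      refine (measure_mono this).trans ?_
      rw [Real.volume_Ioc]
      apply ENNReal.ofReal_le_ofReal; linarith
    · rw [indicator_of_notMem hx]
      have : Prod.mk x ⁻¹' (HPs m h' \ HPs m h) = ∅ := by
        ext y
        simp only [mem_empty_iff_false, iff_false]
        intro hy
        exact hx (mem_Isq.1 (hy.1.1 : (x, y) ∈ Isq)).1
      rw [this]; simp
  have h1 : volume (HPs m h') ≤ volume (HPs m h) + ENNReal.ofReal (2 * (h' - h)) := by
    refine (measure_mono hsub).trans ((measure_union_le _ _).trans ?_)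
    gcongr
    refine hd.trans (le_of_eq ?_)
    rw [← ENNReal.ofReal_mul (by linarith)]
    congr 1; ring
  have h2 := ENNReal.toReal_mono (by
    exact (ENNReal.add_lt_top.2 ⟨(Isq_fin (HPs_sub m h)).lt_top, ENNReal.ofReal_lt_top⟩).ne) h1
  rw [ENNReal.toReal_add (Isq_fin (HPs_sub m h)) ENNReal.ofReal_ne_top,
    ENNReal.toReal_ofReal (by linarith)] at h2
  exact h2

lemma HPs_exists (m b : ℝ) (hb : b ∈ Ioo (0 : ℝ) 4) : ∃ h, volume.real (HPs m h) = b := by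
  have hmono : ∀ h h', h ≤ h' → volume.real (HPs m h) ≤ volume.real (HPs m h') := by
    intro h h' hh
    refine measureReal_mono (fun z hz => ⟨hz.1, hz.2.trans hh⟩) (Isq_fin (HPs_sub m h'))
  have hcont : Continuous (fun h => volume.real (HPs m h)) := by
    have : LipschitzWith 2 (fun h => volume.real (HPs m h)) := by
      apply LipschitzWith.of_le_add_mul
      intro x y
      rcases le_total x y with h | h
      · have := hmono x y h
        have := dist_nonneg (x := x) (y := y)
        simp only [NNReal.coe_ofNat]
        linarith
      · have := HPs_vol_le m y x h
        rw [Real.dist_eq, abs_of_nonneg (by linarith)]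
        exact this
    exact this.continuous
  set k := 2 + |m| with hk
  have habs : ∀ z ∈ Isq, |z.2 - m * z.1| ≤ 1 + |m| := by
    intro z hz
    rw [mem_Isq] at hz
    refine (abs_sub _ _).trans ?_
    rw [abs_mul]
    have h1 : |z.1| ≤ 1 := abs_le.2 hz.1
    have h2 : |z.2| ≤ 1 := abs_le.2 hz.2
    nlinarith [abs_nonneg m]
  have hlo : volume.real (HPs m (-k)) = 0 := by
    have : HPs m (-k) = ∅ := by
      ext z
      simp only [mem_empty_iff_false, iff_false]
      intro hz
      have h1 := (abs_le.1 (habs z hz.1)).1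
      have h2 := hz.2
      linarith
    rw [this]; simp
  have hhi : volume.real (HPs m k) = 4 := by
    have : HPs m k = Isq := by
      ext z
      constructor
      · exact fun h => h.1
      · intro hz
        have h1 := (abs_le.1 (habs z hz)).2
        exact ⟨hz, by linarith⟩
    rw [this, measureReal_def, volume_Isq]; simp
  have := intermediate_value_Icc (a := -k) (b := k) (by have := abs_nonneg m; linarith)
    hcont.continuousOn
  simp only [hlo, hhi] at this
  obtain ⟨h, -, hh⟩ := this ⟨hb.1.le, hb.2.le⟩
  exact ⟨h, hh⟩

lemma vol_of_real {A : Set (ℝ × ℝ)} (h : A ⊆ Isq) : volume A = ENNReal.ofReal (volume.real A) := by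
  rw [measureReal_def, ENNReal.ofReal_toReal (Isq_fin h)]

lemma HP_prop {τ : ℝ × ℝ → ℝ} (hτ : IsNorm2 τ) :
    ∃ μ : ℝ, 0 < μ ∧ ((0 : ℝ), μ) ∈ KK τ ∧ ∀ b ∈ Ioo (0 : ℝ) 4, ∃ R, JD R ∧
      volume R = ENNReal.ofReal b ∧ surfU τ Isq R ≤ ENNReal.ofReal (2 * μ) := by
  obtain ⟨m, hpos, hm⟩ := exists_slope hτ
  refine ⟨_, hpos, hm, fun b hb => ?_⟩
  obtain ⟨h, hh⟩ := HPs_exists m b hb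
  have hv : volume (HPs m h) = ENNReal.ofReal b := by rw [vol_of_real (HPs_sub m h), hh]
  refine ⟨HPs m h, JD_convex (HPs_cpt m h) (HPs_sub m h) (HPs_conv m h) ?_, hv, ?_⟩
  · rw [hv]; exact ENNReal.ofReal_pos.2 hb.1
  · refine surfU_upper (HPs_cpt m h).measurableSet (HPs_sub m h) (by positivity) le_rfl
      (fun ε => HPs m (h + ε * τ (-m, 1))) ?_ ?_
    · intro ε hε z hz w hw hI
      refine ⟨hI, ?_⟩
      have h1 := dual_dot hτ (-m, 1) w
      have h2 : dualNorm τ w * τ (-m, 1) ≤ 1 * τ (-m, 1) := by gcongr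
      have h3 := hz.2
      simp only [Prod.snd_add, Prod.smul_snd, smul_eq_mul, Prod.fst_add, Prod.smul_fst] at *
      nlinarith
    · intro ε hε
      rw [vol_of_real (HPs_sub _ _)]
      apply ENNReal.ofReal_le_ofReal
      have := HPs_vol_le m h (h + ε * τ (-m, 1)) (by nlinarith)
      linarith

/-! Corner sets -/

/-- Quarter of the unit ball -/
def WW (τ : ℝ × ℝ → ℝ) : Set (ℝ × ℝ) := {z | z ∈ KK τ ∧ 0 ≤ z.1 ∧ 0 ≤ z.2}

/-- its area -/
def om (τ : ℝ × ℝ → ℝ) : ℝ := volume.real (WW τ)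

lemma quad_closed : IsClosed {z : ℝ × ℝ | 0 ≤ z.1 ∧ 0 ≤ z.2} :=
  (isClosed_le continuous_const continuous_fst).inter (isClosed_le continuous_const continuous_snd)

lemma quad_convex : Convex ℝ {z : ℝ × ℝ | 0 ≤ z.1 ∧ 0 ≤ z.2} := by
  intro x hx y hy a b ha hb _
  have := hx.1; have := hx.2; have := hy.1; have := hy.2
  constructor <;> simp <;> positivity

lemma WW_cpt {τ : ℝ × ℝ → ℝ} (hτ : IsNorm2 τ) : IsCompact (WW τ) := by
  refine IsCompact.inter_right ?_ quad_closed
  obtain ⟨C, -, hC⟩ := KK_bdd hτ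
  exact Metric.isCompact_of_isClosed_isBounded (KK_closed τ)
    (isBounded_iff_forall_norm_le.2 ⟨C, hC⟩)

lemma WW_conv (τ : ℝ × ℝ → ℝ) : Convex ℝ (WW τ) := (KK_convex τ).inter quad_convex

lemma om_pos {τ : ℝ × ℝ → ℝ} (hτ : IsNorm2 τ) : 0 < om τ := by
  obtain ⟨c, hc, h⟩ := KK_nhds hτ
  have hsub : Icc (0 : ℝ) c ×ˢ Icc (0 : ℝ) c ⊆ WW τ := by
    rintro ⟨x, y⟩ ⟨hx, hy⟩
    refine ⟨h _ ?_, hx.1, hy.1⟩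
    rw [Prod.norm_def]
    simp only [Real.norm_eq_abs]
    exact max_le (by rw [abs_of_nonneg hx.1]; exact hx.2) (by rw [abs_of_nonneg hy.1]; exact hy.2)
  refine ENNReal.toReal_pos ?_ (WW_cpt hτ).measure_ne_top
  refine (lt_of_lt_of_le ?_ (measure_mono hsub)).ne'
  rw [Measure.volume_eq_prod, Measure.prod_prod, Real.volume_Icc]
  have : 0 < ENNReal.ofReal (c - 0) := ENNReal.ofReal_pos.2 (by linarith)
  positivity

/-- the corner set -/
def Cor (τ : ℝ × ℝ → ℝ) (s : ℝ) : Set (ℝ × ℝ) := (fun u => u + (-1, -1)) '' (s • WW τ)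

lemma Cor_vol {τ : ℝ × ℝ → ℝ} (hτ : IsNorm2 τ) (s : ℝ) :
    volume (Cor τ s) = ENNReal.ofReal (s ^ 2 * om τ) := by
  rw [Cor, image_add_right, measure_preimage_add_right, Measure.addHaar_smul]
  simp only [Module.finrank_prod, Module.finrank_self]
  rw [om, measureReal_def, ENNReal.ofReal_mul (sq_nonneg s), ENNReal.ofReal_toReal
    (WW_cpt hτ).measure_ne_top, show (1 + 1 : ℕ) = 2 from rfl, abs_of_nonneg (sq_nonneg s)]

lemma mem_Cor {τ : ℝ × ℝ → ℝ} (hτ : IsNorm2 τ) {s : ℝ} (hs : 0 < s) {z : ℝ × ℝ} :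
    z ∈ Cor τ s ↔ dualNorm τ (z + (1, 1)) ≤ s ∧ 0 ≤ (z + (1, 1)).1 ∧ 0 ≤ (z + (1, 1)).2 := by
  have e : z ∈ Cor τ s ↔ s⁻¹ • (z + (1, 1)) ∈ WW τ := by
    rw [Cor, image_add_right, mem_preimage, Set.mem_smul_set_iff_inv_smul_mem₀ hs.ne']
    have : z + -(-1, -1) = z + (1, 1) := by simp
    rw [this]
  rw [e]
  simp only [WW, Set.mem_ofPred_eq, ← mem_KK_iff hτ, (isNorm2_dualNorm hτ).2.1,
    abs_of_pos (inv_pos.2 hs)]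
  rw [inv_mul_le_iff₀ hs, mul_one]
  simp only [Prod.smul_fst, Prod.smul_snd, smul_eq_mul, mul_nonneg_iff_of_pos_left (inv_pos.2 hs)]

lemma Isq_quad {z : ℝ × ℝ} (h : z ∈ Isq) : 0 ≤ (z + (1, 1)).1 ∧ 0 ≤ (z + (1, 1)).2 := by
  rw [mem_Isq] at h
  simp only [Prod.fst_add, Prod.snd_add]
  constructor <;> linarith [h.1.1, h.2.1]

/-- expansion of corner sets -/
lemma Cor_expand {τ : ℝ × ℝ → ℝ} (hτ : IsNorm2 τ) {r ε : ℝ} (hr : 0 < r) (hε : 0 < ε)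
    {z w : ℝ × ℝ} (hz : dualNorm τ (z + (1, 1)) ≤ r) (hw : dualNorm τ w ≤ 1)
    (hI : z + ε • w ∈ Isq) : z + ε • w ∈ Cor τ (r + ε) := by
  rw [mem_Cor hτ (by linarith)]
  refine ⟨?_, Isq_quad hI⟩
  have h1 := (isNorm2_dualNorm hτ).2.2 (z + (1, 1)) (ε • w)
  rw [(isNorm2_dualNorm hτ).2.1, abs_of_pos hε] at h1
  have e : z + ε • w + (1, 1) = z + (1, 1) + ε • w := by abel
  rw [e]
  nlinarith

lemma Cor_energy {τ : ℝ × ℝ → ℝ} (hτ : IsNorm2 τ) {r : ℝ} (hr : 0 < r) {A : Set (ℝ × ℝ)}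
    (hA : MeasurableSet A) (hI : A ⊆ Isq) (hz : ∀ z ∈ A, dualNorm τ (z + (1, 1)) ≤ r)
    (hv : volume.real A = r ^ 2 * om τ) : surfU τ Isq A ≤ ENNReal.ofReal (2 * (r * om τ)) := by
  have ho := om_pos hτ
  refine surfU_upper hA hI (by positivity) ho.le (fun ε => Cor τ (r + ε)) ?_ ?_
  · intro ε hε z hzA w hw hI'
    exact Cor_expand hτ hr hε (hz z hzA) hw hI'
  · intro ε hε
    rw [Cor_vol hτ, hv]
    apply ENNReal.ofReal_le_ofReal
    nlinarith

/-- The corner set fits strictly in the square. -/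
def Fits (τ : ℝ × ℝ → ℝ) (r : ℝ) : Prop := ∀ u ∈ WW τ, r * u.1 < 2 ∧ r * u.2 < 2

lemma Fits.sub {τ : ℝ × ℝ → ℝ} {r : ℝ} (hr : 0 < r) (h : Fits τ r) : Cor τ r ⊆ Isq := by
  rintro _ ⟨_, ⟨u, hu, rfl⟩, rfl⟩
  have h1 := h u hu
  have h2 := hu.2
  rw [mem_Isq]
  simp only [Prod.fst_add, Prod.snd_add, Prod.smul_fst, Prod.smul_snd, smul_eq_mul]
  have := mul_nonneg hr.le h2.1
  have := mul_nonneg hr.le h2.2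
  constructor <;> constructor <;> linarith

lemma Cor_JD {τ : ℝ × ℝ → ℝ} (hτ : IsNorm2 τ) {r : ℝ} (hr : 0 < r) (h : Fits τ r) :
    JD (Cor τ r) ∧ surfU τ Isq (Cor τ r) ≤ ENNReal.ofReal (2 * (r * om τ)) := by
  have ho := om_pos hτ
  have hc : IsCompact (Cor τ r) := ((WW_cpt hτ).smul r).image (by fun_prop)
  constructor
  · refine JD_convex hc (h.sub hr) ?_ ?_
    · have := ((WW_conv τ).smul r).vadd ((-1, -1) : ℝ × ℝ)
      have e : Cor τ r = ((-1, -1) : ℝ × ℝ) +ᵥ r • WW τ := by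
        rw [Cor]
        show _ = (fun u : ℝ × ℝ => ((-1, -1) : ℝ × ℝ) + u) '' _
        simp only [add_comm]
      rw [e]; exact this
    · rw [Cor_vol hτ]; exact ENNReal.ofReal_pos.2 (by positivity)
  · refine Cor_energy hτ hr hc.measurableSet (h.sub hr) ?_ ?_
    · intro z hz; exact ((mem_Cor hτ hr).1 hz).1
    · rw [measureReal_def, Cor_vol hτ, ENNReal.toReal_ofReal (by positivity)]

lemma nofit_aux {τ : ℝ × ℝ → ℝ} (hτ : IsNorm2 τ) {μ : ℝ} (hμ : 0 < μ) (hK : ((0 : ℝ), μ) ∈ KK τ)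
    {u : ℝ × ℝ} (hu : u ∈ WW τ) (hu1 : 0 < u.1) : u.1 * μ / 2 ≤ om τ := by
  have h0 : (0 : ℝ × ℝ) ∈ WW τ := ⟨KK_zero hτ, le_rfl, le_rfl⟩
  have hm : ((0 : ℝ), μ) ∈ WW τ := ⟨hK, le_rfl, hμ.le⟩
  have hsub : regionBetween (fun x => x / u.1 * u.2) (fun x => x / u.1 * u.2 + (1 - x / u.1) * μ)
      (Ioc 0 u.1) ⊆ WW τ := by
    rintro ⟨x, y⟩ ⟨hx, hy⟩
    simp only [mem_Ioc, mem_Ioo] at hx hy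
    set s := x / u.1 with hs
    have hs0 : 0 ≤ s := by have := hx.1; positivity
    have hs1 : s ≤ 1 := by rw [hs, div_le_one hu1]; exact hx.2
    have hx' : x = s * u.1 := by rw [hs]; field_simp
    set t := (y - s * u.2) / μ with ht
    have ht0 : 0 ≤ t := div_nonneg (by linarith) hμ.le
    have ht1 : t ≤ 1 - s := by rw [ht, div_le_iff₀ hμ]; linarith
    have hy' : y = s * u.2 + t * μ := by rw [ht]; field_simp; ring
    have e1 := (WW_conv τ).starConvex h0
    have hmem : s • u + (t • ((0 : ℝ), μ) + (1 - s - t) • (0 : ℝ × ℝ)) ∈ WW τ := by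
      by_cases hs1' : s = 1
      · have : t = 0 := by linarith
        rw [this, hs1']; simpa using hu
      · have hs1'' : 0 < 1 - s := lt_of_le_of_ne (by linarith) (fun h => hs1' (by linarith))
        have a := (WW_conv τ) hm h0 (a := t / (1 - s)) (b := (1 - s - t) / (1 - s))
          (by positivity) (div_nonneg (by linarith) hs1''.le) (by field_simp; ring)
        have b := (WW_conv τ) hu a hs0 hs1''.le (by ring)
        convert b using 2
        ext <;> simp <;> field_simp
    convert hmem using 1
    ext
    · simp [hx']
    · simp [hy']
  have h1 := measureReal_mono (μ := volume) hsub (WW_cpt hτ).measure_ne_top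
  rw [om]
  refine le_trans (le_of_eq ?_) h1
  rw [measureReal_def, Measure.volume_eq_prod, volume_regionBetween_eq_integral]
  · rw [ENNReal.toReal_ofReal]
    · have : ∀ y, ((fun x => x / u.1 * u.2 + (1 - x / u.1) * μ) - fun x => x / u.1 * u.2) y
        = μ - (μ / u.1) * y := by
        intro y; simp; ring
      simp_rw [this]
      rw [← intervalIntegral.integral_of_le hu1.le, intervalIntegral.integral_sub (by simp)
        (by apply Continuous.intervalIntegrable; fun_prop), intervalIntegral.integral_const_mul]
      simp; field_simp; norm_num
    · refine setIntegral_nonneg measurableSet_Ioc fun y hy => ?_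
      have : y / u.1 ≤ 1 := by rw [div_le_one hu1]; exact hy.2
      simp
      have : 0 ≤ 1 - y / u.1 := by linarith
      positivity
  · apply Continuous.integrableOn_Ioc; fun_prop
  · apply Continuous.integrableOn_Ioc; fun_prop
  · exact measurableSet_Ioc
  · intro y hy
    have : y / u.1 ≤ 1 := by rw [div_le_one hu1]; exact hy.2
    have : 0 ≤ 1 - y / u.1 := by linarith
    simp; positivity

lemma om_map {τ : ℝ × ℝ → ℝ} {σ : (ℝ × ℝ) ≃L[ℝ] (ℝ × ℝ)} (hs : σ = swL ) :
    om (τ ∘ σ) = om τ := by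
  subst hs
  have : WW (τ ∘ swL) = swL ⁻¹' WW τ := by
    ext z
    simp only [WW, Set.mem_ofPred_eq, mem_preimage, KK_comp swL_sym, swL_apply]
    tauto
  rw [om, om, this, measureReal_def, measureReal_def]
  congr 1
  exact swL_sym.mp.measure_preimage_emb swL.toHomeomorph.measurableEmbedding _

lemma nofit {τ : ℝ × ℝ → ℝ} (hτ : IsNorm2 τ) {r : ℝ} (hr : 0 < r) (h : ¬ Fits τ r) :
    ∀ b ∈ Ioo (0 : ℝ) 4, ∃ R, JD R ∧
      volume R = ENNReal.ofReal b ∧ surfU τ Isq R ≤ ENNReal.ofReal (2 * (r * om τ)) := by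
  have key : ∀ τ : ℝ × ℝ → ℝ, IsNorm2 τ → (∃ u ∈ WW τ, 2 ≤ r * u.1) →
      ∀ b ∈ Ioo (0 : ℝ) 4, ∃ R, JD R ∧
      volume R = ENNReal.ofReal b ∧ surfU τ Isq R ≤ ENNReal.ofReal (2 * (r * om τ)) := by
    rintro τ hτ ⟨u, hu, hu2⟩ b hb
    obtain ⟨μ, hμ, hK, hHP⟩ := HP_prop hτ
    obtain ⟨R, hR, hv, hE⟩ := hHP b hb
    refine ⟨R, hR, hv, hE.trans (ENNReal.ofReal_le_ofReal ?_)⟩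
    have hu1 : 0 < u.1 := by
      by_contra hn
      push Not at hn
      nlinarith
    have := nofit_aux hτ hμ hK hu hu1
    nlinarith
  simp only [Fits] at h
  push Not at h
  obtain ⟨u, hu, hu2⟩ := h
  intro b hb
  by_cases h1 : r * u.1 < 2
  · have h2 := hu2 h1
    obtain ⟨R, hR, hv, hE⟩ := key (τ ∘ swL) (hτ.comp swL) ⟨(u.2, u.1), by
      refine ⟨(KK_comp swL_sym _).2 ?_, hu.2.2, hu.2.1⟩
      exact hu.1, h2⟩ b hb
    refine ⟨affH swL 0 '' R, hR.map swL 0 swL_Isq, ?_, ?_⟩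
    · rw [← hv]
      have := (affH_mp swL_sym 0).measure_preimage_emb (affH swL 0).measurableEmbedding
        (affH swL 0 '' R)
      rw [preimage_image_eq _ (affH swL 0).injective] at this
      exact this.symm
    · have := surfU_map' hτ swL_sym 0 Isq R
      rw [swL_Isq] at this
      rw [om_map rfl] at hE
      exact this.trans hE
  · push Not at h1
    exact key τ hτ ⟨u, hu, h1⟩ b hb

lemma P1_prop {τ : ℝ × ℝ → ℝ} (hτ : IsNorm2 τ) : ∀ b ∈ Ioo (0 : ℝ) 4, ∃ R, JD R ∧
      volume R = ENNReal.ofReal b ∧ surfU τ Isq R ≤ ENNReal.ofReal (2 * √(om τ * b)) := by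
  intro b hb
  have ho := om_pos hτ
  have hb0 := hb.1
  set r := √(b / om τ) with hr
  have hr0 : 0 < r := Real.sqrt_pos.2 (by positivity)
  have hr2 : r ^ 2 = b / om τ := Real.sq_sqrt (by positivity)
  have e1 : r ^ 2 * om τ = b := by rw [hr2]; field_simp
  have e2 : √(om τ * b) = r * om τ := by
    rw [← e1, show om τ * (r ^ 2 * om τ) = (r * om τ) ^ 2 by ring]
    exact Real.sqrt_sq (by positivity)
  rw [e2]
  by_cases hf : Fits τ r
  · obtain ⟨h1, h2⟩ := Cor_JD hτ hr0 hf
    exact ⟨_, h1, by rw [Cor_vol hτ, e1], h2⟩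
  · exact nofit hτ hr0 hf b hb

end

end

section
open MeasureTheory Set Filter ENNReal Topology
open scoped Pointwise

noncomputable section

/-! Complement of a corner set is a Jordan domain -/

/-- the square `[0,2]²` -/
def Qd : Set (ℝ × ℝ) := Icc 0 2 ×ˢ Icc 0 2

/-- the part of the square outside the ball -/
def SQ (N : ℝ × ℝ → ℝ) (r : ℝ) : Set (ℝ × ℝ) := {u | u ∈ Qd ∧ r ≤ N u}

/-- the part of the square beyond the chord -/
def PQ (N : ℝ × ℝ → ℝ) (r : ℝ) : Set (ℝ × ℝ) := {u | u ∈ Qd ∧ r ≤ u.1 * N (1, 0) + u.2 * N (0, 1)}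

lemma Qd_cpt : IsCompact Qd := isCompact_Icc.prod isCompact_Icc

lemma Qd_int : interior Qd = Ioo 0 2 ×ˢ Ioo 0 2 := by
  rw [Qd, interior_prod_eq, interior_Icc]

lemma Qd_conv : Convex ℝ Qd := (convex_Icc 0 2).prod (convex_Icc 0 2)

lemma N_le_L {N : ℝ × ℝ → ℝ} (hN : IsNorm2 N) {u : ℝ × ℝ} (h1 : 0 ≤ u.1) (h2 : 0 ≤ u.2) :
    N u ≤ u.1 * N (1, 0) + u.2 * N (0, 1) := by
  have e : u = u.1 • ((1 : ℝ), (0 : ℝ)) + u.2 • ((0 : ℝ), (1 : ℝ)) := by ext <;> simp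
  have h := hN.2.2 (u.1 • ((1 : ℝ), (0 : ℝ))) (u.2 • ((0 : ℝ), (1 : ℝ)))
  rw [← e, hN.2.1, hN.2.1, abs_of_nonneg h1, abs_of_nonneg h2] at h
  exact h

lemma scale_frontier {S : Set (ℝ × ℝ)} {u : ℝ × ℝ} (hu : u ∈ S)
    (h : ∀ t ∈ Ioo (0 : ℝ) 1, t • u ∉ S) : u ∈ frontier S := by
  refine ⟨subset_closure hu, fun hi => ?_⟩
  have hc : ContinuousAt (fun t : ℝ => t • u) 1 := by fun_prop
  have h1 : ∀ᶠ t in 𝓝 (1 : ℝ), t • u ∈ S := by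
    have := hc.eventually_mem (s := S) (by rw [one_smul]; exact mem_interior_iff_mem_nhds.1 hi)
    exact this
  have h2 : ∀ᶠ t in 𝓝[<] (1 : ℝ), t • u ∈ S := h1.filter_mono nhdsWithin_le_nhds
  have h3 : ∀ᶠ t in 𝓝[<] (1 : ℝ), t ∈ Ioo (0 : ℝ) 1 := Ioo_mem_nhdsLT one_pos
  obtain ⟨t, ht1, ht2⟩ := (h2.and h3).exists
  exact h t ht2 ht1

lemma Q_frontier {S : Set (ℝ × ℝ)} {u : ℝ × ℝ} (hu : u ∈ S) (hS : S ⊆ Qd) (h : u ∉ interior Qd) :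
    u ∈ frontier S :=
  ⟨subset_closure hu, fun hi => h (interior_mono hS hi)⟩

/-- the radial map -/
def PsiR (N : ℝ × ℝ → ℝ) (r : ℝ) (u : ℝ × ℝ) : ℝ × ℝ := (max 1 (r / N u)) • u

lemma N_pos {N : ℝ × ℝ → ℝ} (hN : IsNorm2 N) {u : ℝ × ℝ} (h : u ≠ 0) : 0 < N u :=
  lt_of_le_of_ne (hN.nonneg u) (fun h' => h ((hN.1 u).1 h'.symm))

lemma SQ_cpt {N : ℝ × ℝ → ℝ} (hN : IsNorm2 N) (r : ℝ) : IsCompact (SQ N r) :=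
  Qd_cpt.inter_right (isClosed_le continuous_const hN.continuous)

lemma PQ_cpt (N : ℝ × ℝ → ℝ) (r : ℝ) : IsCompact (PQ N r) :=
  Qd_cpt.inter_right (t := {u : ℝ × ℝ | r ≤ u.1 * N (1, 0) + u.2 * N (0, 1)})
    (isClosed_le continuous_const (by fun_prop))

lemma PQ_conv (N : ℝ × ℝ → ℝ) (r : ℝ) : Convex ℝ (PQ N r) := by
  refine Qd_conv.inter ?_
  intro x hx y hy a b ha hb hab
  have hx : r ≤ x.1 * N (1, 0) + x.2 * N (0, 1) := hx
  have hy : r ≤ y.1 * N (1, 0) + y.2 * N (0, 1) := hy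
  show r ≤ _
  simp only [Prod.fst_add, Prod.snd_add, Prod.smul_fst, Prod.smul_snd, smul_eq_mul]
  have : r = a * r + b * r := by rw [← add_mul, hab, one_mul]
  nlinarith [mul_le_mul_of_nonneg_left hx ha, mul_le_mul_of_nonneg_left hy hb]

lemma PQ_int_mem {N : ℝ × ℝ → ℝ} {r : ℝ} {u : ℝ × ℝ} (h : u ∈ interior Qd)
    (hL : r < u.1 * N (1, 0) + u.2 * N (0, 1)) : u ∈ interior (PQ N r) := by
  have ho : IsOpen (interior Qd ∩ {u : ℝ × ℝ | r < u.1 * N (1, 0) + u.2 * N (0, 1)}) :=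
    isOpen_interior.inter (isOpen_lt continuous_const (by fun_prop))
  refine interior_maximal ?_ ho ⟨h, hL⟩
  intro v hv
  exact ⟨interior_subset hv.1, le_of_lt hv.2⟩

lemma SQ_int_mem {N : ℝ × ℝ → ℝ} (hN : IsNorm2 N) {r : ℝ} {u : ℝ × ℝ} (h : u ∈ interior Qd)
    (hL : r < N u) : u ∈ interior (SQ N r) := by
  have ho : IsOpen (interior Qd ∩ {u : ℝ × ℝ | r < N u}) :=
    isOpen_interior.inter (isOpen_lt continuous_const hN.continuous)
  refine interior_maximal ?_ ho ⟨h, hL⟩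
  intro v hv
  exact ⟨interior_subset hv.1, le_of_lt hv.2⟩

lemma diag_int {t : ℝ} (h : t ∈ Ioo (0 : ℝ) 2) : (t, t) ∈ interior Qd := by
  rw [Qd_int]; exact ⟨h, h⟩

lemma SQ_int {N : ℝ × ℝ → ℝ} (hN : IsNorm2 N) {r : ℝ} (hr : 0 < r)
    (hF : ∀ u : ℝ × ℝ, 0 ≤ u.1 → 0 ≤ u.2 → N u ≤ r → u.1 < 2 ∧ u.2 < 2) :
    (interior (SQ N r)).Nonempty := by
  have h2 : r < N (2, 2) := by
    by_contra hn
    push Not at hn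
    have := (hF (2, 2) (by norm_num) (by norm_num) hn).1
    norm_num at this
  have hs : ∀ t : ℝ, 0 ≤ t → N (t, t) = t * N (1, 1) := by
    intro t ht
    have := hN.2.1 t (1, 1)
    rw [abs_of_nonneg ht] at this
    rw [← this]; simp
  rw [hs 2 (by norm_num)] at h2
  have h1 : 0 < N (1, 1) := by nlinarith
  have h3 : r / N (1, 1) < 2 := by rw [div_lt_iff₀ h1]; exact h2
  have h4 : 0 < r / N (1, 1) := by positivity
  have h5 : r = r / N (1, 1) * N (1, 1) := by field_simp
  refine ⟨((2 + r / N (1, 1)) / 2, (2 + r / N (1, 1)) / 2), SQ_int_mem hN (diag_int ⟨by linarith, by linarith⟩) ?_⟩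
  rw [hs _ (by linarith)]
  nlinarith

lemma SQ_sub_PQ {N : ℝ × ℝ → ℝ} (hN : IsNorm2 N) (r : ℝ) : SQ N r ⊆ PQ N r :=
  fun _ hu => ⟨hu.1, hu.2.trans (N_le_L hN hu.1.1.1 hu.1.2.1)⟩

lemma PQ_frontier_mem {N : ℝ × ℝ → ℝ} {r : ℝ} (hr : 0 < r) {u : ℝ × ℝ} (h : u ∈ PQ N r)
    (hL : u.1 * N (1, 0) + u.2 * N (0, 1) = r) : u ∈ frontier (PQ N r) := by
  refine scale_frontier h fun t ht hmem => ?_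
  have := hmem.2
  simp only [Prod.smul_fst, Prod.smul_snd, smul_eq_mul] at this
  have h2 : t * u.1 * N (1, 0) + t * u.2 * N (0, 1) = t * r := by rw [← hL]; ring
  rw [h2] at this
  nlinarith [ht.2]

lemma SQ_frontier_mem {N : ℝ × ℝ → ℝ} (hN : IsNorm2 N) {r : ℝ} (hr : 0 < r) {u : ℝ × ℝ}
    (h : u ∈ SQ N r) (hL : N u = r) : u ∈ frontier (SQ N r) := by
  refine scale_frontier h fun t ht hmem => ?_
  have := hmem.2
  rw [hN.2.1, hL, abs_of_pos ht.1] at this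
  nlinarith [ht.2]

lemma PQ_ne {N : ℝ × ℝ → ℝ} {r : ℝ} (hr : 0 < r) {u : ℝ × ℝ} (h : u ∈ PQ N r) : u ≠ 0 := by
  rintro rfl
  have := h.2
  simp at this
  linarith

lemma SQ_frontier {N : ℝ × ℝ → ℝ} (hN : IsNorm2 N) {r : ℝ} (hr : 0 < r)
    (hF : ∀ u : ℝ × ℝ, 0 ≤ u.1 → 0 ≤ u.2 → N u ≤ r → u.1 < 2 ∧ u.2 < 2) :
    frontier (SQ N r) = PsiR N r '' frontier (PQ N r) := by
  apply Subset.antisymm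
  · intro u hu
    have huS : u ∈ SQ N r := (SQ_cpt hN r).isClosed.frontier_subset hu
    have huP := SQ_sub_PQ hN r huS
    rcases huS.2.lt_or_eq with h | h
    · refine ⟨u, Q_frontier huP (fun _ h => h.1) ?_, ?_⟩
      · intro hi
        exact hu.2 (SQ_int_mem hN hi h)
      · rw [PsiR, max_eq_left, one_smul]
        rw [div_le_one (by linarith)]; exact h.le
    · have hL := huP.2
      set L := u.1 * N (1, 0) + u.2 * N (0, 1) with hLd
      have hL0 : 0 < L := by linarith
      have hs1 : r / L ≤ 1 := by rw [div_le_one hL0]; exact hL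
      have hs0 : 0 < r / L := by positivity
      have hq := huS.1
      refine ⟨(r / L) • u, PQ_frontier_mem hr ⟨?_, ?_⟩ ?_, ?_⟩
      · refine ⟨⟨?_, ?_⟩, ?_, ?_⟩ <;> simp only [Prod.smul_fst, Prod.smul_snd, smul_eq_mul]
        · exact mul_nonneg hs0.le hq.1.1
        · nlinarith [hq.1.1, hq.1.2]
        · exact mul_nonneg hs0.le hq.2.1
        · nlinarith [hq.2.1, hq.2.2]
      · simp only [Prod.smul_fst, Prod.smul_snd, smul_eq_mul]
        rw [mul_assoc, mul_assoc, ← mul_add, ← hLd]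
        apply le_of_eq; field_simp
      · simp only [Prod.smul_fst, Prod.smul_snd, smul_eq_mul]
        rw [mul_assoc, mul_assoc, ← mul_add, ← hLd]
        field_simp
      · rw [PsiR, hN.2.1, ← h, abs_of_pos hs0, smul_smul]
        have e : r / (r / L * r) = L / r := by field_simp
        have : 1 ≤ L / r := by rw [le_div_iff₀ hr]; linarith
        rw [e, max_eq_right this]
        have : L / r * (r / L) = 1 := by field_simp
        rw [this, one_smul]
  · rintro _ ⟨u, hu, rfl⟩
    have huP : u ∈ PQ N r := (PQ_cpt N r).isClosed.frontier_subset hu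
    have hq := huP.1
    have hn0 : 0 < N u := N_pos hN (PQ_ne hr huP)
    rcases le_or_gt (N u) r with h | h
    · have h1 : 1 ≤ r / N u := by rw [le_div_iff₀ hn0]; linarith
      have hk : 0 ≤ r / N u := by linarith
      rw [PsiR, max_eq_right h1]
      have hNu : N ((r / N u) • u) = r := by
        rw [hN.2.1, abs_of_nonneg hk]; field_simp
      have h2 := hF ((r / N u) • u) (by simpa using mul_nonneg hk hq.1.1)
        (by simpa using mul_nonneg hk hq.2.1) hNu.le
      refine SQ_frontier_mem hN hr ⟨⟨⟨?_, h2.1.le⟩, ?_, h2.2.le⟩, hNu.ge⟩ hNu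
      · simpa using mul_nonneg hk hq.1.1
      · simpa using mul_nonneg hk hq.2.1
    · have e : PsiR N r u = u := by
        rw [PsiR, max_eq_left, one_smul]
        rw [div_le_one hn0]; exact h.le
      rw [e]
      refine Q_frontier ⟨hq, h.le⟩ (fun _ h => h.1) ?_
      intro hi
      exact hu.2 (PQ_int_mem hi (h.trans_le (N_le_L hN hq.1.1 hq.2.1)))

lemma PsiR_inj {N : ℝ × ℝ → ℝ} (hN : IsNorm2 N) {r : ℝ} (hr : 0 < r)
    (hF : ∀ u : ℝ × ℝ, 0 ≤ u.1 → 0 ≤ u.2 → N u ≤ r → u.1 < 2 ∧ u.2 < 2) :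
    InjOn (PsiR N r) (frontier (PQ N r)) := by
  have key : ∀ u ∈ frontier (PQ N r), ∀ v ∈ frontier (PQ N r), PsiR N r u = PsiR N r v →
      ¬ max 1 (r / N v) < max 1 (r / N u) := by
    intro u hu v hv heq hlt
    have huP : u ∈ PQ N r := (PQ_cpt N r).isClosed.frontier_subset hu
    have hvP : v ∈ PQ N r := (PQ_cpt N r).isClosed.frontier_subset hv
    have hu0 : 0 < N u := N_pos hN (PQ_ne hr huP)
    have hv0 : 0 < N v := N_pos hN (PQ_ne hr hvP)
    set ku := max 1 (r / N u) with hku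
    set kv := max 1 (r / N v) with hkv
    have hkv1 : 1 ≤ kv := le_max_left _ _
    have hku' : ku = r / N u := by
      rcases max_choice 1 (r / N u) with h | h
      · rw [← hku] at h; linarith
      · exact h
    have heq' : ku • u = kv • v := heq
    have hNv : kv * N v = r := by
      have : N (kv • v) = r := by
        rw [← heq', hN.2.1, hku', abs_of_pos (by positivity)]; field_simp
      rwa [hN.2.1, abs_of_pos (by linarith)] at this
    have hNvr : N v ≤ r := by nlinarith
    have h2 := hF v hvP.1.1.1 hvP.1.2.1 hNvr
    have ev1 : ku * u.1 = kv * v.1 := by simpa using congrArg Prod.fst heq'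
    have ev2 : ku * u.2 = kv * v.2 := by simpa using congrArg Prod.snd heq'
    have hLu := huP.2
    have hLv : r < v.1 * N (1, 0) + v.2 * N (0, 1) := by
      have : kv * (v.1 * N (1, 0) + v.2 * N (0, 1)) = ku * (u.1 * N (1, 0) + u.2 * N (0, 1)) := by
        linear_combination -N (1, 0) * ev1 - N (0, 1) * ev2
      by_contra hn
      push Not at hn
      nlinarith
    have hvi : v ∉ interior Qd := fun hi => hv.2 (PQ_int_mem hi hLv)
    rw [Qd_int] at hvi
    have hvq := hvP.1
    have : v.1 = 0 ∨ v.2 = 0 := by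
      by_contra hn
      push Not at hn
      exact hvi ⟨⟨lt_of_le_of_ne hvq.1.1 (Ne.symm hn.1), h2.1⟩, lt_of_le_of_ne hvq.2.1 (Ne.symm hn.2), h2.2⟩
    rcases this with h | h
    · have e : v = v.2 • ((0 : ℝ), (1 : ℝ)) := by ext <;> simp [h]
      have : N v = v.2 * N (0, 1) := by
        conv_lhs => rw [e, hN.2.1, abs_of_nonneg hvq.2.1]
      rw [h] at hLv; linarith
    · have e : v = v.1 • ((1 : ℝ), (0 : ℝ)) := by ext <;> simp [h]
      have : N v = v.1 * N (1, 0) := by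
        conv_lhs => rw [e, hN.2.1, abs_of_nonneg hvq.1.1]
      rw [h] at hLv; linarith
  intro u hu v hv heq
  have h1 := key u hu v hv heq
  have h2 := key v hv u hu heq.symm
  have h3 := le_antisymm (not_lt.1 h1) (not_lt.1 h2)
  have h4 : max 1 (r / N u) • u = max 1 (r / N v) • v := heq
  rw [h3] at h4
  exact smul_right_injective _ (by have := le_max_left 1 (r / N v); linarith) h4

lemma PsiR_lip {N : ℝ × ℝ → ℝ} (hN : IsNorm2 N) {r : ℝ} (hr : 0 < r) :
    ∃ K : ℝ, 0 ≤ K ∧ ∀ u ∈ PQ N r, ∀ v ∈ PQ N r, ‖PsiR N r u - PsiR N r v‖ ≤ K * ‖u - v‖ := by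
  obtain ⟨C, hC, hup⟩ := hN.upper
  by_cases hne : (PQ N r).Nonempty
  swap
  · exact ⟨0, le_rfl, fun u hu => absurd ⟨u, hu⟩ hne⟩
  obtain ⟨x, hx, hmin⟩ := (PQ_cpt N r).exists_isMinOn hne hN.continuous.continuousOn
  have hn0 : 0 < N x := N_pos hN (PQ_ne hr hx)
  set n := N x with hn
  have hge : ∀ u ∈ PQ N r, n ≤ N u := fun u hu => hmin hu
  have hnorm : ∀ u ∈ PQ N r, ‖u‖ ≤ 2 := by
    intro u hu
    have := hu.1
    rw [Prod.norm_def, Real.norm_eq_abs, Real.norm_eq_abs, abs_of_nonneg this.1.1,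
      abs_of_nonneg this.2.1]
    exact max_le this.1.2 this.2.2
  have hdiff : ∀ u v, N u - N v ≤ C * ‖u - v‖ := by
    intro u v
    have := hN.2.2 (u - v) v
    rw [sub_add_cancel] at this
    linarith [hup (u - v)]
  have habs : ∀ u v, |N u - N v| ≤ C * ‖u - v‖ := by
    intro u v
    rw [abs_le]
    have h1 := hdiff u v
    have h2 := hdiff v u
    rw [norm_sub_rev] at h2
    constructor <;> linarith
  refine ⟨(1 + r / n) + r * C / n ^ 2 * 2, by positivity, fun u hu v hv => ?_⟩
  have hu' := hge u hu
  have hv' := hge v hv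
  have hkd : |max 1 (r / N u) - max 1 (r / N v)| ≤ r * C / n ^ 2 * ‖u - v‖ := by
    have h1 := abs_max_sub_max_le_max 1 (r / N u) 1 (r / N v)
    rw [sub_self, abs_zero, max_eq_right (a := (0:ℝ)) (abs_nonneg (r / N u - r / N v))] at h1
    refine h1.trans ?_
    have e : r / N u - r / N v = - (r * (N u - N v) / (N u * N v)) := by
      have : N u ≠ 0 := by linarith
      have : N v ≠ 0 := by linarith
      field_simp; ring
    rw [e, abs_neg, abs_div, abs_mul, abs_of_pos hr, abs_of_pos (by nlinarith : 0 < N u * N v)]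
    have : n ^ 2 ≤ N u * N v := by nlinarith
    calc r * |N u - N v| / (N u * N v) ≤ r * (C * ‖u - v‖) / n ^ 2 := by
          gcongr
          exact habs u v
      _ = _ := by ring
  have hk : |max 1 (r / N u)| ≤ 1 + r / n := by
    have : r / N u ≤ r / n := by gcongr
    have h0 : 0 ≤ r / n := by positivity
    rw [abs_of_nonneg (by positivity)]
    exact max_le (by linarith) (by linarith)
  have e : PsiR N r u - PsiR N r v = max 1 (r / N u) • (u - v) +
      (max 1 (r / N u) - max 1 (r / N v)) • v := by
    simp only [PsiR, smul_sub, sub_smul]; abel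
  rw [e]
  refine (norm_add_le _ _).trans ?_
  rw [norm_smul, norm_smul, Real.norm_eq_abs, Real.norm_eq_abs]
  calc _ ≤ (1 + r / n) * ‖u - v‖ + (r * C / n ^ 2 * ‖u - v‖) * 2 := by
        gcongr
        exact hnorm v hv
    _ = _ := by ring

lemma SQ_curve {N : ℝ × ℝ → ℝ} (hN : IsNorm2 N) {r : ℝ} (hr : 0 < r)
    (hF : ∀ u : ℝ × ℝ, 0 ≤ u.1 → 0 ≤ u.2 → N u ≤ r → u.1 < 2 ∧ u.2 < 2) :
    IsRectJordanCurve (frontier (SQ N r)) := by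
  rw [SQ_frontier hN hr hF]
  obtain ⟨K, hK, hlip⟩ := PsiR_lip hN hr
  have hs := (PQ_cpt N r).isClosed.frontier_subset
  exact (convex_curve (PQ_cpt N r) (PQ_conv N r)
    ((SQ_int hN hr hF).mono (interior_mono (SQ_sub_PQ hN r)))).image hK
    (fun z hz w hw => hlip z (hs hz) w (hs hw)) (PsiR_inj hN hr hF)

lemma SQ_hull {N : ℝ × ℝ → ℝ} (hN : IsNorm2 N) {r : ℝ} (hr : 0 < r) :
    SQ N r = hullSet (frontier (SQ N r)) := by
  refine hull_lemma (SQ_cpt hN r) fun x hx => ?_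
  by_cases hq : x ∈ Qd
  · have hlt : N x < r := by
      by_contra hn
      push Not at hn
      exact hx ⟨hq, hn⟩
    refine ⟨segment ℝ 0 x ∪ (fun t : ℝ => (0 : ℝ × ℝ) + t • ((-1, -1) : ℝ × ℝ)) '' Ici 0, ?_, ?_, ?_, ?_⟩
    · refine IsPreconnected.union 0 (left_mem_segment _ _ _) ⟨0, by simp, by simp⟩
        (convex_segment _ _).isPreconnected (ray_preconnected _ _)
    · exact Or.inl (right_mem_segment _ _ _)
    · rintro y (hy | ⟨t, ht, rfl⟩) hyS
      · obtain ⟨a, b, ha, hb, hab, rfl⟩ := hy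
        have := hyS.2
        rw [smul_zero, zero_add, hN.2.1, abs_of_nonneg hb] at this
        nlinarith [hN.nonneg x]
      · have ht : 0 ≤ t := ht
        have h1 := hyS.1.1.1
        simp at h1
        have ht0 : t = 0 := by linarith
        have := hyS.2
        rw [ht0] at this
        simp [(hN.1 0).2 rfl] at this
        linarith
    · intro hb
      exact ray_unbounded 0 (-1, -1) (by simp) (hb.subset subset_union_right)
  · have h0 : (0 : ℝ × ℝ) ∈ Qd := ⟨⟨le_rfl, by norm_num⟩, le_rfl, by norm_num⟩
    refine ⟨_, ray_preconnected x (x - 0), ⟨0, by simp, by simp⟩,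
      (convex_ray Qd_conv h0 hq).trans (compl_subset_compl.2 fun _ h => h.1), ?_⟩
    apply ray_unbounded
    rw [sub_zero]
    rintro rfl
    exact hq h0

/-- complement of a corner set -/
def CC (τ : ℝ × ℝ → ℝ) (r : ℝ) : Set (ℝ × ℝ) := {z | z ∈ Isq ∧ r ≤ dualNorm τ (z + (1, 1))}

lemma CC_eq (τ : ℝ × ℝ → ℝ) (r : ℝ) :
    CC τ r = affH (ContinuousLinearEquiv.refl ℝ (ℝ × ℝ)) (-1, -1) '' SQ (dualNorm τ) r := by
  ext z
  rw [Homeomorph.image_eq_preimage_symm, mem_preimage, affH_symm_apply]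
  have : (ContinuousLinearEquiv.refl ℝ (ℝ × ℝ)).symm (z - (-1, -1)) = z + (1, 1) := by
    ext <;> simp
  rw [this]
  simp only [CC, SQ, Qd, Set.mem_ofPred_eq, mem_Isq, mem_prod, mem_Icc, Prod.fst_add, Prod.snd_add]
  constructor <;> rintro ⟨⟨⟨h1, h2⟩, h3, h4⟩, h5⟩ <;>
    exact ⟨⟨⟨by linarith, by linarith⟩, by linarith, by linarith⟩, h5⟩

lemma CC_JD {τ : ℝ × ℝ → ℝ} (hτ : IsNorm2 τ) {r : ℝ} (hr : 0 < r) (h : Fits τ r) :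
    JD (CC τ r) := by
  have hN := isNorm2_dualNorm hτ
  have hF : ∀ u : ℝ × ℝ, 0 ≤ u.1 → 0 ≤ u.2 → dualNorm τ u ≤ r → u.1 < 2 ∧ u.2 < 2 := by
    intro u h1 h2 h3
    have hm : r⁻¹ • u ∈ WW τ := by
      refine ⟨?_, ?_, ?_⟩
      · rw [← mem_KK_iff hτ, hN.2.1, abs_of_pos (by positivity), inv_mul_le_iff₀ hr, mul_one]
        exact h3
      · simp only [Prod.smul_fst, smul_eq_mul]; positivity
      · simp only [Prod.smul_snd, smul_eq_mul]; positivity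
    have := h _ hm
    simp only [Prod.smul_fst, Prod.smul_snd, smul_eq_mul] at this
    rwa [mul_inv_cancel_left₀ hr.ne', mul_inv_cancel_left₀ hr.ne'] at this
  have hsub : CC τ r ⊆ Isq := fun _ h => h.1
  rw [CC_eq] at hsub ⊢
  refine ⟨(SQ_cpt hN r).image (affH _ _).continuous, hsub, ?_, ?_, ?_⟩
  · rw [← Homeomorph.image_interior]; exact (SQ_int hN hr hF).image _
  · rw [← Homeomorph.image_frontier]
    refine (SQ_curve hN hr hF).image (K := 1) zero_le_one ?_ (affH _ _).injective.injOn
    intro z _ w _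
    simp [affH_apply]
  · rw [← Homeomorph.image_frontier, hullSet_image, ← SQ_hull hN hr]

lemma P2_prop {τ : ℝ × ℝ → ℝ} (hτ : IsNorm2 τ) : ∀ b ∈ Ioo (0 : ℝ) 4, ∃ R, JD R ∧
      volume R = ENNReal.ofReal (4 - b) ∧ surfU τ Isq R ≤ ENNReal.ofReal (2 * √(om τ * b)) := by
  intro b hb
  have ho := om_pos hτ
  have hb0 := hb.1
  set r := √(b / om τ) with hr
  have hr0 : 0 < r := Real.sqrt_pos.2 (by positivity)
  have hr2 : r ^ 2 = b / om τ := Real.sq_sqrt (by positivity)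
  have e1 : r ^ 2 * om τ = b := by rw [hr2]; field_simp
  have e2 : √(om τ * b) = r * om τ := by
    rw [← e1, show om τ * (r ^ 2 * om τ) = (r * om τ) ^ 2 by ring]
    exact Real.sqrt_sq (by positivity)
  rw [e2]
  by_cases hf : Fits τ r
  swap
  · exact nofit hτ hr0 hf (4 - b) ⟨by linarith [hb.2], by linarith⟩
  have hJ := CC_JD hτ hr0 hf
  have hmC := hJ.cpt.measurableSet
  set A := Isq \ CC τ r with hA
  have hmA : MeasurableSet A := measurable_Isq.diff hmC
  have hAI : A ⊆ Isq := sdiff_subset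
  have hlt : ∀ z ∈ A, dualNorm τ (z + (1, 1)) < r := by
    intro z hz
    by_contra hn
    push Not at hn
    exact hz.2 ⟨hz.1, hn⟩
  have hCA : Isq \ A = CC τ r := by
    rw [hA, sdiff_sdiff_right_self]
    exact inter_eq_right.2 hJ.sub
  have hvA : volume.real A = r ^ 2 * om τ := by
    apply le_antisymm
    · have hs : A ⊆ Cor τ r := fun z hz => (mem_Cor hτ hr0).2 ⟨(hlt z hz).le, Isq_quad hz.1⟩
      have := measureReal_mono (μ := volume) hs (by rw [Cor_vol hτ]; exact ofReal_ne_top)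
      rwa [measureReal_def, measureReal_def, Cor_vol hτ, ENNReal.toReal_ofReal (by positivity)] at this
    · have key : ∀ s ∈ Ioo 0 r, s ^ 2 * om τ ≤ volume.real A := by
        intro s hs
        have hss : Cor τ s ⊆ A := by
          intro z hz
          rw [mem_Cor hτ hs.1] at hz
          have hzr : z ∈ Cor τ r := (mem_Cor hτ hr0).2 ⟨hz.1.trans hs.2.le, hz.2⟩
          refine ⟨hf.sub hr0 hzr, fun h => ?_⟩
          have := h.2
          linarith [hs.2, hz.1]
        have := measureReal_mono (μ := volume) hss (Isq_fin hAI)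
        rwa [measureReal_def, Cor_vol hτ, ENNReal.toReal_ofReal (by positivity)] at this
      have ht : Tendsto (fun s : ℝ => s ^ 2 * om τ) (𝓝[<] r) (𝓝 (r ^ 2 * om τ)) := by
        have : ContinuousAt (fun s : ℝ => s ^ 2 * om τ) r := by fun_prop
        exact this.tendsto.mono_left nhdsWithin_le_nhds
      refine le_of_tendsto ht ?_
      filter_upwards [Ioo_mem_nhdsLT hr0] with s hs using key s hs
  refine ⟨CC τ r, hJ, ?_, ?_⟩
  · rw [← hCA, measure_sdiff hAI hmA.nullMeasurableSet (Isq_fin hAI), volume_Isq, vol_of_real hAI,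
      hvA, e1, ENNReal.ofReal_sub _ hb0.le]
    norm_num
  · rw [← hCA, surfU_compl hτ subset_rfl hmA hAI]
    exact Cor_energy hτ hr0 hmA hAI (fun z hz => (hlt z hz).le) hvA

end

end

section
open MeasureTheory Set Filter ENNReal Topology

noncomputable section

/-! Mollification -/

/-- mollification by a bump function -/
def mol (φ : ContDiffBump (0 : ℝ × ℝ)) (f : ℝ × ℝ → ℝ) (z : ℝ × ℝ) : ℝ :=
  ∫ t, φ.normed volume t * f (z - t)

lemma mol_eq (φ : ContDiffBump (0 : ℝ × ℝ)) (f : ℝ × ℝ → ℝ) :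
    mol φ f = MeasureTheory.convolution (φ.normed volume) f (ContinuousLinearMap.lsmul ℝ ℝ) volume := by
  rfl

lemma locInt_of_bdd {f : ℝ × ℝ → ℝ} (hf : Measurable f) {C : ℝ} (hC : ∀ z, |f z| ≤ C) :
    LocallyIntegrable f volume :=
  (locallyIntegrable_const C).mono hf.aestronglyMeasurable (ae_of_all _ fun z => by
    rw [Real.norm_eq_abs, Real.norm_eq_abs]; exact (hC z).trans (le_abs_self C))

lemma mol_smooth (φ : ContDiffBump (0 : ℝ × ℝ)) {f : ℝ × ℝ → ℝ} (hf : Measurable f) {C : ℝ}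
    (hC : ∀ z, |f z| ≤ C) : ContDiff ℝ (⊤ : ℕ∞) (mol φ f) := by
  rw [mol_eq]
  exact φ.hasCompactSupport_normed.contDiff_convolution_left _ φ.contDiff_normed (locInt_of_bdd hf hC)

lemma normed_integrable (φ : ContDiffBump (0 : ℝ × ℝ)) :
    Integrable (φ.normed volume : ℝ × ℝ → ℝ) volume :=
  φ.continuous_normed.integrable_of_hasCompactSupport φ.hasCompactSupport_normed

lemma mol_integrand (φ : ContDiffBump (0 : ℝ × ℝ)) {f : ℝ × ℝ → ℝ} (hf : Measurable f) {C : ℝ}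
    (hC : ∀ z, |f z| ≤ C) (z : ℝ × ℝ) :
    Integrable (fun t => φ.normed volume t * f (z - t)) volume := by
  refine ((normed_integrable φ).mul_const C).mono' ?_ (ae_of_all _ fun t => ?_)
  · exact (φ.continuous_normed.measurable.mul (hf.comp (by fun_prop))).aestronglyMeasurable
  · rw [norm_mul, Real.norm_eq_abs, Real.norm_eq_abs, abs_of_nonneg (φ.nonneg_normed t)]
    exact mul_le_mul_of_nonneg_left (hC _) (φ.nonneg_normed t)

lemma mol_bdd (φ : ContDiffBump (0 : ℝ × ℝ)) {f : ℝ × ℝ → ℝ} (hf : Measurable f) {C : ℝ}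
    (hC : ∀ z, |f z| ≤ C) (z : ℝ × ℝ) : |mol φ f z| ≤ C := by
  have h1 : ‖∫ t, φ.normed volume t * f (z - t)‖ ≤ ∫ t, φ.normed volume t * C := by
    refine norm_integral_le_of_norm_le ((normed_integrable φ).mul_const C) (ae_of_all _ fun t => ?_)
    rw [norm_mul, Real.norm_eq_abs, Real.norm_eq_abs, abs_of_nonneg (φ.nonneg_normed t)]
    exact mul_le_mul_of_nonneg_left (hC _) (φ.nonneg_normed t)
  rw [integral_mul_const, φ.integral_normed, one_mul] at h1
  exact h1

lemma mol_deriv (φ : ContDiffBump (0 : ℝ × ℝ)) {f g : ℝ × ℝ → ℝ} (hf : Measurable f)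
    (hg : Measurable g) {C : ℝ} (hfC : ∀ z, |f z| ≤ C) (hgC : ∀ z, |g z| ≤ C) (e : ℝ × ℝ)
    (h : ∀ z, ∀ t : ℝ, f (z + t • e) - f z = ∫ s in (0 : ℝ)..t, g (z + s • e)) (z : ℝ × ℝ) :
    HasDerivAt (fun t : ℝ => mol φ f (z + t • e)) (mol φ g z) 0 := by
  have hcg : Continuous (fun s : ℝ => mol φ g (z + s • e)) :=
    (mol_smooth φ hg hgC).continuous.comp (by fun_prop)
  have key : ∀ t : ℝ, mol φ f (z + t • e) = mol φ f z + ∫ s in (0 : ℝ)..t, mol φ g (z + s • e) := by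
    intro t
    have h1 : mol φ f (z + t • e) - mol φ f z
        = ∫ u, ∫ s in (0 : ℝ)..t, φ.normed volume u * g (z + s • e - u) := by
      unfold mol
      rw [← integral_sub (mol_integrand φ hf hfC _) (mol_integrand φ hf hfC _)]
      congr 1
      ext u
      rw [← mul_sub, intervalIntegral.integral_const_mul]
      have := h (z - u) t
      rw [show z + t • e - u = z - u + t • e by abel, this]
      congr 2
      ext s
      rw [show z - u + s • e = z + s • e - u by abel]
    have h2 : ∫ u, ∫ s in (0 : ℝ)..t, φ.normed volume u * g (z + s • e - u)
        = ∫ s in (0 : ℝ)..t, mol φ g (z + s • e) := by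
      have hitg : ∀ a b : ℝ, Integrable (Function.uncurry fun (u : ℝ × ℝ) (s : ℝ) =>
          φ.normed volume u * g (z + s • e - u)) (volume.prod (volume.restrict (Ioc a b))) := by
        intro a b
        have hi : Integrable (fun p : (ℝ × ℝ) × ℝ => φ.normed volume p.1 * C)
            (volume.prod (volume.restrict (Ioc a b))) :=
          ((normed_integrable φ).mul_const C).comp_fst _
        refine hi.mono' ?_ (ae_of_all _ fun p => ?_)
        · refine Measurable.aestronglyMeasurable ?_
          exact (φ.continuous_normed.measurable.comp measurable_fst).mul (hg.comp (by fun_prop))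
        · simp only [Function.uncurry]
          rw [norm_mul, Real.norm_eq_abs, Real.norm_eq_abs, abs_of_nonneg (φ.nonneg_normed _)]
          exact mul_le_mul_of_nonneg_left (hgC _) (φ.nonneg_normed _)
      simp only [intervalIntegral]
      rw [integral_sub]
      · rw [integral_integral_swap (hitg _ _), integral_integral_swap (hitg _ _)]; rfl
      · exact (hitg 0 t).integral_prod_left
      · exact (hitg t 0).integral_prod_left
    linarith
  have h3 := intervalIntegral.integral_hasDerivAt_right (hcg.intervalIntegrable 0 0)
    (hcg.stronglyMeasurableAtFilter _ _) hcg.continuousAt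
  simp only [zero_smul, add_zero] at h3
  have h4 := h3.const_add (mol φ f z)
  exact h4.congr_of_eventuallyEq (Eventually.of_forall key)

lemma mol_tsupport (φ : ContDiffBump (0 : ℝ × ℝ)) {f : ℝ × ℝ → ℝ} {K0 : Set (ℝ × ℝ)}
    (h0 : ∀ z ∉ K0, f z = 0) {z : ℝ × ℝ} (hz : z ∉ Metric.cthickening φ.rOut K0) : mol φ f z = 0 := by
  unfold mol
  have : ∀ t, φ.normed volume t * f (z - t) = 0 := by
    intro t
    by_cases ht : t ∈ Metric.ball (0 : ℝ × ℝ) φ.rOut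
    · rw [h0, mul_zero]
      intro hm
      apply hz
      refine Metric.mem_cthickening_of_dist_le z (z - t) _ _ hm ?_
      rw [dist_eq_norm]
      simp only [Metric.mem_ball, dist_zero_right] at ht
      simpa using ht.le
    · rw [← φ.support_normed_eq (μ := volume), Function.notMem_support] at ht
      rw [ht, zero_mul]
  simp [this]

lemma mol_KK {τ : ℝ × ℝ → ℝ} (φ : ContDiffBump (0 : ℝ × ℝ)) {f1 f2 : ℝ × ℝ → ℝ}
    (hf1 : Measurable f1) (hf2 : Measurable f2) {C : ℝ} (h1C : ∀ z, |f1 z| ≤ C)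
    (h2C : ∀ z, |f2 z| ≤ C) (hK : ∀ z, (f1 z, f2 z) ∈ KK τ) (z : ℝ × ℝ) :
    (mol φ f1 z, mol φ f2 z) ∈ KK τ := by
  intro v
  show v.1 * mol φ f1 z + v.2 * mol φ f2 z ≤ τ v
  unfold mol
  rw [← integral_const_mul, ← integral_const_mul, ← integral_add
    ((mol_integrand φ hf1 h1C z).const_mul _) ((mol_integrand φ hf2 h2C z).const_mul _)]
  calc _ ≤ ∫ t, φ.normed volume t * τ v := by
        refine integral_mono (((mol_integrand φ hf1 h1C z).const_mul _).add
          ((mol_integrand φ hf2 h2C z).const_mul _)) ((normed_integrable φ).mul_const _) fun t => ?_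
        have := mul_le_mul_of_nonneg_left (hK (z - t) v) (φ.nonneg_normed (μ := volume) t)
        simp only at this ⊢
        linarith
    _ = τ v := by rw [integral_mul_const, φ.integral_normed, one_mul]

lemma mol_div2 (φ : ContDiffBump (0 : ℝ × ℝ)) {f1 f2 g1 g2 : ℝ × ℝ → ℝ}
    (hf1 : Measurable f1) (hf2 : Measurable f2) (hg1 : Measurable g1) (hg2 : Measurable g2)
    {C : ℝ} (hf1C : ∀ z, |f1 z| ≤ C)
    (hf2C : ∀ z, |f2 z| ≤ C) (hg1C : ∀ z, |g1 z| ≤ C) (hg2C : ∀ z, |g2 z| ≤ C)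
    (h1 : ∀ y x x', f1 (x', y) - f1 (x, y) = ∫ t in x..x', g1 (t, y))
    (h2 : ∀ x y y', f2 (x, y') - f2 (x, y) = ∫ t in y..y', g2 (x, t)) (z : ℝ × ℝ) :
    div2 (fun z => (mol φ f1 z, mol φ f2 z)) z = mol φ g1 z + mol φ g2 z := by
  have hd1 := (mol_smooth φ hf1 hf1C).differentiable (by simp) z
  have hd2 := (mol_smooth φ hf2 hf2C).differentiable (by simp) z
  have hF := hd1.hasFDerivAt.prodMk hd2.hasFDerivAt
  rw [div2, hF.fderiv]
  simp only [ContinuousLinearMap.prod_apply]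
  have hline : ∀ e : ℝ × ℝ, ∀ f : ℝ × ℝ → ℝ, DifferentiableAt ℝ f z →
      HasDerivAt (fun t : ℝ => f (z + t • e)) (fderiv ℝ f z e) 0 := by
    intro e f hf
    have h := hf.hasFDerivAt
    have h0 : HasFDerivAt f (fderiv ℝ f z) (z + (0 : ℝ) • e) := by simpa using h
    have hl : HasDerivAt (fun t : ℝ => z + t • e) e 0 := by
      have := ((hasDerivAt_id (0 : ℝ)).smul_const e).const_add z
      simpa using this
    exact h0.comp_hasDerivAt 0 hl
  congr 1
  · refine (hline (1, 0) _ hd1).unique (mol_deriv φ hf1 hg1 hf1C hg1C (1, 0) ?_ z)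
    intro z t
    have := h1 z.2 z.1 (z.1 + t)
    have e : ∀ s : ℝ, z + s • ((1 : ℝ), (0 : ℝ)) = (z.1 + s, z.2) := by intro s; ext <;> simp
    simp only [e]
    rw [this, intervalIntegral.integral_comp_add_left (fun s => g1 (s, z.2))]
    simp
  · refine (hline (0, 1) _ hd2).unique (mol_deriv φ hf2 hg2 hf2C hg2C (0, 1) ?_ z)
    intro z t
    have := h2 z.1 z.2 (z.2 + t)
    have e : ∀ s : ℝ, z + s • ((0 : ℝ), (1 : ℝ)) = (z.1, z.2 + s) := by intro s; ext <;> simp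
    simp only [e]
    rw [this, intervalIntegral.integral_comp_add_left (fun s => g2 (z.1, s))]
    simp

/-- Lemma M -/
lemma moll {τ : ℝ × ℝ → ℝ} (hτ : IsNorm2 τ) {U A K0 : Set (ℝ × ℝ)}
    (hAf : volume A ≠ ⊤) (hU : IsOpen U) (hK0 : IsCompact K0) (hKU : K0 ⊆ U)
    {f1 f2 g1 g2 : ℝ × ℝ → ℝ}
    (hf1 : Measurable f1) (hf2 : Measurable f2) (hg1 : Measurable g1) (hg2 : Measurable g2)
    {C : ℝ} (hg1C : ∀ z, |g1 z| ≤ C) (hg2C : ∀ z, |g2 z| ≤ C)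
    (hK : ∀ z, (f1 z, f2 z) ∈ KK τ) (h0 : ∀ z ∉ K0, f1 z = 0 ∧ f2 z = 0)
    (h1 : ∀ y x x', f1 (x', y) - f1 (x, y) = ∫ t in x..x', g1 (t, y))
    (h2 : ∀ x y y', f2 (x, y') - f2 (x, y) = ∫ t in y..y', g2 (x, t)) :
    ENNReal.ofReal (∫ z in A, (g1 z + g2 z)) ≤ surfU τ U A := by
  obtain ⟨C', hC'0, hC'⟩ := KK_bdd hτ
  set D := max C C' with hD
  have hf1D : ∀ z, |f1 z| ≤ D := fun z => by
    have := (norm_fst_le (f1 z, f2 z)).trans (hC' _ (hK z))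
    exact this.trans (le_max_right _ _)
  have hf2D : ∀ z, |f2 z| ≤ D := fun z => by
    have := (norm_snd_le (f1 z, f2 z)).trans (hC' _ (hK z))
    exact this.trans (le_max_right _ _)
  have hg1D : ∀ z, |g1 z| ≤ D := fun z => (hg1C z).trans (le_max_left _ _)
  have hg2D : ∀ z, |g2 z| ≤ D := fun z => (hg2C z).trans (le_max_left _ _)
  obtain ⟨δ, hδ, hδU⟩ := hK0.exists_cthickening_subset_open hU hKU
  let φ : ℕ → ContDiffBump (0 : ℝ × ℝ) := fun n =>
    ⟨δ / (n + 1) / 2, δ / (n + 1), by positivity, by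
      have : 0 < δ / ((n : ℝ) + 1) := by positivity
      linarith⟩
  have hr : ∀ n, (φ n).rOut = δ / (n + 1) := fun n => rfl
  have hφ : Tendsto (fun n => (φ n).rOut) atTop (𝓝 0) := by
    simp only [hr]
    have := (tendsto_one_div_add_atTop_nhds_zero_nat (𝕜 := ℝ)).const_mul δ
    simpa [div_eq_mul_inv] using this
  have hφ' : ∀ᶠ n in atTop, (φ n).rOut ≤ 2 * (φ n).rIn := by
    refine Eventually.of_forall fun n => le_of_eq ?_
    show δ / (n + 1) = 2 * (δ / (n + 1) / 2)
    ring
  have ht1 := ContDiffBump.ae_convolution_tendsto_right_of_locallyIntegrable (μ := volume) hφ hφ'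
    (locInt_of_bdd hg1 hg1D)
  have ht2 := ContDiffBump.ae_convolution_tendsto_right_of_locallyIntegrable (μ := volume) hφ hφ'
    (locInt_of_bdd hg2 hg2D)
  simp only [← mol_eq] at ht1 ht2
  haveI : IsFiniteMeasure (volume.restrict A) := ⟨by
    rw [Measure.restrict_apply_univ]; exact lt_top_iff_ne_top.2 hAf⟩
  have hlim : Tendsto (fun n => ∫ z in A, (mol (φ n) g1 z + mol (φ n) g2 z)) atTop
      (𝓝 (∫ z in A, (g1 z + g2 z))) := by
    refine tendsto_integral_of_dominated_convergence (fun _ => D + D) ?_ (integrable_const _) ?_ ?_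
    · intro n
      exact ((mol_smooth (φ n) hg1 hg1D).continuous.add
        (mol_smooth (φ n) hg2 hg2D).continuous).aestronglyMeasurable
    · intro n
      refine ae_of_all _ fun z => (norm_add_le _ _).trans ?_
      exact add_le_add (mol_bdd _ hg1 hg1D z) (mol_bdd _ hg2 hg2D z)
    · filter_upwards [ae_restrict_of_ae ht1, ae_restrict_of_ae ht2] with z hz1 hz2 using hz1.add hz2
  refine le_of_tendsto (ENNReal.tendsto_ofReal hlim) (Eventually.of_forall fun n => ?_)
  have hle : (φ n).rOut ≤ δ := by
    rw [hr]; exact div_le_self hδ.le (by linarith [n.cast_nonneg (α := ℝ)])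
  have hsup : tsupport (fun z => (mol (φ n) f1 z, mol (φ n) f2 z)) ⊆
      Metric.cthickening (φ n).rOut K0 := by
    refine closure_minimal ?_ Metric.isClosed_cthickening
    intro z hz
    by_contra hn
    apply hz
    show (mol (φ n) f1 z, mol (φ n) f2 z) = 0
    rw [mol_tsupport _ (fun z hz => (h0 z hz).1) hn, mol_tsupport _ (fun z hz => (h0 z hz).2) hn]
    rfl
  have hadm : (fun z => (mol (φ n) f1 z, mol (φ n) f2 z)) ∈ adm τ U := by
    refine ⟨(mol_smooth _ hf1 hf1D).prodMk (mol_smooth _ hf2 hf2D), ?_, ?_, ?_⟩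
    · exact hK0.cthickening.of_isClosed_subset (isClosed_tsupport _) hsup
    · exact hsup.trans ((Metric.cthickening_mono hle _).trans hδU)
    · intro z
      rw [mem_KK_iff hτ]
      exact mol_KK _ hf1 hf2 hf1D hf2D hK z
  refine le_trans (le_of_eq ?_) (le_surfU hadm)
  congr 1
  refine integral_congr_ae (ae_of_all _ fun z => ?_)
  exact (mol_div2 _ hf1 hf2 hg1 hg2 hf1D hf2D hg1D hg2D h1 h2 z).symm

/-- fundamental theorem for Lipschitz functions -/
lemma lip_ftc {f g : ℝ → ℝ} {C : ℝ} (hf : ∀ x y, |f x - f y| ≤ C * |x - y|)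
    (hd : ∀ᵐ x, HasDerivAt f (g x) x) (x x' : ℝ) : f x' - f x = ∫ t in x..x', g t := by
  have hL : LipschitzWith (Real.toNNReal C) f := by
    apply LipschitzWith.of_dist_le_mul
    intro a b
    rw [Real.dist_eq, Real.dist_eq]
    refine (hf a b).trans ?_
    exact mul_le_mul_of_nonneg_right (Real.le_coe_toNNReal C) (abs_nonneg _)
  have hAC : AbsolutelyContinuousOnInterval f x x' :=
    (hL.lipschitzOnWith (s := uIcc x x')).absolutelyContinuousOnInterval
  rw [← hAC.integral_deriv_eq_sub]
  refine intervalIntegral.integral_congr_ae ?_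
  filter_upwards [hd] with t ht _ using ht.deriv

end

end

section
open MeasureTheory Set Filter ENNReal Topology

noncomputable section

/-! Column lengths -/

/-- column length -/
def col (S : Set (ℝ × ℝ)) (x : ℝ) : ℝ := volume.real {t | (x, t) ∈ S}

/-- cumulative column length -/
def cum (S : Set (ℝ × ℝ)) (x y : ℝ) : ℝ := volume.real {t | (x, t) ∈ S ∧ t < y}

/-- indicator -/
def ind (S : Set (ℝ × ℝ)) (z : ℝ × ℝ) : ℝ := S.indicator 1 z

lemma ind_meas {S : Set (ℝ × ℝ)} (hS : MeasurableSet S) : Measurable (ind S) :=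
  measurable_one.indicator hS

lemma ind_nonneg (S : Set (ℝ × ℝ)) (z : ℝ × ℝ) : 0 ≤ ind S z :=
  indicator_nonneg (fun _ _ => zero_le_one) z

lemma ind_le (S : Set (ℝ × ℝ)) (z : ℝ × ℝ) : ind S z ≤ 1 :=
  indicator_le_self' (f := (1 : ℝ × ℝ → ℝ)) (fun _ _ => zero_le_one) z

lemma ind_of_mem {S : Set (ℝ × ℝ)} {z : ℝ × ℝ} (h : z ∈ S) : ind S z = 1 := indicator_of_mem h _

lemma ind_of_notMem {S : Set (ℝ × ℝ)} {z : ℝ × ℝ} (h : z ∉ S) : ind S z = 0 :=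
  indicator_of_notMem h _

lemma col_meas {S : Set (ℝ × ℝ)} (hS : MeasurableSet S) : Measurable (col S) :=
  (measurable_measure_prodMk_left hS).ennreal_toReal

lemma cum_meas {S : Set (ℝ × ℝ)} (hS : MeasurableSet S) :
    Measurable (fun z : ℝ × ℝ => cum S z.1 z.2) := by
  have : MeasurableSet {p : (ℝ × ℝ) × ℝ | (p.1.1, p.2) ∈ S ∧ p.2 < p.1.2} := by
    refine MeasurableSet.inter ?_ (measurableSet_lt measurable_snd (measurable_snd.comp measurable_fst))
    exact hS.preimage (f := fun p : (ℝ × ℝ) × ℝ => (p.1.1, p.2)) (by fun_prop)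
  exact (measurable_measure_prodMk_left this).ennreal_toReal

lemma slice_meas {S : Set (ℝ × ℝ)} (hS : MeasurableSet S) (x : ℝ) : MeasurableSet {t | (x, t) ∈ S} :=
  measurable_prodMk_left hS

lemma slice_fin {S : Set (ℝ × ℝ)} {a b : ℝ} (h : S ⊆ univ ×ˢ Ioo a b) (x : ℝ) :
    volume {t | (x, t) ∈ S} ≠ ⊤ :=
  ne_top_of_le_ne_top (by rw [Real.volume_Ioo]; exact ofReal_ne_top)
    (measure_mono (fun t ht => (h ht).2) : volume {t | (x, t) ∈ S} ≤ volume (Ioo a b))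

lemma col_nonneg (S : Set (ℝ × ℝ)) (x : ℝ) : 0 ≤ col S x := measureReal_nonneg

lemma cum_nonneg (S : Set (ℝ × ℝ)) (x y : ℝ) : 0 ≤ cum S x y := measureReal_nonneg

lemma cum_le {S : Set (ℝ × ℝ)} {a b : ℝ} (h : S ⊆ univ ×ˢ Ioo a b) (x y : ℝ) :
    cum S x y ≤ col S x :=
  measureReal_mono (fun _ ht => ht.1) (slice_fin h x)

lemma col_le_len {S : Set (ℝ × ℝ)} {a b : ℝ} (hab : a ≤ b) (h : S ⊆ univ ×ˢ Ioo a b) (x : ℝ) :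
    col S x ≤ b - a := by
  have := measureReal_mono (μ := volume) (fun t ht => (h ht).2 : {t | (x, t) ∈ S} ⊆ Ioo a b)
    (by rw [Real.volume_Ioo]; exact ofReal_ne_top)
  rwa [Real.volume_real_Ioo_of_le hab] at this

lemma cum_zero {S : Set (ℝ × ℝ)} {a b : ℝ} (h : S ⊆ univ ×ˢ Ioo a b) (x : ℝ) {y : ℝ} (hy : y ≤ a) :
    cum S x y = 0 := by
  have : {t | (x, t) ∈ S ∧ t < y} = ∅ := by
    ext t
    simp only [Set.mem_ofPred_eq, mem_empty_iff_false, iff_false]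
    rintro ⟨h1, h2⟩
    have := (h h1).2.1
    linarith
  rw [cum, this, measureReal_empty]

lemma cum_full {S : Set (ℝ × ℝ)} {a b : ℝ} (h : S ⊆ univ ×ˢ Ioo a b) (x : ℝ) {y : ℝ} (hy : b ≤ y) :
    cum S x y = col S x := by
  have : {t | (x, t) ∈ S ∧ t < y} = {t | (x, t) ∈ S} := by
    ext t
    simp only [Set.mem_ofPred_eq, and_iff_left_iff_imp]
    intro h1
    have h2 := (h h1).2.2
    simp only at h2
    linarith
  rw [cum, this, col]

lemma cum_sub {S : Set (ℝ × ℝ)} (hS : MeasurableSet S) {a b : ℝ} (h : S ⊆ univ ×ˢ Ioo a b)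
    (x y y' : ℝ) : cum S x y' - cum S x y = ∫ t in y..y', ind S (x, t) := by
  have key : ∀ y y', y ≤ y' → cum S x y' - cum S x y = ∫ t in y..y', ind S (x, t) := by
    intro y y' hy
    rw [intervalIntegral.integral_of_le hy, integral_Ioc_eq_integral_Ioo, ← integral_Ico_eq_integral_Ioo]
    have e1 : ∀ t, ind S (x, t) = {t | (x, t) ∈ S}.indicator 1 t := fun t => rfl
    simp_rw [e1]
    rw [setIntegral_indicator (slice_meas hS x)]
    simp only [Pi.one_apply]
    rw [setIntegral_const, smul_eq_mul, mul_one, cum, cum]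
    have e2 : {t | (x, t) ∈ S ∧ t < y'} = {t | (x, t) ∈ S ∧ t < y} ∪ (Ico y y' ∩ {t | (x, t) ∈ S}) := by
      ext t
      simp only [Set.mem_ofPred_eq, mem_union, mem_inter_iff, mem_Ico]
      constructor
      · rintro ⟨h1, h2⟩
        rcases lt_or_ge t y with h3 | h3
        · exact Or.inl ⟨h1, h3⟩
        · exact Or.inr ⟨⟨h3, h2⟩, h1⟩
      · rintro (⟨h1, h2⟩ | ⟨⟨h1, h2⟩, h3⟩)
        · exact ⟨h1, h2.trans_le hy⟩
        · exact ⟨h3, h2⟩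
    rw [e2, measureReal_union ?_ ?_ (ne_top_of_le_ne_top (slice_fin h x) (measure_mono fun _ ht => ht.1))
      (ne_top_of_le_ne_top (slice_fin h x) (measure_mono fun _ ht => ht.2))]
    · ring
    · rw [Set.disjoint_left]
      rintro t ⟨_, h1⟩ ⟨⟨h2, _⟩, _⟩
      linarith
    · exact measurableSet_Ico.inter (slice_meas hS x)
  rcases le_total y y' with hy | hy
  · exact key y y' hy
  · rw [intervalIntegral.integral_symm, ← key y' y hy]; ring

lemma KK_seg {τ : ℝ × ℝ → ℝ} (hτ : IsNorm2 τ) {μ : ℝ} (hK : ((0 : ℝ), μ) ∈ KK τ) {s : ℝ}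
    (hs : |s| ≤ μ) : ((0 : ℝ), s) ∈ KK τ := by
  intro v
  have h1 := hK v
  have h2 := hK (-v)
  rw [hτ.neg] at h2
  simp only [Prod.fst_neg, Prod.snd_neg, mul_zero, zero_add, neg_mul] at h1 h2 ⊢
  have h3 : |v.2 * s| ≤ |v.2| * μ := by rw [abs_mul]; gcongr
  have h4 : |v.2| * μ ≤ τ v := by
    rcases abs_choice v.2 with h | h <;> rw [h] <;> linarith
  linarith [le_abs_self (v.2 * s)]

section
open Classical

/-- key field computation for the column bound -/
lemma L1_aux {τ : ℝ × ℝ → ℝ} (hτ : IsNorm2 τ) {μ : ℝ} (hμ : 0 < μ) (hK : ((0 : ℝ), μ) ∈ KK τ)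
    {A : Set (ℝ × ℝ)} (hA : MeasurableSet A) {d θ : ℝ} (hd : 0 < d) (hd1 : d < 1) (hθ : 0 < θ)
    {G : Set ℝ} (hG : MeasurableSet G) (hGI : G ⊆ Ioo (-1 + d) (1 - d))
    (hp : ∀ x ∈ G, θ ≤ col (A ∩ univ ×ˢ Ioo (-1 + d) (1 - d)) x)
    (hq : ∀ x ∈ G, θ ≤ col (Aᶜ ∩ univ ×ˢ Ioo (-1 + d) (1 - d)) x) :
    ENNReal.ofReal (μ * volume.real G) ≤ surfU τ Oq A := by
  set S := A ∩ univ ×ˢ Ioo (-1 + d) (1 - d) with hSd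
  set T := Aᶜ ∩ univ ×ˢ Ioo (-1 + d) (1 - d) with hTd
  have hS : MeasurableSet S := hA.inter (MeasurableSet.univ.prod measurableSet_Ioo)
  have hT : MeasurableSet T := hA.compl.inter (MeasurableSet.univ.prod measurableSet_Ioo)
  have hSs : S ⊆ univ ×ˢ Ioo (-1 + d) (1 - d) := inter_subset_right
  have hTs : T ⊆ univ ×ˢ Ioo (-1 + d) (1 - d) := inter_subset_right
  let c : ℝ → ℝ := fun x => G.indicator (fun _ => μ) x
  have hc : Measurable c := measurable_const.indicator hG
  let f2 : ℝ × ℝ → ℝ := fun z => c z.1 * (cum S z.1 z.2 / col S z.1 - cum T z.1 z.2 / col T z.1)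
  let g2 : ℝ × ℝ → ℝ := fun z => c z.1 * (ind S z / col S z.1 - ind T z / col T z.1)
  have hcol : ∀ {S : Set (ℝ × ℝ)}, MeasurableSet S → Measurable fun z : ℝ × ℝ => col S z.1 :=
    fun hS => (col_meas hS).comp measurable_fst
  have hf2 : Measurable f2 := (hc.comp measurable_fst).mul
    (((cum_meas hS).div (hcol hS)).sub ((cum_meas hT).div (hcol hT)))
  have hg2 : Measurable g2 := (hc.comp measurable_fst).mul
    (((ind_meas hS).div (hcol hS)).sub ((ind_meas hT).div (hcol hT)))
  have hcG : ∀ x ∈ G, c x = μ := fun x hx => indicator_of_mem hx _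
  have hcG' : ∀ x ∉ G, c x = 0 := fun x hx => indicator_of_notMem hx _
  have hg2C : ∀ z, |g2 z| ≤ μ * (1 / θ + 1 / θ) := by
    intro z
    by_cases hz : z.1 ∈ G
    · show |c z.1 * _| ≤ _
      rw [hcG _ hz, abs_mul, abs_of_pos hμ]
      gcongr
      refine (abs_sub _ _).trans ?_
      have h1 : ∀ S : Set (ℝ × ℝ), θ ≤ col S z.1 → |ind S z / col S z.1| ≤ 1 / θ := by
        intro S h
        have : 0 < col S z.1 := by linarith
        rw [abs_of_nonneg (div_nonneg (ind_nonneg _ _) this.le)]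
        gcongr
        exact ind_le _ _
      exact add_le_add (h1 S (hp _ hz)) (h1 T (hq _ hz))
    · show |c z.1 * _| ≤ _
      rw [hcG' _ hz, zero_mul, abs_zero]; positivity
  have hK' : ∀ z, ((0 : ℝ), f2 z) ∈ KK τ := by
    intro z
    apply KK_seg hτ hK
    by_cases hz : z.1 ∈ G
    · show |c z.1 * _| ≤ _
      rw [hcG _ hz, abs_mul, abs_of_pos hμ]
      have h1 : ∀ S : Set (ℝ × ℝ), S ⊆ univ ×ˢ Ioo (-1 + d) (1 - d) → θ ≤ col S z.1 →
          0 ≤ cum S z.1 z.2 / col S z.1 ∧ cum S z.1 z.2 / col S z.1 ≤ 1 := by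
        intro S hs h
        have : 0 < col S z.1 := by linarith
        exact ⟨div_nonneg (cum_nonneg _ _ _) this.le, (div_le_one this).2 (cum_le hs _ _)⟩
      have h2 := h1 S hSs (hp _ hz)
      have h3 := h1 T hTs (hq _ hz)
      have : |cum S z.1 z.2 / col S z.1 - cum T z.1 z.2 / col T z.1| ≤ 1 := by
        rw [abs_le]; constructor <;> linarith
      nlinarith
    · show |c z.1 * _| ≤ _
      rw [hcG' _ hz, zero_mul, abs_zero]; exact hμ.le
  have hmain := moll (f1 := fun _ => 0) (g1 := fun _ => 0) (f2 := f2) (g2 := g2) hτ (U := Oq)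
    (A := A ∩ Oq) (K0 := Icc (-1 + d) (1 - d) ×ˢ Icc (-1 + d) (1 - d))
    (Isq_fin (inter_subset_right.trans (Oq_sub.trans Osq_sub))) (isOpen_Ioo.prod isOpen_Ioo)
    (isCompact_Icc.prod isCompact_Icc) (prod_mono (Icc_subset_Ioo (by linarith) (by linarith))
      (Icc_subset_Ioo (by linarith) (by linarith)))
    measurable_const hf2 measurable_const hg2 (C := μ * (1 / θ + 1 / θ))
    (fun _ => by rw [abs_zero]; positivity) hg2C hK' ?_ ?_ ?_
  · have e : surfU τ Oq (A ∩ Oq) = surfU τ Oq A :=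
      surfU_inter (by rw [inter_assoc, inter_self]) (measurableSet_Ioo.prod measurableSet_Ioo)
    rw [e] at hmain
    refine le_trans (le_of_eq ?_) hmain
    congr 1
    simp only [zero_add]
    have hAO : MeasurableSet (A ∩ Oq) := hA.inter (measurableSet_Ioo.prod measurableSet_Ioo)
    rw [← integral_indicator hAO]
    have e2 : ∀ z, (A ∩ Oq).indicator g2 z = c z.1 * (ind S z / col S z.1) := by
      intro z
      by_cases hz : z.1 ∈ G
      · by_cases hzS : z ∈ S
        · have hm : z ∈ A ∩ Oq := by
            refine ⟨hzS.1, ?_, ?_⟩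
            · have := hGI hz; exact ⟨by linarith [this.1], by linarith [this.2]⟩
            · have := hzS.2.2; exact ⟨by linarith [this.1], by linarith [this.2]⟩
          have hzT : z ∉ T := fun h => h.1 hzS.1
          rw [indicator_of_mem hm]
          show c z.1 * _ = _
          rw [ind_of_notMem hzT]; ring
        · rw [ind_of_notMem hzS, zero_div, mul_zero]
          by_cases hm : z ∈ A ∩ Oq
          · rw [indicator_of_mem hm]
            show c z.1 * _ = _
            have hzT : z ∉ T := fun h => h.1 hm.1
            rw [ind_of_notMem hzT, ind_of_notMem hzS]; ring
          · rw [indicator_of_notMem hm]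
      · rw [hcG' _ hz, zero_mul]
        by_cases hm : z ∈ A ∩ Oq
        · rw [indicator_of_mem hm]
          show c z.1 * _ = _
          rw [hcG' _ hz, zero_mul]
        · rw [indicator_of_notMem hm]
    simp_rw [e2]
    have hitg : Integrable (fun z : ℝ × ℝ => c z.1 * (ind S z / col S z.1)) (volume.prod volume) := by
      have hb : Integrable ((Icc (-1 : ℝ) 1 ×ˢ Icc (-1 : ℝ) 1).indicator (fun _ => μ * (1 / θ)))
          (volume.prod volume : Measure (ℝ × ℝ)) := by
        rw [integrable_indicator_iff (measurableSet_Icc.prod measurableSet_Icc)]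
        refine integrableOn_const ?_
        rw [← Measure.volume_eq_prod]
        exact (isCompact_Icc.prod isCompact_Icc).measure_ne_top
      refine hb.mono' ?_ (ae_of_all _ fun z => ?_)
      · exact ((hc.comp measurable_fst).mul ((ind_meas hS).div (hcol hS))).aestronglyMeasurable
      · by_cases hz : z.1 ∈ G
        · by_cases hzS : z ∈ S
          · have hm : z ∈ (Icc (-1 : ℝ) 1 ×ˢ Icc (-1 : ℝ) 1) := by
              refine ⟨?_, ?_⟩
              · have := hGI hz; exact ⟨by linarith [this.1], by linarith [this.2]⟩
              · have := hzS.2.2; exact ⟨by linarith [this.1], by linarith [this.2]⟩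
            have := hp _ hz
            have h0 : 0 < col S z.1 := by linarith
            rw [indicator_of_mem hm, hcG _ hz, ind_of_mem hzS, Real.norm_eq_abs,
              abs_of_nonneg (by positivity)]
            gcongr
          · rw [ind_of_notMem hzS, zero_div, mul_zero, norm_zero]
            exact indicator_nonneg (fun _ _ => by positivity) _
        · rw [hcG' _ hz, zero_mul, norm_zero]
          exact indicator_nonneg (fun _ _ => by positivity) _
    rw [Measure.volume_eq_prod, integral_prod _ hitg]
    have e3 : ∀ x, ∫ y, c x * (ind S (x, y) / col S x) = c x := by
      intro x
      by_cases hx : x ∈ G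
      · have := hp _ hx
        have h0 : col S x ≠ 0 := by linarith
        rw [integral_const_mul, integral_div]
        have : ∫ y, ind S (x, y) = col S x := by
          have e1 : ∀ t, ind S (x, t) = {t | (x, t) ∈ S}.indicator 1 t := fun t => rfl
          simp_rw [e1]
          rw [integral_indicator_one (slice_meas hS x)]; rfl
        rw [this, div_self h0, mul_one]
      · simp [hcG' _ hx]
    simp only [e3]
    show _ = ∫ x, G.indicator (fun _ => μ) x
    rw [integral_indicator hG, setIntegral_const, smul_eq_mul, mul_comm]
  · intro z hz
    refine ⟨rfl, ?_⟩
    show c z.1 * _ = 0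
    by_cases hzG : z.1 ∈ G
    · have h0 : z.2 ∉ Icc (-1 + d) (1 - d) := fun h => hz ⟨Ioo_subset_Icc_self (hGI hzG), h⟩
      rw [mem_Icc, not_and_or, not_le, not_le] at h0
      rcases h0 with h0 | h0
      · rw [cum_zero hSs _ h0.le, cum_zero hTs _ h0.le]; ring
      · have h1 := hp _ hzG
        have h2 := hq _ hzG
        rw [cum_full hSs _ h0.le, cum_full hTs _ h0.le, div_self (by linarith),
          div_self (by linarith)]; ring
    · rw [hcG' _ hzG, zero_mul]
  · intro y x x'; simp
  · intro x y y'
    show c x * _ - c x * _ = ∫ t in y..y', c x * _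
    rw [intervalIntegral.integral_const_mul, ← mul_sub]
    congr 1
    have hi : ∀ {S : Set (ℝ × ℝ)}, MeasurableSet S →
        IntervalIntegrable (fun t => ind S (x, t)) volume y y' := by
      intro S hS
      refine (intervalIntegrable_const (c := (1 : ℝ))).mono_fun ?_ (ae_of_all _ fun t => ?_)
      · exact ((ind_meas hS).comp measurable_prodMk_left).aestronglyMeasurable
      · show ‖ind S (x, t)‖ ≤ ‖(1 : ℝ)‖
        rw [Real.norm_eq_abs, Real.norm_eq_abs, abs_of_nonneg (ind_nonneg _ _), abs_one]
        exact ind_le _ _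
    simp only
    rw [intervalIntegral.integral_sub ((hi hS).div_const _) ((hi hT).div_const _),
      intervalIntegral.integral_div, intervalIntegral.integral_div, ← cum_sub hS hSs, ← cum_sub hT hTs]
    ring

end

/-- exhausting margins -/
def dn (n : ℕ) : ℝ := 1 / ((n : ℝ) + 2)

lemma dn_pos (n : ℕ) : 0 < dn n := by unfold dn; positivity

lemma dn_lt (n : ℕ) : dn n < 1 := by
  unfold dn; rw [div_lt_one (by positivity)]; have := Nat.cast_nonneg (α := ℝ) n; linarith

lemma dn_anti : Antitone dn := by
  intro m n h
  unfold dn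
  have : (m : ℝ) ≤ n := by exact_mod_cast h
  gcongr

lemma dn_small {e : ℝ} (he : 0 < e) : ∃ N, ∀ n ≥ N, dn n < e := by
  obtain ⟨N, hN⟩ := exists_nat_gt (1 / e)
  refine ⟨N, fun n hn => ?_⟩
  have : (N : ℝ) ≤ n := by exact_mod_cast hn
  unfold dn
  rw [div_lt_iff₀ (by positivity)]
  rw [div_lt_iff₀ he] at hN
  nlinarith

/-- truncated strip -/
def strp (n : ℕ) : Set (ℝ × ℝ) := univ ×ˢ Ioo (-1 + dn n) (1 - dn n)

lemma strp_mono : Monotone strp := by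
  intro m n h
  have := dn_anti h
  exact prod_mono le_rfl (Ioo_subset_Ioo (by linarith) (by linarith))

lemma col_mono {S T : Set (ℝ × ℝ)} {a b : ℝ} (hST : S ⊆ T) (h : T ⊆ univ ×ˢ Ioo a b) (x : ℝ) :
    col S x ≤ col T x := measureReal_mono (fun _ ht => hST ht) (slice_fin h x)

lemma L1_ev {B : Set (ℝ × ℝ)} {x : ℝ} (hB : volume {t | (x, t) ∈ B ∩ Oq} ≠ 0) :
    ∃ N, ∀ n ≥ N, dn n ≤ col (B ∩ strp n) x := by
  obtain ⟨n0, hn0⟩ : ∃ n, volume {t | (x, t) ∈ B ∩ strp n} ≠ 0 := by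
    by_contra hc
    push Not at hc
    apply hB
    refine measure_mono_null ?_ (measure_iUnion_null hc)
    intro t ht
    have ht1 : (x, t) ∈ B ∩ Oq := ht
    have h1 : -1 < t := ht1.2.2.1
    have h2 : t < 1 := ht1.2.2.2
    obtain ⟨N, hN⟩ := dn_small (lt_min (by linarith : 0 < t + 1) (by linarith : 0 < 1 - t))
    have h3 := lt_min_iff.1 (hN N le_rfl)
    exact mem_iUnion.2 ⟨N, ht1.1, trivial, by show -1 + dn N < t; linarith, by show t < 1 - dn N; linarith⟩
  have hpos : 0 < col (B ∩ strp n0) x :=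
    ENNReal.toReal_pos hn0 (slice_fin inter_subset_right x)
  obtain ⟨N, hN⟩ := dn_small hpos
  refine ⟨max N n0, fun n hn => (hN n ((le_max_left _ _).trans hn)).le.trans ?_⟩
  exact col_mono (inter_subset_inter_right _ (strp_mono ((le_max_right _ _).trans hn)))
    inter_subset_right x

lemma L1 {τ : ℝ × ℝ → ℝ} (hτ : IsNorm2 τ) {μ : ℝ} (hμ : 0 < μ) (hK : ((0 : ℝ), μ) ∈ KK τ)
    {A : Set (ℝ × ℝ)} (hA : MeasurableSet A)
    (hn : ∀ᵐ x, x ∈ Ioo (-1 : ℝ) 1 → volume {t | (x, t) ∈ A ∩ Oq} ≠ 0 ∧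
      volume {t | (x, t) ∈ Aᶜ ∩ Oq} ≠ 0) :
    ENNReal.ofReal (2 * μ) ≤ surfU τ Oq A := by
  have hms : ∀ n, MeasurableSet (strp n) := fun n => MeasurableSet.univ.prod measurableSet_Ioo
  let G : ℕ → Set ℝ := fun n => Ioo (-1 + dn n) (1 - dn n) ∩
    ({x | dn n ≤ col (A ∩ strp n) x} ∩ {x | dn n ≤ col (Aᶜ ∩ strp n) x})
  have hGm : ∀ n, MeasurableSet (G n) := fun n => measurableSet_Ioo.inter
    ((measurableSet_le measurable_const (col_meas (hA.inter (hms n)))).inter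
      (measurableSet_le measurable_const (col_meas (hA.compl.inter (hms n)))))
  have hmono : Monotone G := by
    intro m n h
    have hd := dn_anti h
    rintro x ⟨⟨h1, h2⟩, h3, h4⟩
    refine ⟨⟨by linarith, by linarith⟩, ?_, ?_⟩
    · exact (hd.trans h3).trans (col_mono (inter_subset_inter_right _ (strp_mono h)) inter_subset_right x)
    · exact (hd.trans h4).trans (col_mono (inter_subset_inter_right _ (strp_mono h)) inter_subset_right x)
  have hG1 : ∀ n, ENNReal.ofReal μ * volume (G n) ≤ surfU τ Oq A := by
    intro n
    have := L1_aux hτ hμ hK hA (dn_pos n) (dn_lt n) (dn_pos n) (hGm n) inter_subset_left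
      (fun x hx => hx.2.1) (fun x hx => hx.2.2)
    have hfin : volume (G n) ≠ ⊤ := ne_top_of_le_ne_top (b := volume (Ioo (-1 + dn n) (1 - dn n)))
      (by rw [Real.volume_Ioo]; exact ofReal_ne_top) (measure_mono inter_subset_left)
    rwa [ENNReal.ofReal_mul hμ.le, ofReal_measureReal hfin] at this
  have hU : volume (Ioo (-1 : ℝ) 1) ≤ volume (⋃ n, G n) := by
    refine measure_mono_ae ?_
    filter_upwards [hn] with x hx hxI
    obtain ⟨hx1, hx2⟩ := hx hxI
    obtain ⟨N1, hN1⟩ := L1_ev hx1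
    obtain ⟨N2, hN2⟩ := L1_ev hx2
    have hxI' : -1 < x ∧ x < 1 := hxI
    obtain ⟨N3, hN3⟩ := dn_small (lt_min (by linarith : 0 < x + 1) (by linarith : 0 < 1 - x))
    set N := max N1 (max N2 N3)
    have h3 := lt_min_iff.1 (hN3 N ((le_max_right _ _).trans (le_max_right _ _)))
    exact mem_iUnion.2 ⟨N, ⟨by linarith, by linarith⟩, hN1 N (le_max_left _ _),
      hN2 N ((le_max_left _ _).trans (le_max_right _ _))⟩
  rw [hmono.measure_iUnion] at hU
  calc ENNReal.ofReal (2 * μ) = ENNReal.ofReal μ * volume (Ioo (-1 : ℝ) 1) := by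
        rw [Real.volume_Ioo, ← ENNReal.ofReal_mul hμ.le]; congr 1; ring
    _ ≤ ENNReal.ofReal μ * ⨆ n, volume (G n) := by gcongr
    _ = ⨆ n, ENNReal.ofReal μ * volume (G n) := ENNReal.mul_iSup _ _
    _ ≤ _ := iSup_le hG1

end

end

section
open MeasureTheory Set Filter ENNReal Topology

noncomputable section

/-! Lipschitz functions with prescribed a.e. derivative -/

/-- bounded Lipschitz with a.e. derivative `g` -/
def LD (f g : ℝ → ℝ) : Prop :=
  (∃ C : ℝ, (∀ x y, |f x - f y| ≤ C * |x - y|) ∧ ∀ x, |f x| ≤ C) ∧ ∀ᵐ x, HasDerivAt f (g x) x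

lemma LD.ftc {f g : ℝ → ℝ} (h : LD f g) (x x' : ℝ) : f x' - f x = ∫ t in x..x', g t := by
  obtain ⟨⟨C, hC, _⟩, hd⟩ := h
  exact lip_ftc hC hd x x'

lemma LD.mul {f g f' g' : ℝ → ℝ} (h : LD f f') (h' : LD g g') :
    LD (fun x => f x * g x) (fun x => f' x * g x + f x * g' x) := by
  obtain ⟨⟨C, hC, hCb⟩, hd⟩ := h
  obtain ⟨⟨D, hD, hDb⟩, hd'⟩ := h'
  have hC0 : 0 ≤ C := (abs_nonneg _).trans (hCb 0)
  have hD0 : 0 ≤ D := (abs_nonneg _).trans (hDb 0)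
  refine ⟨⟨2 * C * D, ?_, ?_⟩, ?_⟩
  · intro x y
    have : f x * g x - f y * g y = f x * (g x - g y) + (f x - f y) * g y := by ring
    rw [this]
    calc |f x * (g x - g y) + (f x - f y) * g y| ≤ |f x| * |g x - g y| + |f x - f y| * |g y| := by
          rw [← abs_mul, ← abs_mul]; exact abs_add_le _ _
      _ ≤ C * (D * |x - y|) + (C * |x - y|) * D := by
          gcongr
          exacts [hCb x, hD x y, hC x y, hDb y]
      _ = _ := by ring
  · intro x
    rw [abs_mul]
    have := mul_le_mul (hCb x) (hDb x) (abs_nonneg _) hC0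
    nlinarith [mul_nonneg hC0 hD0]
  · filter_upwards [hd, hd'] with x h1 h2
    exact h1.mul h2

lemma LD.const (c : ℝ) : LD (fun _ => c) (fun _ => 0) :=
  ⟨⟨|c|, fun x y => by simp; positivity, fun _ => le_rfl⟩, ae_of_all _ fun x => hasDerivAt_const x c⟩

lemma LD.of_int {f g : ℝ → ℝ} {C : ℝ} (hg : Measurable g) (hgC : ∀ x, |g x| ≤ C) (hfC : ∀ x, |f x| ≤ C)
    (h : ∀ x x', f x' - f x = ∫ t in x..x', g t) : LD f g := by
  refine ⟨⟨C, ?_, hfC⟩, ?_⟩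
  · intro x y
    rw [h y x]
    exact intervalIntegral.norm_integral_le_of_norm_le_const (f := g) (C := C) (fun t _ => hgC t)
  · have hloc : LocallyIntegrable g := by
      refine (locallyIntegrable_const C).mono hg.aestronglyMeasurable (ae_of_all _ fun x => ?_)
      rw [Real.norm_eq_abs, Real.norm_eq_abs]
      exact (hgC x).trans (le_abs_self _)
    filter_upwards [_root_.LocallyIntegrable.ae_hasDerivAt_integral hloc] with x hx
    have := (hx 0).const_add (f 0)
    refine this.congr_of_eventuallyEq (Eventually.of_forall fun y => ?_)
    show f y = f 0 + ∫ t in (0:ℝ)..y, g t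
    rw [← h 0 y]; ring

/-- cutoff function descending only on `Z` -/
lemma cutoff {X δ : ℝ} (hδ : 0 < δ) (hX : 3 * δ < X) {Z : Set ℝ} (hZ : MeasurableSet Z)
    (hZp : volume (Z ∩ Ioo (X - δ) X) ≠ 0) :
    ∃ (η h : ℝ → ℝ) (e C : ℝ), 0 < e ∧ Measurable h ∧ (∀ x, |h x| ≤ C) ∧ Measurable η ∧ LD η h ∧
      (∀ x, 0 ≤ η x ∧ η x ≤ 1) ∧ (∀ x ∈ Icc (2 * δ) (X - δ), η x = 1) ∧
      (∀ x, x ∉ Icc e (X - e) → η x = 0) ∧ ∀ x, x ∉ Z → 0 ≤ h x := by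
  obtain ⟨n, hn⟩ : ∃ n : ℕ, volume (Z ∩ Ioo (X - δ) (X - dn n)) ≠ 0 := by
    by_contra hc
    push Not at hc
    apply hZp
    refine measure_mono_null ?_ (measure_iUnion_null hc)
    rintro t ⟨ht1, ht2, ht3⟩
    obtain ⟨N, hN⟩ := dn_small (by linarith : 0 < X - t)
    have := hN N le_rfl
    exact mem_iUnion.2 ⟨N, ht1, ht2, by linarith⟩
  set S : Set (ℝ × ℝ) := univ ×ˢ Ioo δ (2 * δ) with hSd
  set T : Set (ℝ × ℝ) := univ ×ˢ (Z ∩ Ioo (X - δ) (X - dn n)) with hTd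
  have hS : MeasurableSet S := MeasurableSet.univ.prod measurableSet_Ioo
  have hT : MeasurableSet T := MeasurableSet.univ.prod (hZ.inter measurableSet_Ioo)
  have hSs : S ⊆ univ ×ˢ Ioo δ (2 * δ) := le_rfl
  have hTs : T ⊆ univ ×ˢ Ioo (X - δ) (X - dn n) := prod_mono le_rfl inter_subset_right
  have hcT : 0 < col T 0 := by
    refine ENNReal.toReal_pos ?_ (slice_fin hTs 0)
    have : {t | ((0:ℝ), t) ∈ T} = Z ∩ Ioo (X - δ) (X - dn n) := by
      ext t; simp only [hTd, Set.mem_ofPred_eq, mem_prod, mem_univ, true_and]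
    rw [this]; exact hn
  have hcS : 0 < col S 0 := by
    refine ENNReal.toReal_pos ?_ (slice_fin hSs 0)
    have : {t | ((0:ℝ), t) ∈ S} = Ioo δ (2 * δ) := by
      ext t; simp [hSd]
    rw [this, Real.volume_Ioo]; simp; linarith
  have fr : ∀ S : Set (ℝ × ℝ), ∀ a b, S ⊆ univ ×ˢ Ioo a b → 0 < col S 0 → ∀ x,
      0 ≤ cum S 0 x / col S 0 ∧ cum S 0 x / col S 0 ≤ 1 := by
    intro S a b hs h x
    exact ⟨div_nonneg (cum_nonneg _ _ _) h.le, (div_le_one h).2 (cum_le hs _ _)⟩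
  have frS := fr S _ _ hSs hcS
  have frT := fr T _ _ hTs hcT
  let η : ℝ → ℝ := fun x => cum S 0 x / col S 0 - cum T 0 x / col T 0
  let h : ℝ → ℝ := fun x => ind S (0, x) / col S 0 - ind T (0, x) / col T 0
  have hηl : ∀ x, x ≤ X - δ → η x = cum S 0 x / col S 0 := by
    intro x hx
    show _ - _ = _
    rw [cum_zero hTs 0 hx, zero_div, sub_zero]
  have hηr : ∀ x, 2 * δ ≤ x → η x = 1 - cum T 0 x / col T 0 := by
    intro x hx
    show _ - _ = _
    rw [cum_full hSs 0 hx, div_self hcS.ne']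
  have hb : ∀ x, 0 ≤ η x ∧ η x ≤ 1 := by
    intro x
    rcases le_total x (X - δ) with hx | hx
    · rw [hηl x hx]; exact frS x
    · rw [hηr x (by linarith)]
      have := frT x
      constructor <;> linarith
  have hmi : ∀ {S : Set (ℝ × ℝ)}, MeasurableSet S → Measurable fun x => ind S ((0:ℝ), x) :=
    fun hS => (ind_meas hS).comp measurable_prodMk_left
  have hhm : Measurable h := ((hmi hS).div_const _).sub ((hmi hT).div_const _)
  have hi : ∀ {S : Set (ℝ × ℝ)}, MeasurableSet S → ∀ y y',
      IntervalIntegrable (fun t => ind S ((0:ℝ), t)) volume y y' := by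
    intro S hS y y'
    refine (intervalIntegrable_const (c := (1 : ℝ))).mono_fun ?_ (ae_of_all _ fun t => ?_)
    · exact (hmi hS).aestronglyMeasurable
    · show ‖ind S (0, t)‖ ≤ ‖(1 : ℝ)‖
      rw [Real.norm_eq_abs, Real.norm_eq_abs, abs_of_nonneg (ind_nonneg _ _), abs_one]
      exact ind_le _ _
  have hCb : ∀ x, |h x| ≤ 1 + (1 / col S 0 + 1 / col T 0) := by
    intro x
    have h1 : ∀ S : Set (ℝ × ℝ), 0 < col S 0 → |ind S (0, x) / col S 0| ≤ 1 / col S 0 := by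
      intro S hp
      rw [abs_of_nonneg (div_nonneg (ind_nonneg _ _) hp.le)]
      gcongr
      exact ind_le _ _
    have := (abs_sub (ind S (0, x) / col S 0) (ind T (0, x) / col T 0)).trans
      (add_le_add (h1 S hcS) (h1 T hcT))
    show |_ - _| ≤ _
    linarith
  refine ⟨η, h, min δ (dn n), 1 + (1 / col S 0 + 1 / col T 0), lt_min hδ (dn_pos n), hhm, hCb, ?_, ?_,
    hb, ?_, ?_, ?_⟩
  · have hm : ∀ {S : Set (ℝ × ℝ)}, MeasurableSet S → Measurable fun x => cum S 0 x :=
      fun hS => (cum_meas hS).comp (measurable_prodMk_left (x := (0:ℝ)))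
    exact ((hm hS).div_const _).sub ((hm hT).div_const _)
  · refine LD.of_int hhm hCb ?_ ?_
    · intro x
      rw [abs_of_nonneg (hb x).1]
      have : 0 < 1 / col S 0 + 1 / col T 0 := by positivity
      linarith [(hb x).2]
    · intro x x'
      show _ - _ - (_ - _) = ∫ t in x..x', (_ - _)
      rw [intervalIntegral.integral_sub ((hi hS _ _).div_const _) ((hi hT _ _).div_const _),
        intervalIntegral.integral_div, intervalIntegral.integral_div, ← cum_sub hS hSs, ← cum_sub hT hTs]
      ring
  · intro x hx
    rw [hηl x hx.2, cum_full hSs 0 hx.1, div_self hcS.ne']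
  · intro x hx
    rw [mem_Icc, not_and_or, not_le, not_le] at hx
    rcases hx with hx | hx
    · have := lt_min_iff.1 hx
      rw [hηl x (by linarith), cum_zero hSs 0 this.1.le, zero_div]
    · have h1 : X - dn n < x ∨ X - δ < x := by
        rcases min_choice δ (dn n) with h | h <;> rw [h] at hx <;> tauto
      rcases le_total (dn n) δ with h2 | h2
      · rw [min_eq_right h2] at hx
        rw [hηr x (by linarith), cum_full hTs 0 hx.le, div_self hcT.ne', sub_self]
      · exfalso
        apply hn
        rw [Ioo_eq_empty (by linarith), inter_empty, measure_empty]
  · intro x hx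
    have : ((0:ℝ), x) ∉ T := fun h => hx h.2.1
    show 0 ≤ _ - _
    rw [ind_of_notMem this, zero_div, sub_zero]
    exact div_nonneg (ind_nonneg _ _) hcS.le

/-- inverse of a primitive -/
lemma inv_prim {w : ℝ → ℝ} (hw : Continuous w) {c : ℝ} (hc : 0 < c) (hcw : ∀ t, c ≤ w t) (p1 p2 : ℝ) :
    ∃ H : ℝ → ℝ, (∀ t, HasDerivAt H (1 / w (H t)) t) ∧ H 0 = p1 ∧ H (∫ t in p1..p2, w t) = p2 ∧
      Monotone H := by
  let G : ℝ → ℝ := fun t => ∫ s in p1..t, w s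
  have hd : ∀ t, HasDerivAt G (w t) t := fun t =>
    intervalIntegral.integral_hasDerivAt_right (hw.intervalIntegrable _ _)
      (hw.stronglyMeasurableAtFilter _ _) hw.continuousAt
  have hGc : Continuous G := continuous_iff_continuousAt.2 fun t => (hd t).continuousAt
  have hmono : StrictMono G := strictMono_of_hasDerivAt_pos hd fun t => hc.trans_le (hcw t)
  have hlow : ∀ t, p1 ≤ t → c * (t - p1) ≤ G t := by
    intro t ht
    have := intervalIntegral.integral_mono_on (μ := volume) ht (f := fun _ => c) (g := w)
      intervalIntegrable_const (hw.intervalIntegrable _ _) (fun s _ => hcw s)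
    rw [intervalIntegral.integral_const, smul_eq_mul] at this
    show _ ≤ ∫ s in p1..t, w s
    linarith
  have hup : ∀ t, t ≤ p1 → G t ≤ c * (t - p1) := by
    intro t ht
    have := intervalIntegral.integral_mono_on (μ := volume) ht (f := fun _ => c) (g := w)
      intervalIntegrable_const (hw.intervalIntegrable _ _) (fun s _ => hcw s)
    rw [intervalIntegral.integral_const, smul_eq_mul] at this
    show ∫ s in p1..t, w s ≤ _
    rw [intervalIntegral.integral_symm]
    linarith
  have hsurj : Function.Surjective G := by
    refine hGc.surjective ?_ ?_
    · refine tendsto_atTop_mono' atTop (f₁ := fun t => c * (t - p1)) ?_ ?_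
      · filter_upwards [eventually_ge_atTop p1] with t ht using hlow t ht
      · exact (tendsto_atTop_add_const_right atTop (-p1) tendsto_id).const_mul_atTop hc
    · refine tendsto_atBot_mono' atBot (f₁ := fun t => c * (t - p1)) ?_ ?_
      · filter_upwards [eventually_le_atBot p1] with t ht using hup t ht
      · exact (tendsto_atBot_add_const_right atBot (-p1) tendsto_id).const_mul_atBot hc
  let e := hmono.orderIsoOfSurjective G hsurj
  have he : ∀ t, e t = G t := fun t => rfl
  refine ⟨e.symm, ?_, ?_, ?_, e.symm.monotone⟩
  · intro t
    rw [one_div]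
    refine HasDerivAt.of_local_left_inverse (f := G) ?_ (hd _) (hc.trans_le (hcw _)).ne' ?_
    · exact e.symm.toHomeomorph.continuous.continuousAt
    · exact Eventually.of_forall fun y => e.apply_symm_apply y
  · rw [e.symm_apply_eq, he]; simp [G]
  · rw [e.symm_apply_eq, he]

end

end

section
open MeasureTheory Set Filter ENNReal Topology

noncomputable section

/-- lower profile -/
def lW (τ : ℝ × ℝ → ℝ) (t : ℝ) : ℝ := sInf {s | (t, s) ∈ WW τ}
/-- upper profile -/
def uW (τ : ℝ × ℝ → ℝ) (t : ℝ) : ℝ := sSup {s | (t, s) ∈ WW τ}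

lemma slW_cpt {τ : ℝ × ℝ → ℝ} (hτ : IsNorm2 τ) (t : ℝ) : IsCompact {s | (t, s) ∈ WW τ} := by
  have h1 : IsCompact (Prod.snd '' (WW τ)) := (WW_cpt hτ).image continuous_snd
  refine h1.of_isClosed_subset ?_ (fun s hs => ⟨(t, s), hs, rfl⟩)
  exact (WW_cpt hτ).isClosed.preimage (by fun_prop : Continuous fun s : ℝ => (t, s))

lemma slW_eq {τ : ℝ × ℝ → ℝ} (hτ : IsNorm2 τ) {t : ℝ} (hne : {s | (t, s) ∈ WW τ}.Nonempty) :
    {s | (t, s) ∈ WW τ} = Icc (lW τ t) (uW τ t) := by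
  have hc := slW_cpt hτ t
  apply subset_antisymm
  · intro s hs
    exact ⟨csInf_le hc.bddBelow hs, le_csSup hc.bddAbove hs⟩
  · have h1 := hc.sInf_mem hne
    have h2 := hc.sSup_mem hne
    have hcv : Convex ℝ {s | (t, s) ∈ WW τ} := by
      intro x hx y hy a b ha hb hab
      have := WW_conv τ hx hy ha hb hab
      have e : a • (t, x) + b • (t, y) = (t, a • x + b • y) := by
        ext
        · simp only [Prod.smul_mk, Prod.mk_add_mk, smul_eq_mul]; rw [← add_mul, hab, one_mul]
        · rfl
      rw [e] at this
      exact this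
    exact hcv.ordConnected.out h1 h2

lemma WW_top {τ : ℝ × ℝ → ℝ} (hτ : IsNorm2 τ) : ∃ p : ℝ, 0 < p ∧ (∀ z ∈ WW τ, z.1 ≤ p) ∧
    ∀ t, 0 < t → t < p → ∃ s1 s2, s1 < s2 ∧ (t, s1) ∈ WW τ ∧ (t, s2) ∈ WW τ := by
  obtain ⟨c, hc, h⟩ := KK_nhds hτ
  have hbox : ∀ x y : ℝ, 0 ≤ x → x ≤ c → 0 ≤ y → y ≤ c → (x, y) ∈ WW τ := by
    intro x y h1 h2 h3 h4
    refine ⟨h _ ?_, h1, h3⟩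
    rw [Prod.norm_mk, Real.norm_eq_abs, Real.norm_eq_abs, abs_of_nonneg h1, abs_of_nonneg h3]
    exact max_le h2 h4
  obtain ⟨z, hz, hmax⟩ := (WW_cpt hτ).exists_isMaxOn ⟨(0, 0), hbox 0 0 le_rfl hc.le le_rfl hc.le⟩
    continuous_fst.continuousOn
  have hzc : c ≤ z.1 := hmax (hbox c 0 hc.le le_rfl le_rfl hc.le)
  refine ⟨z.1, hc.trans_le hzc, fun w hw => hmax hw, ?_⟩
  intro t ht0 ht1
  have hp : 0 < z.1 := ht0.trans ht1
  have key : ∀ r, 0 ≤ r → r ≤ c → (t, (1 - t / z.1) * r + t / z.1 * z.2) ∈ WW τ := by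
    intro r hr hr'
    have h1 : t / z.1 ≤ 1 := (div_le_one hp).2 ht1.le
    have := WW_conv τ (hbox 0 r le_rfl hc.le hr hr') hz (by linarith : 0 ≤ 1 - t / z.1)
      (by positivity : 0 ≤ t / z.1) (by ring)
    convert this using 1
    ext
    · simp; field_simp
    · simp
  refine ⟨_, _, ?_, key 0 le_rfl hc.le, key c hc.le le_rfl⟩
  have : 0 < 1 - t / z.1 := by rw [sub_pos, div_lt_one hp]; exact ht1
  nlinarith

lemma WW_prof {τ : ℝ × ℝ → ℝ} (hτ : IsNorm2 τ) {a : ℝ} (ha : a < om τ) :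
    ∃ (p1 p2 : ℝ) (w l : ℝ → ℝ) (c M : ℝ), p1 ≤ p2 ∧ Continuous w ∧ Continuous l ∧ 0 < c ∧
      (∀ t, c ≤ w t ∧ w t ≤ M) ∧
      (∀ t ∈ Icc p1 p2, ∀ r ∈ Icc (0:ℝ) 1, (t, l t + w t * r) ∈ WW τ) ∧ a < ∫ t in p1..p2, w t := by
  obtain ⟨p, hp, htop, hin⟩ := WW_top hτ
  have hne : ∀ t ∈ Ioo 0 p, {s | (t, s) ∈ WW τ}.Nonempty := by
    intro t ht
    obtain ⟨s, _, _, hs, _⟩ := hin t ht.1 ht.2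
    exact ⟨s, hs⟩
  have hlm : ∀ t ∈ Ioo 0 p, (t, lW τ t) ∈ WW τ := fun t ht => (slW_cpt hτ t).sInf_mem (hne t ht)
  have hum : ∀ t ∈ Ioo 0 p, (t, uW τ t) ∈ WW τ := fun t ht => (slW_cpt hτ t).sSup_mem (hne t ht)
  have hlc : ContinuousOn (lW τ) (Ioo 0 p) := by
    refine ConvexOn.continuousOn isOpen_Ioo ⟨convex_Ioo 0 p, ?_⟩
    intro x hx y hy a b ha hb hab
    exact csInf_le (slW_cpt hτ _).bddBelow (WW_conv τ (hlm x hx) (hlm y hy) ha hb hab)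
  have huc : ContinuousOn (uW τ) (Ioo 0 p) := by
    refine ConcaveOn.continuousOn isOpen_Ioo ⟨convex_Ioo 0 p, ?_⟩
    intro x hx y hy a b ha hb hab
    exact le_csSup (slW_cpt hτ _).bddAbove (WW_conv τ (hum x hx) (hum y hy) ha hb hab)
  have hlt : ∀ t ∈ Ioo 0 p, lW τ t < uW τ t := by
    intro t ht
    obtain ⟨s1, s2, h, h1, h2⟩ := hin t ht.1 ht.2
    exact (csInf_le (slW_cpt hτ t).bddBelow h1).trans_lt
      (h.trans_le (le_csSup (slW_cpt hτ t).bddAbove h2))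
  -- choose the interval
  let I : ℕ → Set ℝ := fun n => Icc (p * dn n / 2) (p * (1 - dn n / 2))
  have hI : ∀ n, I n ⊆ Ioo 0 p := by
    intro n t ht
    have h1 := dn_pos n
    exact ⟨lt_of_lt_of_le (by positivity) ht.1, ht.2.trans_lt (by nlinarith)⟩
  have hImono : Monotone I := by
    intro m n h
    have := dn_anti h
    exact Icc_subset_Icc (by nlinarith) (by nlinarith)
  have hIle : ∀ n, p * dn n / 2 ≤ p * (1 - dn n / 2) := by
    intro n; have := dn_lt n; nlinarith
  obtain ⟨n, hn⟩ : ∃ n, ENNReal.ofReal a < volume (WW τ ∩ I n ×ˢ univ) := by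
    have hm : Monotone fun n => WW τ ∩ I n ×ˢ (univ : Set ℝ) := fun m n h =>
      inter_subset_inter_right _ (prod_mono (hImono h) le_rfl)
    have h1 : volume (WW τ) ≤ volume (⋃ n, WW τ ∩ I n ×ˢ (univ : Set ℝ)) := by
      have hnull : ∀ x : ℝ, volume ({x} ×ˢ (univ : Set ℝ)) = 0 := by
        intro x; rw [Measure.volume_eq_prod, Measure.prod_prod]; simp
      have hsub : WW τ ⊆ (⋃ n, WW τ ∩ I n ×ˢ (univ : Set ℝ)) ∪
          (({0} ×ˢ (univ : Set ℝ)) ∪ ({p} ×ˢ (univ : Set ℝ))) := by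
        intro z hz
        rcases (hz.2.1).eq_or_lt with h0 | h0
        · exact Or.inr (Or.inl ⟨h0.symm, trivial⟩)
        rcases (htop z hz).eq_or_lt with h2 | h2
        · exact Or.inr (Or.inr ⟨h2, trivial⟩)
        left
        have hp1 : 0 < 1 - z.1 / p := by rw [sub_pos, div_lt_one hp]; exact h2
        obtain ⟨N, hN⟩ := dn_small (lt_min (by positivity : 0 < z.1 / p) hp1)
        have h3 := lt_min_iff.1 (hN N le_rfl)
        have h4 := dn_pos N
        refine mem_iUnion.2 ⟨N, hz, ⟨?_, ?_⟩, trivial⟩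
        · have := (lt_div_iff₀ hp).1 h3.1; nlinarith
        · have : z.1 / p < 1 - dn N := by linarith
          have := (div_lt_iff₀ hp).1 this; nlinarith
      refine (measure_mono hsub).trans ((measure_union_le _ _).trans ?_)
      rw [measure_union_null (hnull 0) (hnull p), add_zero]
    have h2 : ENNReal.ofReal a < volume (WW τ) := by
      rw [← ofReal_measureReal (WW_cpt hτ).measure_ne_top]
      exact (ENNReal.ofReal_lt_ofReal_iff (om_pos hτ)).2 ha
    have h3 := h2.trans_le h1
    rw [hm.measure_iUnion, lt_iSup_iff] at h3
    exact h3
  set p1 := p * dn n / 2 with hp1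
  set p2 := p * (1 - dn n / 2) with hp2
  have hp12 : p1 ≤ p2 := hIle n
  have hIn : Icc p1 p2 ⊆ Ioo 0 p := hI n
  let cl : ℝ → ℝ := fun t => max p1 (min p2 t)
  have hcl : ∀ t, cl t ∈ Icc p1 p2 := fun t => ⟨le_max_left _ _, max_le hp12 (min_le_left _ _)⟩
  have hclc : Continuous cl := by fun_prop
  have hcle : ∀ t ∈ Icc p1 p2, cl t = t := by
    intro t ht; show max p1 (min p2 t) = t; rw [min_eq_right ht.2, max_eq_right ht.1]
  let w0 : ℝ → ℝ := fun t => uW τ t - lW τ t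
  have hw0 : ContinuousOn w0 (Icc p1 p2) := (huc.sub hlc).mono hIn
  obtain ⟨tm, htm, hmin⟩ := isCompact_Icc.exists_isMinOn (nonempty_Icc.2 hp12) hw0
  obtain ⟨tM, htM, hmax⟩ := isCompact_Icc.exists_isMaxOn (nonempty_Icc.2 hp12) hw0
  have hwc : Continuous fun t => w0 (cl t) := hw0.comp_continuous hclc hcl
  refine ⟨p1, p2, fun t => w0 (cl t), fun t => lW τ (cl t), w0 tm, w0 tM, hp12, hwc,
    (hlc.mono hIn).comp_continuous hclc hcl, sub_pos.2 (hlt tm (hIn htm)), ?_, ?_, ?_⟩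
  · exact fun t => ⟨hmin (hcl t), hmax (hcl t)⟩
  · intro t ht r hr
    simp only [hcle t ht]
    have h1 := slW_eq hτ (hne t (hIn ht))
    have h2 : lW τ t + w0 t * r ∈ Icc (lW τ t) (uW τ t) := by
      have := hlt t (hIn ht)
      show lW τ t + (uW τ t - lW τ t) * r ∈ _
      constructor <;> nlinarith [hr.1, hr.2]
    rw [← h1] at h2
    exact h2
  · have hV : MeasurableSet (WW τ ∩ I n ×ˢ (univ : Set ℝ)) :=
      (WW_cpt hτ).measurableSet.inter (measurableSet_Icc.prod MeasurableSet.univ)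
    have e1 : volume (WW τ ∩ I n ×ˢ (univ : Set ℝ)) = ENNReal.ofReal (∫ t in p1..p2, w0 (cl t)) := by
      rw [Measure.volume_eq_prod, Measure.prod_apply hV]
      have e2 : ∀ x, volume (Prod.mk x ⁻¹' (WW τ ∩ I n ×ˢ (univ : Set ℝ))) =
          (Icc p1 p2).indicator (fun x => ENNReal.ofReal (w0 (cl x))) x := by
        intro x
        by_cases hx : x ∈ Icc p1 p2
        · rw [indicator_of_mem hx]
          have : Prod.mk x ⁻¹' (WW τ ∩ I n ×ˢ (univ : Set ℝ)) = Icc (lW τ x) (uW τ x) := by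
            rw [← slW_eq hτ (hne x (hIn hx))]
            ext s
            constructor
            · exact fun h => h.1
            · exact fun h => ⟨h, hx, trivial⟩
          rw [this, Real.volume_Icc, hcle x hx]
        · rw [indicator_of_notMem hx]
          have : Prod.mk x ⁻¹' (WW τ ∩ I n ×ˢ (univ : Set ℝ)) = ∅ := by
            ext s
            simp only [mem_preimage, mem_empty_iff_false, iff_false]
            exact fun h => hx h.2.1
          rw [this, measure_empty]
      simp_rw [e2]
      rw [lintegral_indicator measurableSet_Icc, intervalIntegral.integral_of_le hp12,
        ← integral_Icc_eq_integral_Ioc, ofReal_integral_eq_lintegral_ofReal]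
      · exact hwc.continuousOn.integrableOn_Icc
      · exact ae_of_all _ fun x => (sub_pos.2 (hlt _ (hIn (hcl x)))).le
    rw [e1] at hn
    exact (ENNReal.ofReal_lt_ofReal_iff'.1 hn).1

end

end

section
open MeasureTheory Set Filter ENNReal Topology

noncomputable section

lemma int_col {S : Set (ℝ × ℝ)} (hS : MeasurableSet S) {X Y : ℝ} (hX : 0 ≤ X) (hY : 0 ≤ Y)
    (hs : S ⊆ Ioo 0 X ×ˢ Ioo 0 Y) :
    Integrable (col S) ∧ ∫ x, col S x = volume.real S := by
  have hs' : S ⊆ univ ×ˢ Ioo 0 Y := hs.trans (prod_mono (subset_univ _) le_rfl)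
  constructor
  · have hb : Integrable ((Ioo 0 X).indicator (fun _ : ℝ => Y)) := by
      rw [integrable_indicator_iff measurableSet_Ioo]
      exact integrableOn_const (by rw [Real.volume_Ioo]; exact ofReal_ne_top)
    refine hb.mono' (col_meas hS).aestronglyMeasurable (ae_of_all _ fun x => ?_)
    rw [Real.norm_eq_abs, abs_of_nonneg (col_nonneg _ _)]
    by_cases hx : x ∈ Ioo 0 X
    · rw [indicator_of_mem hx]
      simpa using col_le_len hY hs' x
    · rw [indicator_of_notMem hx]
      have : {t | (x, t) ∈ S} = ∅ := by
        ext t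
        simp only [Set.mem_ofPred_eq, mem_empty_iff_false, iff_false]
        exact fun h => hx (hs h).1
      rw [col, this, measureReal_empty]
  · show ∫ x, (volume {t | (x, t) ∈ S}).toReal = (volume S).toReal
    have h1 := integral_toReal (μ := volume) (f := fun x => volume {t | (x, t) ∈ S})
      (measurable_measure_prodMk_left hS).aemeasurable (ae_of_all _ fun x => (slice_fin hs' x).lt_top)
    rw [h1, Measure.volume_eq_prod, Measure.prod_apply hS]
    rfl

lemma Q_aux {τ : ℝ × ℝ → ℝ} (hτ : IsNorm2 τ) {X Y δ θ : ℝ} (hδ : 0 < δ) (hX : 3 * δ < X)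
    (hY : 3 * δ < Y) (hθ : 0 < θ) {Z Z' : Set ℝ} (hZ : MeasurableSet Z) (hZ' : MeasurableSet Z')
    (hZp : volume (Z ∩ Ioo (X - δ) X) ≠ 0) (hZp' : volume (Z' ∩ Ioo (Y - δ) Y) ≠ 0)
    {A : Set (ℝ × ℝ)} (hA : MeasurableSet A) (hAU : A ⊆ Ioo 0 X ×ˢ Ioo 0 Y)
    (hAZ : ∀ z ∈ A, z.1 ∉ Z ∧ z.2 ∉ Z') {S : Set (ℝ × ℝ)} (hS : MeasurableSet S) (hSA : S ⊆ A)
    (hSb : S ⊆ Ioo (2 * δ) (X - δ) ×ˢ Ioo (2 * δ) (Y - δ)) (hSθ : ∀ z ∈ S, θ ≤ col S z.1)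
    (hV : 0 < volume.real S) {a : ℝ} (ha : a < om τ) :
    ENNReal.ofReal (2 * √(a * volume.real S)) ≤ surfU τ (Ioo 0 X ×ˢ Ioo 0 Y) A := by
  obtain ⟨p1, p2, w, l, c, M, hp, hw, hl, hc, hcM, hWW, haw⟩ := WW_prof hτ ha
  obtain ⟨η, h, e, C1, he, hhm, hhC, hηm, hηL, hη01, hη1, hη0, hhp⟩ := cutoff hδ hX hZ hZp
  obtain ⟨ξ, k, e', C2, he', hkm, hkC, hξm, hξL, hξ01, hξ1, hξ0, hkp⟩ := cutoff hδ hY hZ' hZp'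
  obtain ⟨H, hHd, hH0, hH1, hHm⟩ := inv_prim hw hc (fun t => (hcM t).1) p1 p2
  set V := volume.real S with hVd
  set ω := ∫ t in p1..p2, w t with hωd
  have hX0 : 0 < X := by linarith
  have hY0 : 0 < Y := by linarith
  have hSU : S ⊆ Ioo 0 X ×ˢ Ioo 0 Y := hSA.trans hAU
  have hSs : S ⊆ univ ×ˢ Ioo 0 Y := hSU.trans (prod_mono (subset_univ _) le_rfl)
  obtain ⟨hmi, hmV⟩ := int_col hS hX0.le hY0.le hSU
  have hm0 := col_nonneg S
  have hmY : ∀ x, col S x ≤ Y := fun x => by simpa using col_le_len hY0.le hSs x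
  have hω0 : 0 ≤ ω := intervalIntegral.integral_nonneg hp fun t _ => hc.le.trans (hcM t).1
  have hM : 0 < M := hc.trans_le ((hcM 0).1.trans (hcM 0).2)
  have hwp : ∀ t, 0 < w t := fun t => hc.trans_le (hcM t).1
  let κ := ω / V
  have hκ : 0 ≤ κ := div_nonneg hω0 hV.le
  -- the first component
  let F : ℝ → ℝ := fun x => ∫ t in Iic x, col S t
  have hF0 : ∀ x, 0 ≤ F x := fun x => integral_nonneg fun t => hm0 t
  have hFV : ∀ x, F x ≤ V := fun x => by
    rw [hVd, ← hmV]; exact setIntegral_le_integral hmi (ae_of_all _ hm0)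
  have hFL : LD F (col S) := by
    refine LD.of_int (C := Y + V) (col_meas hS) (fun x => ?_) (fun x => ?_) (fun x x' => ?_)
    · rw [abs_of_nonneg (hm0 x)]; linarith [hmY x]
    · rw [abs_of_nonneg (hF0 x)]; linarith [hFV x]
    · exact intervalIntegral.integral_Iic_sub_Iic hmi.integrableOn hmi.integrableOn
  let T1 : ℝ → ℝ := fun x => H (κ * F x)
  have hT1 : ∀ x, T1 x ∈ Icc p1 p2 := by
    intro x
    constructor
    · rw [← hH0]; exact hHm (mul_nonneg hκ (hF0 x))
    · rw [← hH1]
      apply hHm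
      calc κ * F x ≤ κ * V := by gcongr; exact hFV x
        _ = ω := div_mul_cancel₀ _ hV.ne'
  have hHlip : ∀ s t, |H s - H t| ≤ 1 / c * |s - t| := by
    intro s t
    refine Convex.norm_image_sub_le_of_norm_hasDerivWithin_le (s := univ) (f' := fun t => 1 / w (H t))
      (fun x _ => (hHd x).hasDerivWithinAt) (fun x _ => ?_) convex_univ trivial trivial
    rw [Real.norm_eq_abs, abs_of_pos (one_div_pos.2 (hwp _))]
    exact one_div_le_one_div_of_le hc (hcM _).1
  have hT1L : LD T1 (fun x => κ * col S x / w (T1 x)) := by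
    obtain ⟨⟨C, hC, hCb⟩, hd⟩ := hFL
    have hC0 : 0 ≤ C := (abs_nonneg _).trans (hCb 0)
    refine ⟨⟨1 / c * (κ * C) + (|p1| + |p2|), ?_, ?_⟩, ?_⟩
    · intro x y
      refine (hHlip _ _).trans ?_
      rw [← mul_sub, abs_mul, abs_of_nonneg hκ]
      have h1 : 1 / c * (κ * |F x - F y|) ≤ 1 / c * (κ * (C * |x - y|)) := by gcongr; exact hC x y
      have h2 : 0 ≤ (|p1| + |p2|) * |x - y| := by positivity
      linarith
    · intro x
      have h1 := hT1 x
      have h2 : |T1 x| ≤ |p1| + |p2| := by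
        rw [abs_le]
        constructor
        · linarith [h1.1, neg_abs_le p1, abs_nonneg p2]
        · linarith [h1.2, le_abs_self p2, abs_nonneg p1]
      have : 0 ≤ 1 / c * (κ * C) := by positivity
      linarith
    · filter_upwards [hd] with x hx
      have h1 := (hHd (κ * F x)).comp x (hx.const_mul κ)
      have e : κ * col S x / w (T1 x) = 1 / w (H (κ * F x)) * (κ * col S x) := by
        show κ * col S x / w (T1 x) = 1 / w (T1 x) * _
        ring
      rw [e]
      exact h1
  have hT1c : Continuous T1 := by
    have h1 : Continuous H := continuous_iff_continuousAt.2 fun t => (hHd t).continuousAt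
    have h2 : Continuous F := by
      obtain ⟨⟨C, hC, hCb⟩, hd⟩ := hFL
      have hC0 : 0 ≤ C := (abs_nonneg _).trans (hCb 0)
      refine (LipschitzWith.of_dist_le_mul (K := C.toNNReal) fun x y => ?_).continuous
      rw [Real.coe_toNNReal _ hC0]; exact hC x y
    exact h1.comp (continuous_const.mul h2)
  -- the second component
  let fr : ℝ × ℝ → ℝ := fun z => cum S z.1 z.2 / col S z.1
  have hfr : ∀ z, fr z ∈ Icc (0:ℝ) 1 := by
    intro z
    refine ⟨div_nonneg (cum_nonneg _ _ _) (hm0 _), ?_⟩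
    rcases (hm0 z.1).eq_or_lt with h0 | h0
    · show _ / _ ≤ _; rw [← h0, _root_.div_zero]; exact zero_le_one
    · exact (div_le_one h0).2 (cum_le hSs _ _)
  let T2 : ℝ × ℝ → ℝ := fun z => l (T1 z.1) + w (T1 z.1) * fr z
  have hT : ∀ z, (T1 z.1, T2 z) ∈ WW τ := fun z => hWW _ (hT1 _) _ (hfr z)
  obtain ⟨B, hB⟩ := (WW_cpt hτ).isBounded.exists_norm_le
  have hTB1 : ∀ x, |T1 x| ≤ B := fun x => (norm_fst_le _).trans (hB _ (hT (x, 0)))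
  have hTB2 : ∀ z, |T2 z| ≤ B := fun z => (norm_snd_le _).trans (hB _ (hT z))
  have hB0 : 0 ≤ B := (abs_nonneg _).trans (hTB1 0)
  have hT10 : ∀ x, 0 ≤ T1 x := fun x => (hT (x, 0)).2.1
  have hT20 : ∀ z, 0 ≤ T2 z := fun z => (hT z).2.2
  let q : ℝ × ℝ → ℝ := fun z => w (T1 z.1) * (ind S z / col S z.1)
  have hind : ∀ z, 0 ≤ ind S z / col S z.1 ∧ ind S z / col S z.1 ≤ 1 / θ := by
    intro z
    refine ⟨div_nonneg (ind_nonneg _ _) (hm0 _), ?_⟩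
    by_cases hz : z ∈ S
    · rw [ind_of_mem hz]; exact one_div_le_one_div_of_le hθ (hSθ z hz)
    · rw [ind_of_notMem hz, zero_div]; positivity
  have hq0 : ∀ z, 0 ≤ q z := fun z => mul_nonneg (hwp _).le (hind z).1
  have hqM : ∀ z, q z ≤ M * (1 / θ) := fun z =>
    mul_le_mul (hcM _).2 (hind z).2 (hind z).1 hM.le
  have hcolm : Measurable fun z : ℝ × ℝ => col S z.1 := (col_meas hS).comp measurable_fst
  have hwT : Measurable fun z : ℝ × ℝ => w (T1 z.1) := ((hw.comp hT1c).comp continuous_fst).measurable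
  have hlT : Measurable fun z : ℝ × ℝ => l (T1 z.1) := ((hl.comp hT1c).comp continuous_fst).measurable
  have hT1m : Measurable fun z : ℝ × ℝ => T1 z.1 := (hT1c.comp continuous_fst).measurable
  have hfrm : Measurable fr := (cum_meas hS).div hcolm
  have hT2m : Measurable T2 := hlT.add (hwT.mul hfrm)
  have hqm : Measurable q := hwT.mul ((ind_meas hS).div hcolm)
  have hT2L : ∀ x, LD (fun y => T2 (x, y)) (fun y => q (x, y)) := by
    intro x
    refine LD.of_int (C := M * (1 / θ) + B) (hqm.comp measurable_prodMk_left) (fun y => ?_) (fun y => ?_)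
      (fun y y' => ?_)
    · rw [abs_of_nonneg (hq0 _)]; linarith [hqM (x, y)]
    · have : 0 ≤ M * (1 / θ) := by positivity
      linarith [hTB2 (x, y)]
    · show l (T1 x) + w (T1 x) * (cum S x y' / col S x) - (l (T1 x) + w (T1 x) * (cum S x y / col S x))
        = ∫ t in y..y', w (T1 x) * (ind S (x, t) / col S x)
      rw [intervalIntegral.integral_const_mul, intervalIntegral.integral_div, ← cum_sub hS hSs]
      ring
  -- the field
  let f1 : ℝ × ℝ → ℝ := fun z => (η z.1 * T1 z.1) * ξ z.2
  let g1 : ℝ × ℝ → ℝ := fun z => (h z.1 * T1 z.1 + η z.1 * (κ * col S z.1 / w (T1 z.1))) * ξ z.2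
  let f2 : ℝ × ℝ → ℝ := fun z => η z.1 * (ξ z.2 * T2 z)
  let g2 : ℝ × ℝ → ℝ := fun z => η z.1 * (k z.2 * T2 z + ξ z.2 * q z)
  have hη' : Measurable fun z : ℝ × ℝ => η z.1 := hηm.comp measurable_fst
  have hξ' : Measurable fun z : ℝ × ℝ => ξ z.2 := hξm.comp measurable_snd
  have hf1 : Measurable f1 := (hη'.mul hT1m).mul hξ'
  have hg1 : Measurable g1 := (((hhm.comp measurable_fst).mul hT1m).add
    (hη'.mul ((measurable_const.mul hcolm).div hwT))).mul hξ'
  have hf2 : Measurable f2 := hη'.mul (hξ'.mul hT2m)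
  have hg2 : Measurable g2 := hη'.mul (((hkm.comp measurable_snd).mul hT2m).add (hξ'.mul hqm))
  have hC10 : 0 ≤ C1 := (abs_nonneg _).trans (hhC 0)
  have hC20 : 0 ≤ C2 := (abs_nonneg _).trans (hkC 0)
  have hr : ∀ x, 0 ≤ κ * col S x / w (T1 x) ∧ κ * col S x / w (T1 x) ≤ κ * Y / c := by
    intro x
    refine ⟨div_nonneg (mul_nonneg hκ (hm0 _)) (hwp _).le, ?_⟩
    have := hm0 x
    gcongr
    · exact hmY x
    · exact (hcM _).1
  have hη1' : ∀ x, |η x| ≤ 1 := fun x => by rw [abs_of_nonneg (hη01 x).1]; exact (hη01 x).2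
  have hξ1' : ∀ x, |ξ x| ≤ 1 := fun x => by rw [abs_of_nonneg (hξ01 x).1]; exact (hξ01 x).2
  have hKY : 0 ≤ κ * Y / c := by positivity
  have hMθ : 0 ≤ M * (1 / θ) := by positivity
  have hg1C : ∀ z, |g1 z| ≤ C1 * B + κ * Y / c := by
    intro z
    show |(h z.1 * T1 z.1 + η z.1 * (κ * col S z.1 / w (T1 z.1))) * ξ z.2| ≤ _
    rw [abs_mul]
    calc _ ≤ (|h z.1 * T1 z.1| + |η z.1 * (κ * col S z.1 / w (T1 z.1))|) * 1 := by
          gcongr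
          · exact abs_add_le _ _
          · exact hξ1' _
      _ ≤ (C1 * B + 1 * (κ * Y / c)) * 1 := by
          rw [abs_mul, abs_mul, abs_of_nonneg (hr z.1).1]
          have h1 := mul_le_mul (hhC z.1) (hTB1 z.1) (abs_nonneg _) hC10
          have h2 := mul_le_mul (hη1' z.1) (hr z.1).2 (hr z.1).1 zero_le_one
          linarith
      _ = _ := by ring
  have hg2C : ∀ z, |g2 z| ≤ C2 * B + M * (1 / θ) := by
    intro z
    show |η z.1 * (k z.2 * T2 z + ξ z.2 * q z)| ≤ _
    rw [abs_mul]
    calc _ ≤ 1 * (|k z.2 * T2 z| + |ξ z.2 * q z|) := by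
          gcongr
          · exact hη1' _
          · exact abs_add_le _ _
      _ ≤ 1 * (C2 * B + 1 * (M * (1 / θ))) := by
          rw [abs_mul, abs_mul, abs_of_nonneg (hq0 z)]
          have h1 := mul_le_mul (hkC z.2) (hTB2 z) (abs_nonneg _) hC20
          have h2 := mul_le_mul (hξ1' z.2) (hqM z) (hq0 z) zero_le_one
          linarith
      _ = _ := by ring
  have hAfin : volume A ≠ ⊤ := by
    refine ne_top_of_le_ne_top (b := volume (Icc 0 X ×ˢ Icc 0 Y)) ?_
      (measure_mono (hAU.trans (prod_mono Ioo_subset_Icc_self Ioo_subset_Icc_self)))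
    exact (isCompact_Icc.prod isCompact_Icc).measure_ne_top
  have hmain := moll (f1 := f1) (g1 := g1) (f2 := f2) (g2 := g2) hτ (U := Ioo 0 X ×ˢ Ioo 0 Y)
    (A := A) (K0 := Icc e (X - e) ×ˢ Icc e' (Y - e'))
    hAfin (isOpen_Ioo.prod isOpen_Ioo)
    (isCompact_Icc.prod isCompact_Icc) (prod_mono (Icc_subset_Ioo (by linarith) (by linarith))
      (Icc_subset_Ioo (by linarith) (by linarith)))
    hf1 hf2 hg1 hg2 (C := (C1 * B + κ * Y / c) + (C2 * B + M * (1 / θ)))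
    (fun z => (hg1C z).trans (by have := mul_nonneg hC20 hB0; linarith))
    (fun z => (hg2C z).trans (by have := mul_nonneg hC10 hB0; linarith)) ?_ ?_ ?_ ?_
  · refine le_trans (ENNReal.ofReal_le_ofReal ?_) hmain
    have hpt : ∀ z ∈ A, 2 * √κ * ind S z ≤ g1 z + g2 z := by
      intro z hz
      have hz1 := hhp z.1 (hAZ z hz).1
      have hz2 := hkp z.2 (hAZ z hz).2
      have e1 : 0 ≤ h z.1 * T1 z.1 := mul_nonneg hz1 (hT10 _)
      have e2 : 0 ≤ k z.2 * T2 z := mul_nonneg hz2 (hT20 _)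
      by_cases hzS : z ∈ S
      · have b1 : η z.1 = 1 := hη1 _ (Ioo_subset_Icc_self (hSb hzS).1)
        have b2 : ξ z.2 = 1 := hξ1 _ (Ioo_subset_Icc_self (hSb hzS).2)
        show _ ≤ (h z.1 * T1 z.1 + η z.1 * (κ * col S z.1 / w (T1 z.1))) * ξ z.2 +
          η z.1 * (k z.2 * T2 z + ξ z.2 * (w (T1 z.1) * (ind S z / col S z.1)))
        rw [b1, b2, ind_of_mem hzS]
        have hcp : 0 < col S z.1 := hθ.trans_le (hSθ z hzS)
        have hwz := hwp (T1 z.1)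
        have key : 2 * √κ ≤ κ * col S z.1 / w (T1 z.1) + w (T1 z.1) * (1 / col S z.1) := by
          have hs := Real.sq_sqrt hκ
          set s := √κ
          rw [← hs]
          have : 0 ≤ (s * col S z.1 - w (T1 z.1)) ^ 2 / (w (T1 z.1) * col S z.1) := by positivity
          have e : (s * col S z.1 - w (T1 z.1)) ^ 2 / (w (T1 z.1) * col S z.1) =
              s ^ 2 * col S z.1 / w (T1 z.1) + w (T1 z.1) * (1 / col S z.1) - 2 * s := by
            field_simp; ring
          linarith
        linarith
      · rw [ind_of_notMem hzS, mul_zero]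
        have := (hη01 z.1).1
        have := (hξ01 z.2).1
        have := hq0 z
        have := (hr z.1).1
        show 0 ≤ (h z.1 * T1 z.1 + η z.1 * (κ * col S z.1 / w (T1 z.1))) * ξ z.2 +
          η z.1 * (k z.2 * T2 z + ξ z.2 * q z)
        positivity
    have hI1 : IntegrableOn (fun z => 2 * √κ * ind S z) A := by
      refine Measure.integrableOn_of_bounded (M := 2 * √κ) hAfin
        ((ind_meas hS).const_mul _).aestronglyMeasurable (ae_of_all _ fun z => ?_)
      rw [Real.norm_eq_abs, abs_of_nonneg (mul_nonneg (by positivity) (ind_nonneg _ _))]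
      have := ind_le S z
      have h0 : 0 ≤ 2 * √κ := by positivity
      nlinarith
    have hI2 : IntegrableOn (fun z => g1 z + g2 z) A := by
      refine Measure.integrableOn_of_bounded (M := (C1 * B + κ * Y / c) + (C2 * B + M * (1 / θ))) hAfin
        (hg1.add hg2).aestronglyMeasurable (ae_of_all _ fun z => ?_)
      exact (abs_add_le _ _).trans (add_le_add (hg1C z) (hg2C z))
    refine le_trans ?_ (setIntegral_mono_on hI1 hI2 hA hpt)
    rw [integral_const_mul]
    have e1 : ∫ z in A, ind S z = V := by
      show ∫ z in A, S.indicator 1 z = V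
      rw [setIntegral_indicator hS, inter_eq_self_of_subset_right hSA]
      simp [hVd]
    rw [e1, mul_assoc]
    have : √(a * V) ≤ √κ * V := by
      rw [← Real.sqrt_sq hV.le, ← Real.sqrt_mul hκ]
      apply Real.sqrt_le_sqrt
      rw [Real.sqrt_sq hV.le]
      have : κ * V = ω := div_mul_cancel₀ _ hV.ne'
      nlinarith
    linarith
  · intro z
    have := KK_smul hτ (hT z).1 (mul_nonneg (hη01 z.1).1 (hξ01 z.2).1)
      (mul_le_one₀ (hη01 z.1).2 (hξ01 z.2).1 (hξ01 z.2).2)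
    convert this using 1
    ext
    · show (η z.1 * T1 z.1) * ξ z.2 = η z.1 * ξ z.2 * T1 z.1; ring
    · show η z.1 * (ξ z.2 * T2 z) = η z.1 * ξ z.2 * T2 z; ring
  · intro z hz
    have : η z.1 = 0 ∨ ξ z.2 = 0 := by
      by_contra hcon
      push Not at hcon
      apply hz
      constructor
      · by_contra h; exact hcon.1 (hη0 _ h)
      · by_contra h; exact hcon.2 (hξ0 _ h)
    show (η z.1 * T1 z.1) * ξ z.2 = 0 ∧ η z.1 * (ξ z.2 * T2 z) = 0
    rcases this with h | h <;> rw [h] <;> constructor <;> ring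
  · intro y x x'
    show (η x' * T1 x') * ξ y - (η x * T1 x) * ξ y = ∫ t in x..x', (_ + _) * ξ y
    rw [intervalIntegral.integral_mul_const, ← (hηL.mul hT1L).ftc x x']
    ring
  · intro x y y'
    show η x * (ξ y' * T2 (x, y')) - η x * (ξ y * T2 (x, y)) = ∫ t in y..y', η x * (_ + _)
    rw [intervalIntegral.integral_const_mul, ← (hξL.mul (hT2L x)).ftc y y']
    ring

end

end

section
open MeasureTheory Set Filter ENNReal Topology

noncomputable section

lemma slice_null {A : Set (ℝ × ℝ)} (hA : MeasurableSet A) :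
    volume {z | z ∈ A ∧ volume {t | (z.1, t) ∈ A} = 0} = 0 := by
  have hm : MeasurableSet {z : ℝ × ℝ | z ∈ A ∧ volume {t | (z.1, t) ∈ A} = 0} := by
    refine hA.inter ?_
    exact measurable_fst (measurable_measure_prodMk_left hA (measurableSet_singleton 0))
  rw [Measure.volume_eq_prod, Measure.measure_prod_null hm]
  refine ae_of_all _ fun x => ?_
  show volume {t | (x, t) ∈ A ∧ volume {t | (x, t) ∈ A} = 0} = 0
  by_cases h : volume {t | (x, t) ∈ A} = 0
  · exact measure_mono_null (fun t ht => ht.1) h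
  · have : {t | (x, t) ∈ A ∧ volume {t | (x, t) ∈ A} = 0} = ∅ := by
      ext t; simp only [Set.mem_ofPred_eq, mem_empty_iff_false, iff_false]; exact fun hh => h hh.2
    rw [this, measure_empty]

/-- Corner isoperimetric inequality. -/
lemma Q_prop {τ : ℝ × ℝ → ℝ} (hτ : IsNorm2 τ) {X Y : ℝ} (hX : 0 < X)
    (hY : 0 < Y) {Z Z' : Set ℝ} (hZ : MeasurableSet Z) (hZ' : MeasurableSet Z')
    (hZp : ∀ δ, 0 < δ → volume (Z ∩ Ioo (X - δ) X) ≠ 0)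
    (hZp' : ∀ δ, 0 < δ → volume (Z' ∩ Ioo (Y - δ) Y) ≠ 0)
    {A : Set (ℝ × ℝ)} (hA : MeasurableSet A) (hAU : A ⊆ Ioo 0 X ×ˢ Ioo 0 Y)
    (hAZ : ∀ z ∈ A, z.1 ∉ Z ∧ z.2 ∉ Z') :
    ENNReal.ofReal (2 * √(om τ * volume.real A)) ≤ surfU τ (Ioo 0 X ×ˢ Ioo 0 Y) A := by
  rcases (measureReal_nonneg (μ := volume) (s := A)).eq_or_lt with h0 | hV
  · rw [← h0]; simp
  have hω := om_pos hτ
  have hAfin : volume A ≠ ⊤ := by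
    refine ne_top_of_le_ne_top (b := volume (Icc 0 X ×ˢ Icc 0 Y)) ?_
      (measure_mono (hAU.trans (prod_mono Ioo_subset_Icc_self Ioo_subset_Icc_self)))
    exact (isCompact_Icc.prod isCompact_Icc).measure_ne_top
  let box : ℕ → Set (ℝ × ℝ) := fun n => Ioo (2 * dn n) (X - dn n) ×ˢ Ioo (2 * dn n) (Y - dn n)
  have hbox : Monotone box := by
    intro m n h
    have := dn_anti h
    exact prod_mono (Ioo_subset_Ioo (by linarith) (by linarith))
      (Ioo_subset_Ioo (by linarith) (by linarith))
  let B : ℕ → Set (ℝ × ℝ) := fun n => A ∩ box n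
  have hBm : ∀ n, MeasurableSet (B n) := fun n => hA.inter (measurableSet_Ioo.prod measurableSet_Ioo)
  have hBmono : Monotone B := fun m n h => inter_subset_inter_right _ (hbox h)
  have hBs : ∀ n, B n ⊆ univ ×ˢ Ioo 0 Y := fun n =>
    inter_subset_left.trans (hAU.trans (prod_mono (subset_univ _) le_rfl))
  let S : ℕ → Set (ℝ × ℝ) := fun n => B n ∩ {z | dn n ≤ col (B n) z.1}
  have hSm : ∀ n, MeasurableSet (S n) := fun n => (hBm n).inter
    (measurableSet_le measurable_const ((col_meas (hBm n)).comp measurable_fst))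
  have hSmono : Monotone S := by
    intro m n h z hz
    exact ⟨hBmono h hz.1, (dn_anti h).trans (le_trans hz.2 (col_mono (hBmono h) (hBs n) _))⟩
  have hSθ : ∀ n, ∀ z ∈ S n, dn n ≤ col (S n) z.1 := by
    intro n z hz
    have h1 : dn n ≤ col (B n) z.1 := hz.2
    have : {t | (z.1, t) ∈ S n} = {t | (z.1, t) ∈ B n} := by
      ext t
      exact ⟨fun h => h.1, fun h => ⟨h, h1⟩⟩
    rw [col, this]; exact h1
  have hinB : ∀ z ∈ A, ∃ N, z ∈ B N := by
    intro z hz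
    have h1 := hAU hz
    have h2 : 0 < z.1 := h1.1.1
    have h3 : z.1 < X := h1.1.2
    have h4 : 0 < z.2 := h1.2.1
    have h5 : z.2 < Y := h1.2.2
    obtain ⟨N, hN⟩ := dn_small (lt_min (lt_min (by linarith : 0 < z.1 / 2) (by linarith : 0 < X - z.1))
      (lt_min (by linarith : 0 < z.2 / 2) (by linarith : 0 < Y - z.2)))
    have h6 := hN N le_rfl
    rw [lt_min_iff, lt_min_iff, lt_min_iff] at h6
    exact ⟨N, hz, ⟨by linarith [h6.1.1], by linarith [h6.1.2]⟩, ⟨by linarith [h6.2.1], by linarith [h6.2.2]⟩⟩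
  have hvol : volume A ≤ volume (⋃ n, S n) := by
    have hsub : A ⊆ (⋃ n, S n) ∪ {z | z ∈ A ∧ volume {t | (z.1, t) ∈ A} = 0} := by
      intro z hz
      by_cases h : volume {t | (z.1, t) ∈ A} = 0
      · exact Or.inr ⟨hz, h⟩
      left
      obtain ⟨n0, hn0⟩ : ∃ n, volume {t | (z.1, t) ∈ B n} ≠ 0 := by
        by_contra hc
        push Not at hc
        apply h
        refine measure_mono_null ?_ (measure_iUnion_null hc)
        intro t ht
        obtain ⟨N, hN⟩ := hinB _ ht
        exact mem_iUnion.2 ⟨N, hN⟩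
      have hpos : 0 < col (B n0) z.1 := ENNReal.toReal_pos hn0 (slice_fin (hBs n0) _)
      obtain ⟨N, hN⟩ := dn_small hpos
      obtain ⟨N', hN'⟩ := hinB z hz
      let k := max (max N N') n0
      refine mem_iUnion.2 ⟨k, hBmono ((le_max_right _ _).trans (le_max_left _ _)) hN', ?_⟩
      exact (hN k ((le_max_left _ _).trans (le_max_left _ _))).le.trans
        (col_mono (hBmono (le_max_right _ _)) (hBs k) _)
    refine (measure_mono hsub).trans ((measure_union_le _ _).trans ?_)
    rw [slice_null hA, add_zero]
  obtain ⟨N0, hN0⟩ := dn_small (lt_min (by linarith : 0 < X / 3) (by linarith : 0 < Y / 3))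
  have key : ∀ s ∈ Ioo (0:ℝ) 1, ENNReal.ofReal (2 * (s * √(om τ * volume.real A))) ≤
      surfU τ (Ioo 0 X ×ˢ Ioo 0 Y) A := by
    intro s hs
    have h1 : ENNReal.ofReal (s * volume.real A) < volume (⋃ n, S n) := by
      refine lt_of_lt_of_le ?_ hvol
      rw [← ofReal_measureReal hAfin]
      exact (ENNReal.ofReal_lt_ofReal_iff hV).2 (by nlinarith [hs.2])
    rw [hSmono.measure_iUnion, lt_iSup_iff] at h1
    obtain ⟨n1, hn1⟩ := h1
    let n := max n1 N0
    have hn : ENNReal.ofReal (s * volume.real A) < volume (S n) :=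
      hn1.trans_le (measure_mono (hSmono (le_max_left _ _)))
    have hSA : S n ⊆ A := inter_subset_left.trans inter_subset_left
    have hSf : volume (S n) ≠ ⊤ := ne_top_of_le_ne_top hAfin (measure_mono hSA)
    rw [← ofReal_measureReal hSf, ENNReal.ofReal_lt_ofReal_iff'] at hn
    have hd := lt_min_iff.1 (hN0 n (le_max_right _ _))
    have := Q_aux hτ (dn_pos n) (by linarith) (by linarith) (dn_pos n) hZ hZ' (hZp _ (dn_pos n))
      (hZp' _ (dn_pos n)) hA hAU hAZ (hSm n) hSA (inter_subset_left.trans inter_subset_right) (hSθ n)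
      hn.2 (a := s * om τ) (by nlinarith [hs.2])
    refine le_trans (ENNReal.ofReal_le_ofReal ?_) this
    have e : s * √(om τ * volume.real A) = √(s ^ 2 * (om τ * volume.real A)) := by
      rw [Real.sqrt_mul (x := s ^ 2) (by positivity), Real.sqrt_sq hs.1.le]
    rw [e]
    gcongr 2 * ?_
    apply Real.sqrt_le_sqrt
    have h5 : s * om τ * (s * volume.real A) ≤ s * om τ * volume.real (S n) :=
      mul_le_mul_of_nonneg_left hn.1.le (mul_nonneg hs.1.le hω.le)
    nlinarith
  have hT : Tendsto (fun s : ℝ => ENNReal.ofReal (2 * (s * √(om τ * volume.real A)))) (𝓝[<] 1)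
      (𝓝 (ENNReal.ofReal (2 * (1 * √(om τ * volume.real A))))) := by
    refine Tendsto.mono_left ?_ nhdsWithin_le_nhds
    exact (ENNReal.continuous_ofReal.comp
      (by fun_prop : Continuous fun s : ℝ => 2 * (s * √(om τ * volume.real A)))).tendsto 1
  rw [one_mul] at hT
  refine le_of_tendsto hT ?_
  filter_upwards [Ioo_mem_nhdsLT (zero_lt_one (α := ℝ))] with s hs using key s hs

end

end

section
open MeasureTheory Set Filter ENNReal Topology

noncomputable section

/-- Every set of positive measure has a point with two-sided positive density. -/
lemma two_sided {Z : Set ℝ} (hZ : MeasurableSet Z) (hp : volume Z ≠ 0) :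
    ∃ x0 ∈ Z, ∀ δ : ℝ, 0 < δ → volume (Z ∩ Ioo (x0 - δ) x0) ≠ 0 ∧
      volume (Z ∩ Ioo x0 (x0 + δ)) ≠ 0 := by
  set g : ℝ → ℝ := Z.indicator (fun _ => (1:ℝ)) with hg
  have hloc : LocallyIntegrable g volume :=
    (locallyIntegrable_const (1:ℝ)).indicator hZ
  have hae := _root_.LocallyIntegrable.ae_hasDerivAt_integral hloc
  have hx : ∃ x ∈ Z, HasDerivAt (fun y => ∫ t in (0:ℝ)..y, g t) (g x) x := by
    by_contra hc
    push Not at hc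
    apply hp
    refine measure_mono_null ?_ (ae_iff.1 hae)
    intro x hx hx'
    exact hc x hx (hx' 0)
  obtain ⟨x, hxZ, hd⟩ := hx
  have hgx : g x = 1 := by simp [hg, hxZ]
  rw [hgx] at hd
  have hitg : ∀ p q : ℝ, IntervalIntegrable g volume p q := fun p q =>
    (hloc.integrableOn_isCompact isCompact_uIcc).intervalIntegrable
  have hzero : ∀ p q : ℝ, p ≤ q → volume (Z ∩ Ioo p q) = 0 →
      (∫ t in (0:ℝ)..q, g t) = ∫ t in (0:ℝ)..p, g t := by
    intro p q hpq h0
    rw [← sub_eq_zero, intervalIntegral.integral_interval_sub_left (hitg _ _) (hitg _ _),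
      intervalIntegral.integral_of_le hpq, ← integral_Ioc_eq_integral_Ioo.symm, hg,
      integral_indicator hZ, Measure.restrict_restrict hZ]
    rw [Measure.restrict_eq_zero.2 h0]
    simp
  refine ⟨x, hxZ, fun δ hδ => ⟨fun h0 => ?_, fun h0 => ?_⟩⟩
  · have h1 := hd.hasDerivWithinAt (s := Iio x)
    have h2 : HasDerivWithinAt (fun y => ∫ t in (0:ℝ)..y, g t) 0 (Iio x) x := by
      refine (hasDerivWithinAt_const x (Iio x) (∫ t in (0:ℝ)..x, g t)).congr_of_eventuallyEq ?_ rfl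
      filter_upwards [Ioo_mem_nhdsLT (by linarith : x - δ < x)] with y hy
      refine (hzero y x hy.2.le (measure_mono_null ?_ h0)).symm
      exact inter_subset_inter_right _ (Ioo_subset_Ioo_left hy.1.le)
    have := (uniqueDiffWithinAt_Iio x).eq_deriv _ h1 h2
    norm_num at this
  · have h1 := hd.hasDerivWithinAt (s := Ioi x)
    have h2 : HasDerivWithinAt (fun y => ∫ t in (0:ℝ)..y, g t) 0 (Ioi x) x := by
      refine (hasDerivWithinAt_const x (Ioi x) (∫ t in (0:ℝ)..x, g t)).congr_of_eventuallyEq ?_ rfl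
      filter_upwards [Ioo_mem_nhdsGT (by linarith : x < x + δ)] with y hy
      refine hzero x y hy.1.le (measure_mono_null ?_ h0)
      exact inter_subset_inter_right _ (Ioo_subset_Ioo_right hy.2.le)
    have := (uniqueDiffWithinAt_Ioi x).eq_deriv _ h1 h2
    norm_num at this

/-- An open quadrant of the square. -/
def Qdr (a b x0 y0 : ℝ) : Set (ℝ × ℝ) :=
  {z | (0 < 1 + a * z.1 ∧ a * z.1 < a * x0) ∧ (0 < 1 + b * z.2 ∧ b * z.2 < b * y0)}

lemma Qdr_open (a b x0 y0 : ℝ) : IsOpen (Qdr a b x0 y0) := by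
  refine IsOpen.inter (IsOpen.inter ?_ ?_) (IsOpen.inter ?_ ?_)
  · exact isOpen_lt continuous_const (by fun_prop : Continuous fun z : ℝ × ℝ => 1 + a * z.1)
  · exact isOpen_lt (by fun_prop : Continuous fun z : ℝ × ℝ => a * z.1) continuous_const
  · exact isOpen_lt continuous_const (by fun_prop : Continuous fun z : ℝ × ℝ => 1 + b * z.2)
  · exact isOpen_lt (by fun_prop : Continuous fun z : ℝ × ℝ => b * z.2) continuous_const

lemma flip_mp {a : ℝ} (ha : a = 1 ∨ a = -1) (S : Set ℝ) :
    volume ((fun u : ℝ => a * u + -a) ⁻¹' S) = volume S := by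
  rcases ha with rfl | rfl
  · simp only [one_mul]
    exact measure_preimage_add_right volume (-1) S
  · have : (fun u : ℝ => -1 * u + -(-1)) ⁻¹' S = (fun u => -u) ⁻¹' ((fun u => u + 1) ⁻¹' S) := by
      ext u; simp
    rw [this]
    have h := Measure.measure_preimage_neg (volume : Measure ℝ) ((fun u => u + 1) ⁻¹' S)
    refine h.trans ?_
    exact measure_preimage_add_right volume 1 S

lemma quad_one {τ : ℝ × ℝ → ℝ} (hτ : IsNorm2 τ) {σ : (ℝ × ℝ) ≃L[ℝ] (ℝ × ℝ)} (h : SymL σ)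
    {a b : ℝ} (ha : a = 1 ∨ a = -1) (hb : b = 1 ∨ b = -1) (hσ : ∀ z, σ z = (a * z.1, b * z.2))
    {x0 y0 : ℝ} (hx0 : x0 ∈ Ioo (-1:ℝ) 1) (hy0 : y0 ∈ Ioo (-1:ℝ) 1)
    {Z Z' : Set ℝ} (hZ : MeasurableSet Z) (hZ' : MeasurableSet Z')
    (hZp : ∀ δ : ℝ, 0 < δ → volume (Z ∩ {x | a * x0 - δ < a * x ∧ a * x < a * x0}) ≠ 0)
    (hZp' : ∀ δ : ℝ, 0 < δ → volume (Z' ∩ {x | b * y0 - δ < b * x ∧ b * x < b * y0}) ≠ 0)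
    {B : Set (ℝ × ℝ)} (hB : MeasurableSet B) (hBZ : ∀ z ∈ B, z.1 ∉ Z ∧ z.2 ∉ Z') :
    ENNReal.ofReal (2 * √(om (τ ∘ σ) * volume.real (B ∩ Qdr a b x0 y0))) ≤
      surfU τ (Qdr a b x0 y0) B := by
  set φ := affH σ (-a, -b) with hφ
  have hφa : ∀ z, φ z = (a * z.1 + -a, b * z.2 + -b) := fun z => by
    rw [hφ, affH_apply, hσ]; rfl
  have hX : 0 < 1 + a * x0 := by
    rcases ha with rfl | rfl
    · linarith [hx0.1]
    · linarith [hx0.2]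
  have hY : 0 < 1 + b * y0 := by
    rcases hb with rfl | rfl
    · linarith [hy0.1]
    · linarith [hy0.2]
  have haa : a * a = 1 := by rcases ha with rfl | rfl <;> norm_num
  have hbb : b * b = 1 := by rcases hb with rfl | rfl <;> norm_num
  set U := Ioo 0 (1 + a * x0) ×ˢ Ioo 0 (1 + b * y0) with hU
  have ea : ∀ u : ℝ, a * (a * u + -a) = u - 1 := fun u => by
    linear_combination (u - 1) * haa
  have eb : ∀ u : ℝ, b * (b * u + -b) = u - 1 := fun u => by
    linear_combination (u - 1) * hbb
  have hQ : Qdr a b x0 y0 = φ '' U := by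
    ext z
    obtain ⟨w, rfl⟩ := φ.surjective z
    rw [φ.injective.mem_set_image, hφa]
    simp only [Qdr, Set.mem_ofPred_eq, ea, eb, hU, Set.mem_prod, Set.mem_Ioo]
    constructor
    · rintro ⟨⟨h1, h2⟩, h3, h4⟩
      exact ⟨⟨by linarith, by linarith⟩, by linarith, by linarith⟩
    · rintro ⟨⟨h1, h2⟩, h3, h4⟩
      exact ⟨⟨by linarith, by linarith⟩, by linarith, by linarith⟩
  set A := U ∩ φ ⁻¹' B with hA
  have hAm : MeasurableSet A :=
    (measurableSet_Ioo.prod measurableSet_Ioo).inter (φ.continuous.measurable hB)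
  have hAB : φ '' A = B ∩ Qdr a b x0 y0 := by
    rw [hA, image_inter_preimage, hQ, inter_comm]
  have hvol : volume A = volume (B ∩ Qdr a b x0 y0) := by
    have := (affH_mp h (-a, -b)).measure_preimage_emb φ.measurableEmbedding (φ '' A)
    rw [← hAB, ← this, ← hφ, preimage_image_eq _ φ.injective]
  have hvr : volume.real A = volume.real (B ∩ Qdr a b x0 y0) := by
    simp only [measureReal_def, hvol]
  have key := Q_prop (hτ.comp σ) hX hY (Z := (fun u : ℝ => a * u + -a) ⁻¹' Z)
    (Z' := (fun u : ℝ => b * u + -b) ⁻¹' Z')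
    ((by fun_prop : Measurable fun u : ℝ => a * u + -a) hZ)
    ((by fun_prop : Measurable fun u : ℝ => b * u + -b) hZ')
    (by
      intro δ hδ
      have := hZp δ hδ
      rw [← flip_mp ha] at this
      convert this using 2
      ext u
      simp only [mem_inter_iff, mem_preimage, Set.mem_Ioo, Set.mem_ofPred_eq, ea]
      refine and_congr_right fun _ => ⟨fun h => ⟨by linarith, by linarith⟩,
        fun h => ⟨by linarith, by linarith⟩⟩)
    (by
      intro δ hδ
      have := hZp' δ hδ
      rw [← flip_mp hb] at this
      convert this using 2
      ext u
      simp only [mem_inter_iff, mem_preimage, Set.mem_Ioo, Set.mem_ofPred_eq, eb]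
      refine and_congr_right fun _ => ⟨fun h => ⟨by linarith, by linarith⟩,
        fun h => ⟨by linarith, by linarith⟩⟩)
    hAm inter_subset_left
    (by
      intro z hz
      have := hBZ _ hz.2
      rw [hφa] at this
      exact this)
  rw [hvr] at key
  refine key.trans ((surfU_map hτ h (-a, -b) U A).trans ?_)
  rw [← hφ, ← hQ, hAB]
  apply le_of_eq
  refine surfU_inter ?_ (Qdr_open _ _ _ _).measurableSet
  rw [inter_assoc, inter_self]

lemma sqrt_add_le' {x y : ℝ} (hx : 0 ≤ x) (hy : 0 ≤ y) : √(x + y) ≤ √x + √y := by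
  rw [Real.sqrt_le_left (by positivity)]
  nlinarith [Real.sq_sqrt hx, Real.sq_sqrt hy, Real.sqrt_nonneg x, Real.sqrt_nonneg y,
    mul_nonneg (Real.sqrt_nonneg x) (Real.sqrt_nonneg y)]

lemma sqrt_sum4 {w p q r s : ℝ} (hw : 0 ≤ w) (hp : 0 ≤ p) (hq : 0 ≤ q) (hr : 0 ≤ r) (hs : 0 ≤ s) :
    √(w * (p + q + r + s)) ≤ √(w * p) + √(w * q) + √(w * r) + √(w * s) := by
  have e1 := sqrt_add_le' (by positivity : 0 ≤ w * (p + q + r)) (by positivity : 0 ≤ w * s)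
  have e2 := sqrt_add_le' (by positivity : 0 ≤ w * (p + q)) (by positivity : 0 ≤ w * r)
  have e3 := sqrt_add_le' (by positivity : 0 ≤ w * p) (by positivity : 0 ≤ w * q)
  rw [← mul_add] at e1 e2 e3
  linarith

lemma om_neg {τ : ℝ × ℝ → ℝ} (hτ : IsNorm2 τ) (z : ℝ × ℝ) : τ (-z) = τ z := hτ.neg z

lemma sgn_sym : SymL (rfL.trans (swL.trans (rfL.trans swL))) :=
  rfL_sym.trans (swL_sym.trans (rfL_sym.trans swL_sym))

lemma four_quad {τ : ℝ × ℝ → ℝ} (hτ : IsNorm2 τ) {Z Z' : Set ℝ} (hZ : MeasurableSet Z)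
    (hZ' : MeasurableSet Z') (hZI : Z ⊆ Ioo (-1) 1) (hZI' : Z' ⊆ Ioo (-1) 1)
    (hZp : volume Z ≠ 0) (hZp' : volume Z' ≠ 0)
    {B : Set (ℝ × ℝ)} (hB : MeasurableSet B) (hBI : B ⊆ Isq)
    (hBZ : ∀ z ∈ B, z.1 ∉ Z ∧ z.2 ∉ Z') :
    ENNReal.ofReal (2 * √(min (om τ) (om (τ ∘ rfL)) * volume.real B)) ≤ surfU τ Oq B := by
  obtain ⟨x0, hx0, hxd⟩ := two_sided hZ hZp
  obtain ⟨y0, hy0, hyd⟩ := two_sided hZ' hZp'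
  set w := min (om τ) (om (τ ∘ rfL)) with hw
  have hw0 : 0 ≤ w := le_min (om_pos hτ).le (om_pos (hτ.comp rfL)).le
  have dp : ∀ {Z : Set ℝ} {x : ℝ}, (∀ δ : ℝ, 0 < δ → volume (Z ∩ Ioo (x - δ) x) ≠ 0 ∧
      volume (Z ∩ Ioo x (x + δ)) ≠ 0) → ∀ δ : ℝ, 0 < δ →
      volume (Z ∩ {y | 1 * x - δ < 1 * y ∧ 1 * y < 1 * x}) ≠ 0 := by
    intro Z x h δ hδ
    simp only [one_mul]
    exact (h δ hδ).1
  have dm : ∀ {Z : Set ℝ} {x : ℝ}, (∀ δ : ℝ, 0 < δ → volume (Z ∩ Ioo (x - δ) x) ≠ 0 ∧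
      volume (Z ∩ Ioo x (x + δ)) ≠ 0) → ∀ δ : ℝ, 0 < δ →
      volume (Z ∩ {y | -1 * x - δ < -1 * y ∧ -1 * y < -1 * x}) ≠ 0 := by
    intro Z x h δ hδ
    convert (h δ hδ).2 using 3
    ext y
    simp only [Set.mem_ofPred_eq, Set.mem_Ioo]
    constructor
    · rintro ⟨h1, h2⟩; exact ⟨by linarith, by linarith⟩
    · rintro ⟨h1, h2⟩; exact ⟨by linarith, by linarith⟩
  have k1 := quad_one hτ (σ := swL.trans swL) (swL_sym.trans swL_sym) (a := 1) (b := 1) (Or.inl rfl)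
    (Or.inl rfl) (fun z => by simp [swL_apply]) (hZI hx0) (hZI' hy0) hZ hZ' (dp hxd) (dp hyd) hB hBZ
  have k2 := quad_one hτ (σ := rfL) rfL_sym (a := -1) (b := 1) (Or.inr rfl)
    (Or.inl rfl) (fun z => by simp [rfL_apply]) (hZI hx0) (hZI' hy0) hZ hZ' (dm hxd) (dp hyd) hB hBZ
  have k3 := quad_one hτ (σ := swL.trans (rfL.trans swL)) (swL_sym.trans (rfL_sym.trans swL_sym))
    (a := 1) (b := -1) (Or.inl rfl) (Or.inr rfl) (fun z => by simp [rfL_apply, swL_apply])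
    (hZI hx0) (hZI' hy0) hZ hZ' (dp hxd) (dm hyd) hB hBZ
  have k4 := quad_one hτ (σ := rfL.trans (swL.trans (rfL.trans swL))) sgn_sym (a := -1) (b := -1)
    (Or.inr rfl) (Or.inr rfl) (fun z => by simp [rfL_apply, swL_apply])
    (hZI hx0) (hZI' hy0) hZ hZ' (dm hxd) (dm hyd) hB hBZ
  have t1 : τ ∘ (swL.trans swL) = τ := by ext z; simp [swL_apply]
  have t3 : τ ∘ (swL.trans (rfL.trans swL)) = τ ∘ rfL := by
    ext z
    have := hτ.neg (rfL z)
    simp only [Function.comp_apply, ContinuousLinearEquiv.trans_apply, rfL_apply, swL_apply] at this ⊢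
    rw [← this]; simp
  have t4 : τ ∘ (rfL.trans (swL.trans (rfL.trans swL))) = τ := by
    ext z
    have := hτ.neg z
    simp only [Function.comp_apply, ContinuousLinearEquiv.trans_apply, rfL_apply, swL_apply]
    rw [← this]; rfl
  rw [t1] at k1
  rw [t3] at k3
  rw [t4] at k4
  have hx := hZI hx0
  have hy := hZI' hy0
  have q1 : Qdr 1 1 x0 y0 ⊆ Oq := by
    intro z hz
    obtain ⟨⟨h1, h2⟩, h3, h4⟩ := hz
    exact ⟨⟨by linarith, by linarith [hx.2]⟩, by linarith, by linarith [hy.2]⟩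
  have q2 : Qdr (-1) 1 x0 y0 ⊆ Oq := by
    intro z hz
    obtain ⟨⟨h1, h2⟩, h3, h4⟩ := hz
    exact ⟨⟨by linarith [hx.1], by linarith [hx.2]⟩, by linarith, by linarith [hy.2]⟩
  have q3 : Qdr 1 (-1) x0 y0 ⊆ Oq := by
    intro z hz
    obtain ⟨⟨h1, h2⟩, h3, h4⟩ := hz
    exact ⟨⟨by linarith [hx.1], by linarith [hx.2]⟩, by linarith [hy.1], by linarith [hy.2]⟩
  have q4 : Qdr (-1) (-1) x0 y0 ⊆ Oq := by
    intro z hz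
    obtain ⟨⟨h1, h2⟩, h3, h4⟩ := hz
    exact ⟨⟨by linarith [hx.1], by linarith [hx.2]⟩, by linarith [hy.1], by linarith [hy.2]⟩
  have d12 : Disjoint (Qdr 1 1 x0 y0) (Qdr (-1) 1 x0 y0) := by
    rw [Set.disjoint_left]; rintro z ⟨⟨_, h⟩, _⟩ ⟨⟨_, h'⟩, _⟩; linarith
  have d34 : Disjoint (Qdr 1 (-1) x0 y0) (Qdr (-1) (-1) x0 y0) := by
    rw [Set.disjoint_left]; rintro z ⟨⟨_, h⟩, _⟩ ⟨⟨_, h'⟩, _⟩; linarith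
  have d : Disjoint (Qdr 1 1 x0 y0 ∪ Qdr (-1) 1 x0 y0) (Qdr 1 (-1) x0 y0 ∪ Qdr (-1) (-1) x0 y0) := by
    rw [Set.disjoint_left]
    rintro z (⟨_, _, h⟩ | ⟨_, _, h⟩) (⟨_, _, h'⟩ | ⟨_, _, h'⟩) <;> linarith
  have s12 := surfU_add hτ (E := B) (subset_union_left (s := Qdr 1 1 x0 y0) (t := Qdr (-1) 1 x0 y0))
    subset_union_right d12
  have s34 := surfU_add hτ (E := B) (subset_union_left (s := Qdr 1 (-1) x0 y0)
    (t := Qdr (-1) (-1) x0 y0)) subset_union_right d34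
  have s := surfU_add hτ (E := B) (union_subset q1 q2) (union_subset q3 q4) d
  have fin : ∀ a b, volume (B ∩ Qdr a b x0 y0) ≠ ⊤ := fun a b => Isq_fin (inter_subset_left.trans hBI)
  set N : Set (ℝ × ℝ) := (({-1, 1, x0} : Set ℝ) ×ˢ univ) ∪ (univ ×ˢ ({-1, 1, y0} : Set ℝ)) with hN
  have hN0 : volume N = 0 := by
    have f1 : volume ({-1, 1, x0} : Set ℝ) = 0 := Set.Finite.measure_zero (by simp) _
    have f2 : volume ({-1, 1, y0} : Set ℝ) = 0 := Set.Finite.measure_zero (by simp) _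
    refine measure_union_null ?_ ?_
    · rw [Measure.volume_eq_prod, Measure.prod_prod, f1, zero_mul]
    · rw [Measure.volume_eq_prod, Measure.prod_prod, f2, mul_zero]
  have hcov : B ⊆ ((B ∩ Qdr 1 1 x0 y0 ∪ B ∩ Qdr (-1) 1 x0 y0) ∪ B ∩ Qdr 1 (-1) x0 y0) ∪
      B ∩ Qdr (-1) (-1) x0 y0 ∪ N := by
    intro z hz
    by_cases hzN : z ∈ N
    · exact Or.inr hzN
    left
    have hI := mem_Isq.1 (hBI hz)
    simp only [hN, mem_union, Set.mem_prod, mem_univ, and_true, true_and, mem_insert_iff,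
      mem_singleton_iff, not_or] at hzN
    obtain ⟨⟨n1, n2, n3⟩, n4, n5, n6⟩ := hzN
    have m1 : -1 < z.1 := lt_of_le_of_ne hI.1.1 (Ne.symm n1)
    have m2 : z.1 < 1 := lt_of_le_of_ne hI.1.2 n2
    have m3 : -1 < z.2 := lt_of_le_of_ne hI.2.1 (Ne.symm n4)
    have m4 : z.2 < 1 := lt_of_le_of_ne hI.2.2 n5
    rcases lt_or_gt_of_ne n3 with c1 | c1 <;> rcases lt_or_gt_of_ne n6 with c2 | c2
    · refine Or.inl (Or.inl (Or.inl ⟨hz, ⟨?_, ?_⟩, ?_, ?_⟩)) <;> linarith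
    · refine Or.inl (Or.inr ⟨hz, ⟨?_, ?_⟩, ?_, ?_⟩) <;> linarith
    · refine Or.inl (Or.inl (Or.inr ⟨hz, ⟨?_, ?_⟩, ?_, ?_⟩)) <;> linarith
    · refine Or.inr ⟨hz, ⟨?_, ?_⟩, ?_, ?_⟩ <;> linarith
  have hv : volume.real B ≤ volume.real (B ∩ Qdr 1 1 x0 y0) + volume.real (B ∩ Qdr (-1) 1 x0 y0) +
      volume.real (B ∩ Qdr 1 (-1) x0 y0) + volume.real (B ∩ Qdr (-1) (-1) x0 y0) := by
    have hle : volume B ≤ volume (B ∩ Qdr 1 1 x0 y0) + volume (B ∩ Qdr (-1) 1 x0 y0) +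
      volume (B ∩ Qdr 1 (-1) x0 y0) + volume (B ∩ Qdr (-1) (-1) x0 y0) := by
      refine (measure_mono hcov).trans ((measure_union_le _ _).trans ?_)
      rw [hN0, add_zero]
      refine (measure_union_le _ _).trans (add_le_add_left ?_ _)
      refine (measure_union_le _ _).trans (add_le_add_left ?_ _)
      exact measure_union_le _ _
    rw [← ofReal_measureReal (fin 1 1), ← ofReal_measureReal (fin (-1) 1),
      ← ofReal_measureReal (fin 1 (-1)), ← ofReal_measureReal (fin (-1) (-1)),
      ← ENNReal.ofReal_add (by positivity) (by positivity),
      ← ENNReal.ofReal_add (by positivity) (by positivity),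
      ← ENNReal.ofReal_add (by positivity) (by positivity)] at hle
    exact ENNReal.toReal_le_of_le_ofReal (by positivity) hle
  have hmono : ∀ o v : ℝ, w ≤ o → 0 ≤ v → √(w * v) ≤ √(o * v) := fun o v h hv =>
    Real.sqrt_le_sqrt (mul_le_mul_of_nonneg_right h hv)
  have wl : w ≤ om τ := min_le_left _ _
  have wr : w ≤ om (τ ∘ rfL) := min_le_right _ _
  refine le_trans ?_ s
  refine le_trans ?_ (add_le_add s12 s34)
  refine le_trans ?_ (add_le_add (add_le_add k1 k2) (add_le_add k3 k4))
  rw [← ENNReal.ofReal_add (by positivity) (by positivity),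
    ← ENNReal.ofReal_add (by positivity) (by positivity),
    ← ENNReal.ofReal_add (by positivity) (by positivity)]
  apply ENNReal.ofReal_le_ofReal
  have g0 : √(w * volume.real B) ≤ _ := Real.sqrt_le_sqrt (mul_le_mul_of_nonneg_left hv hw0)
  have g1 := sqrt_sum4 hw0 (measureReal_nonneg (μ := volume) (s := B ∩ Qdr 1 1 x0 y0))
    (measureReal_nonneg (μ := volume) (s := B ∩ Qdr (-1) 1 x0 y0))
    (measureReal_nonneg (μ := volume) (s := B ∩ Qdr 1 (-1) x0 y0))
    (measureReal_nonneg (μ := volume) (s := B ∩ Qdr (-1) (-1) x0 y0))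
  have g2 := hmono _ (volume.real (B ∩ Qdr 1 1 x0 y0)) wl measureReal_nonneg
  have g3 := hmono _ (volume.real (B ∩ Qdr (-1) 1 x0 y0)) wr measureReal_nonneg
  have g4 := hmono _ (volume.real (B ∩ Qdr 1 (-1) x0 y0)) wr measureReal_nonneg
  have g5 := hmono _ (volume.real (B ∩ Qdr (-1) (-1) x0 y0)) wl measureReal_nonneg
  linarith

end

end

section
open MeasureTheory Set Filter ENNReal Topology

noncomputable section

/-- abscissae of null columns -/
def Xn (A : Set (ℝ × ℝ)) : Set ℝ := {x | x ∈ Ioo (-1 : ℝ) 1 ∧ volume {t | (x, t) ∈ A ∩ Oq} = 0}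

/-- ordinates of null rows -/
def Yn (A : Set (ℝ × ℝ)) : Set ℝ := {y | y ∈ Ioo (-1 : ℝ) 1 ∧ volume {t | (t, y) ∈ A ∩ Oq} = 0}

lemma Oq_meas : MeasurableSet Oq := measurableSet_Ioo.prod measurableSet_Ioo

lemma Xn_meas {A : Set (ℝ × ℝ)} (hA : MeasurableSet A) : MeasurableSet (Xn A) :=
  measurableSet_Ioo.inter
    ((measurable_measure_prodMk_left (ν := volume) (hA.inter Oq_meas)) (measurableSet_singleton 0))

lemma Yn_meas {A : Set (ℝ × ℝ)} (hA : MeasurableSet A) : MeasurableSet (Yn A) :=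
  measurableSet_Ioo.inter
    ((measurable_measure_prodMk_right (μ := volume) (hA.inter Oq_meas)) (measurableSet_singleton 0))

lemma null_X {A : Set (ℝ × ℝ)} (hA : MeasurableSet A) :
    volume {z | z ∈ A ∩ Oq ∧ z.1 ∈ Xn A} = 0 := by
  refine measure_mono_null ?_ (slice_null (hA.inter Oq_meas))
  intro z hz
  exact ⟨hz.1, hz.2.2⟩

lemma null_Y {A : Set (ℝ × ℝ)} (hA : MeasurableSet A) :
    volume {z | z ∈ A ∩ Oq ∧ z.2 ∈ Yn A} = 0 := by
  have hm : MeasurableSet (Prod.swap ⁻¹' (A ∩ Oq) : Set (ℝ × ℝ)) :=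
    measurable_swap (hA.inter Oq_meas)
  have h := slice_null hm
  have hp : MeasurePreserving (Prod.swap : ℝ × ℝ → ℝ × ℝ) volume volume :=
    Measure.measurePreserving_swap
  rw [← hp.measure_preimage_emb (MeasurableEquiv.prodComm (α := ℝ) (β := ℝ)).measurableEmbedding]
  refine measure_mono_null ?_ h
  intro z hz
  have hz' : z.swap ∈ A ∩ Oq ∧ z.swap.2 ∈ Yn A := hz
  exact ⟨hz'.1, hz'.2.2⟩

lemma mixed {A : Set (ℝ × ℝ)} (hA : MeasurableSet A) (h1 : volume (Xn A) ≠ 0)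
    (h2 : volume (Yn Aᶜ) ≠ 0) : False := by
  have h0 : volume (Xn A ×ˢ Yn Aᶜ) = 0 := by
    refine measure_mono_null ?_ (measure_union_null (null_X hA) (null_Y hA.compl))
    intro z hz
    have hzO : z ∈ Oq := ⟨hz.1.1, hz.2.1⟩
    by_cases hzA : z ∈ A
    · exact Or.inl ⟨⟨hzA, hzO⟩, hz.1⟩
    · exact Or.inr ⟨⟨hzA, hzO⟩, hz.2⟩
  rw [Measure.volume_eq_prod, Measure.prod_prod] at h0
  rcases mul_eq_zero.1 h0 with h | h
  · exact h1 h
  · exact h2 h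

lemma Isq_Oq : volume (Isq \ Oq) = 0 := by
  have f1 : volume ({-1, 1} : Set ℝ) = 0 := Set.Finite.measure_zero (by simp) _
  have hN0 : volume ((({-1, 1} : Set ℝ) ×ˢ univ) ∪ (univ ×ˢ ({-1, 1} : Set ℝ)) : Set (ℝ × ℝ)) = 0 := by
    refine measure_union_null ?_ ?_
    · rw [Measure.volume_eq_prod, Measure.prod_prod, f1, zero_mul]
    · rw [Measure.volume_eq_prod, Measure.prod_prod, f1, mul_zero]
  refine measure_mono_null ?_ hN0
  rintro z ⟨hz, hzO⟩
  have hI := mem_Isq.1 hz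
  by_contra hzN
  simp only [mem_union, Set.mem_prod, mem_univ, and_true, true_and, mem_insert_iff,
      mem_singleton_iff, not_or] at hzN
  obtain ⟨⟨n1, n2⟩, n4, n5⟩ := hzN
  exact hzO ⟨⟨lt_of_le_of_ne hI.1.1 (Ne.symm n1), lt_of_le_of_ne hI.1.2 n2⟩,
    lt_of_le_of_ne hI.2.1 (Ne.symm n4), lt_of_le_of_ne hI.2.2 n5⟩

lemma four_null {τ : ℝ × ℝ → ℝ} (hτ : IsNorm2 τ) {B : Set (ℝ × ℝ)} (hB : MeasurableSet B)
    (hBI : B ⊆ Isq) (hX : volume (Xn B) ≠ 0) (hY : volume (Yn B) ≠ 0) :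
    ENNReal.ofReal (2 * √(min (om τ) (om (τ ∘ rfL)) * volume.real B)) ≤ surfU τ Oq B := by
  set C : Set (ℝ × ℝ) := B \ ((Xn B ×ˢ univ) ∪ (univ ×ˢ Yn B)) with hC
  have hCm : MeasurableSet C := hB.diff
    (((Xn_meas hB).prod MeasurableSet.univ).union (MeasurableSet.univ.prod (Yn_meas hB)))
  have hCB : C ⊆ B := diff_subset
  have hnull : volume (B \ C) = 0 := by
    refine measure_mono_null ?_ (measure_union_null Isq_Oq
      (measure_union_null (null_X hB) (null_Y hB)))
    rintro z ⟨hz, hzC⟩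
    by_cases hO : z ∈ Oq
    · right
      have : z ∈ (Xn B ×ˢ univ) ∪ (univ ×ˢ Yn B) := by
        by_contra hn
        exact hzC ⟨hz, hn⟩
      rcases this with h | h
      · exact Or.inl ⟨⟨hz, hO⟩, h.1⟩
      · exact Or.inr ⟨⟨hz, hO⟩, h.2⟩
    · exact Or.inl ⟨hBI hz, hO⟩
  have hae : C =ᵐ[volume] B := by
    refine ae_eq_set.2 ⟨?_, hnull⟩
    rw [diff_eq_empty.2 hCB]; simp
  have := four_quad hτ (Xn_meas hB) (Yn_meas hB) (fun x hx => hx.1) (fun x hx => hx.1) hX hY hCm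
    (hCB.trans hBI) (fun z hz => ⟨fun h => hz.2 (Or.inl ⟨h, mem_univ _⟩),
      fun h => hz.2 (Or.inr ⟨mem_univ _, h⟩)⟩)
  rw [surfU_congr hae, measureReal_congr hae] at this
  exact this

lemma tr_ex {τ : ℝ × ℝ → ℝ} (hτ : IsNorm2 τ) {σ : (ℝ × ℝ) ≃L[ℝ] (ℝ × ℝ)} (h : SymL σ)
    (hI : affH σ 0 '' Isq = Isq) {v e : ℝ≥0∞}
    (hR : ∃ R, JD R ∧ volume R = v ∧ surfU (τ ∘ σ) Isq R ≤ e) :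
    ∃ R, JD R ∧ volume R = v ∧ surfU τ Isq R ≤ e := by
  obtain ⟨R, hJ, hv, hE⟩ := hR
  refine ⟨affH σ 0 '' R, hJ.map σ 0 hI, ?_, ?_⟩
  · have := (affH_mp h 0).measure_preimage_emb (affH σ 0).measurableEmbedding (affH σ 0 '' R)
    rw [← this, preimage_image_eq _ (affH σ 0).injective, hv]
  · have := surfU_map' hτ h 0 Isq R
    rw [hI] at this
    exact this.trans hE

lemma P1_min {τ : ℝ × ℝ → ℝ} (hτ : IsNorm2 τ) {b : ℝ} (hb : b ∈ Ioo (0 : ℝ) 4) : ∃ R, JD R ∧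
    volume R = ENNReal.ofReal b ∧
      surfU τ Isq R ≤ ENNReal.ofReal (2 * √(min (om τ) (om (τ ∘ rfL)) * b)) := by
  rcases min_choice (om τ) (om (τ ∘ rfL)) with h | h <;> rw [h]
  · exact P1_prop hτ b hb
  · exact tr_ex hτ rfL_sym rfL_Isq (P1_prop (hτ.comp rfL) b hb)

lemma P2_min {τ : ℝ × ℝ → ℝ} (hτ : IsNorm2 τ) {b : ℝ} (hb : b ∈ Ioo (0 : ℝ) 4) : ∃ R, JD R ∧
    volume R = ENNReal.ofReal (4 - b) ∧
      surfU τ Isq R ≤ ENNReal.ofReal (2 * √(min (om τ) (om (τ ∘ rfL)) * b)) := by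
  rcases min_choice (om τ) (om (τ ∘ rfL)) with h | h <;> rw [h]
  · exact P2_prop hτ b hb
  · exact tr_ex hτ rfL_sym rfL_Isq (P2_prop (hτ.comp rfL) b hb)

lemma conduct_lt {τ : ℝ × ℝ → ℝ} {R : Set (ℝ × ℝ)} {a v E E' : ℝ} (ha : 0 < a) (hv : 0 < v)
    (hR : volume R = ENNReal.ofReal v) (hlow : ENNReal.ofReal E ≤ surfU τ Oq R)
    (hE : 0 < E) (hlt : E' / a < E / v)
    (hex : ∃ R', JD R' ∧ volume R' = ENNReal.ofReal a ∧ surfU τ Isq R' ≤ ENNReal.ofReal E') :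
    ∃ R' : Set (ℝ × ℝ), MemR R' ∧ volume R' = ENNReal.ofReal a ∧
      (∃ lam' : Set (ℝ × ℝ), IsRectJordanCurve lam' ∧ lam' ⊆ Isq ∧ R' = hullSet lam') ∧
      conduct τ R' < conduct τ R := by
  obtain ⟨R', hJ, hv', hE'⟩ := hex
  refine ⟨R', hJ.memR, hv', hJ.lam, ?_⟩
  have n1 : volume R' ≠ 0 := by rw [hv']; simpa using ha
  have n2 : volume R ≠ 0 := by rw [hR]; simpa using hv
  rw [conduct, conduct, if_neg n1, if_neg n2, hv', hR]
  calc surfE τ R' / ENNReal.ofReal a ≤ ENNReal.ofReal E' / ENNReal.ofReal a :=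
        ENNReal.div_le_div_right ((surfE_le τ R').trans hE') _
    _ = ENNReal.ofReal (E' / a) := (ENNReal.ofReal_div_of_pos ha).symm
    _ < ENNReal.ofReal (E / v) := (ENNReal.ofReal_lt_ofReal_iff (by positivity)).2 hlt
    _ = ENNReal.ofReal E / ENNReal.ofReal v := ENNReal.ofReal_div_of_pos hv
    _ ≤ surfE τ R / ENNReal.ofReal v := ENNReal.div_le_div_right (hlow.trans (le_surfE τ R)) _

lemma ae_X {A : Set (ℝ × ℝ)} (h1 : volume (Xn A) = 0) (h2 : volume (Xn Aᶜ) = 0) :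
    ∀ᵐ x, x ∈ Ioo (-1 : ℝ) 1 → volume {t | (x, t) ∈ A ∩ Oq} ≠ 0 ∧
      volume {t | (x, t) ∈ Aᶜ ∩ Oq} ≠ 0 := by
  have h1' : ∀ᵐ x, x ∉ Xn A := measure_eq_zero_iff_ae_notMem.1 h1
  have h2' : ∀ᵐ x, x ∉ Xn Aᶜ := measure_eq_zero_iff_ae_notMem.1 h2
  filter_upwards [h1', h2'] with x hx1 hx2 hx
  exact ⟨fun h => hx1 ⟨hx, h⟩, fun h => hx2 ⟨hx, h⟩⟩

lemma Xn_swap (A : Set (ℝ × ℝ)) : Xn (swL ⁻¹' A) = Yn A := by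
  ext x
  have : {t | (x, t) ∈ swL ⁻¹' A ∩ Oq} = {t | (t, x) ∈ A ∩ Oq} := by
    ext t
    show ((t, x) ∈ A ∧ (x, t) ∈ Oq) ↔ ((t, x) ∈ A ∧ (t, x) ∈ Oq)
    simp only [Oq, Set.mem_prod]
    tauto
  simp only [Xn, Yn, Set.mem_ofPred_eq, this]

lemma swL_pre (A : Set (ℝ × ℝ)) : affH swL 0 '' (swL ⁻¹' A) = A := by
  have : (swL ⁻¹' A) = affH swL 0 ⁻¹' A := by
    ext z; simp [affH_apply]
  rw [this, image_preimage_eq _ (affH swL 0).surjective]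

theorem main_aux (τ : ℝ × ℝ → ℝ) (hτ : IsNorm2 τ)
    (a : ℝ) (ha : a ∈ Set.Icc (1 : ℝ) 3)
    (R : Set (ℝ × ℝ)) (hR : MemR R) (hvol : volume R < ENNReal.ofReal a) :
    ∃ R' : Set (ℝ × ℝ), MemR R' ∧ volume R' = ENNReal.ofReal a ∧
      (∃ lam' : Set (ℝ × ℝ), IsRectJordanCurve lam' ∧ lam' ⊆ Isq ∧ R' = hullSet lam') ∧
      conduct τ R' < conduct τ R := by
  have ha0 : 0 < a := by linarith [ha.1]
  have ha4 : a ∈ Ioo (0:ℝ) 4 := ⟨ha0, by linarith [ha.2]⟩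
  have hm : MeasurableSet R := hR.1.measurableSet
  have hI : R ⊆ Isq := hR.2.1
  obtain ⟨μ, hμ, hK, hHP⟩ := HP_prop hτ
  by_cases hv0 : volume R = 0
  · obtain ⟨R', hJ, hv', hE'⟩ := hHP a ha4
    refine ⟨R', hJ.memR, hv', hJ.lam, ?_⟩
    have n1 : volume R' ≠ 0 := by rw [hv']; simpa using ha0
    rw [conduct, conduct, if_neg n1, if_pos hv0]
    refine ENNReal.div_lt_top ?_ n1
    exact ne_top_of_le_ne_top ofReal_ne_top ((surfE_le τ R').trans hE')
  set v := volume.real R with hv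
  have hRv : volume R = ENNReal.ofReal v := vol_of_real hI
  have hvpos : 0 < v := ENNReal.toReal_pos hv0 (Isq_fin hI)
  have hva : v < a := by
    rw [hRv] at hvol
    exact (ENNReal.ofReal_lt_ofReal_iff ha0).1 hvol
  set w := min (om τ) (om (τ ∘ rfL)) with hw
  have hw0 : 0 < w := lt_min (om_pos hτ) (om_pos (hτ.comp rfL))
  by_cases hX : volume (Xn R) = 0 ∧ volume (Xn Rᶜ) = 0
  · refine conduct_lt ha0 hvpos hRv (L1 hτ hμ hK hm (ae_X hX.1 hX.2)) (by positivity) ?_ (hHP a ha4)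
    exact div_lt_div_of_pos_left (by positivity) hvpos hva
  by_cases hY : volume (Yn R) = 0 ∧ volume (Yn Rᶜ) = 0
  · obtain ⟨μ', hμ', hK', hHP'⟩ := HP_prop (hτ.comp swL)
    have hm' : MeasurableSet (swL ⁻¹' R) := swL.continuous.measurable hm
    have l := L1 (hτ.comp swL) hμ' hK' hm' (ae_X (by rw [Xn_swap]; exact hY.1)
      (by rw [← preimage_compl, Xn_swap]; exact hY.2))
    have l2 := surfU_map hτ swL_sym 0 Oq (swL ⁻¹' R)
    rw [swL_pre, swL_Oq] at l2
    refine conduct_lt ha0 hvpos hRv (l.trans l2) (by positivity) ?_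
      (tr_ex hτ swL_sym swL_Isq (hHP' a ha4))
    exact div_lt_div_of_pos_left (by positivity) hvpos hva
  by_cases hXn : volume (Xn R) = 0
  · have hXf : volume (Xn Rᶜ) ≠ 0 := fun h => hX ⟨hXn, h⟩
    by_cases hYf : volume (Yn Rᶜ) = 0
    · exfalso
      have hYn : volume (Yn R) ≠ 0 := fun h => hY ⟨h, hYf⟩
      exact mixed hm.compl hXf (by rwa [compl_compl])
    set B := Isq \ R with hB
    have hBO : B ∩ Oq = Rᶜ ∩ Oq := by
      ext z
      exact ⟨fun h => ⟨h.1.2, h.2⟩, fun h => ⟨⟨Osq_sub (Oq_sub h.2), h.1⟩, h.2⟩⟩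
    have l := four_null hτ (measurable_Isq.diff hm) diff_subset (B := B)
      (by unfold Xn; rw [hBO]; exact hXf) (by unfold Yn; rw [hBO]; exact hYf)
    rw [hB, surfU_compl hτ (Oq_sub.trans Osq_sub) hm hI] at l
    have hBv : volume.real (Isq \ R) = 4 - v := by
      rw [measureReal_diff hI hm (Isq_fin Subset.rfl), measureReal_def, volume_Isq]
      simp [hv]
    rw [hBv] at l
    have h4a : 0 < 4 - a := by linarith [ha4.2]
    have h4v : 0 < 4 - v := by linarith
    have hEpos : 0 < 2 * √(w * (4 - v)) := by positivity
    have hex := P2_min hτ (b := 4 - a) ⟨h4a, by linarith⟩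
    rw [_root_.sub_sub_cancel] at hex
    refine conduct_lt ha0 hvpos hRv l hEpos ?_ hex
    have e1 : √(w * (4 - a)) ≤ √(w * (4 - v)) := Real.sqrt_le_sqrt (by gcongr)
    calc 2 * √(w * (4 - a)) / a ≤ 2 * √(w * (4 - v)) / a := by gcongr
      _ < 2 * √(w * (4 - v)) / v := div_lt_div_of_pos_left hEpos hvpos hva
  · have hYn : volume (Yn R) ≠ 0 := by
      intro h
      exact mixed hm hXn (fun h' => hY ⟨h, h'⟩)
    have l := four_null hτ hm hI hXn hYn
    refine conduct_lt ha0 hvpos hRv l (by positivity) ?_ (P1_min hτ ha4)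
    rw [div_lt_div_iff₀ ha0 hvpos]
    refine lt_of_pow_lt_pow_left₀ 2 (by positivity) ?_
    rw [mul_pow, mul_pow, mul_pow, mul_pow, Real.sq_sqrt (by positivity), Real.sq_sqrt (by positivity)]
    have : 0 < w * a * v * (a - v) := by
      have : 0 < a - v := by linarith
      positivity
    nlinarith

end

end

/-- A Jordan domain in `ℛ` of non-full volume can be replaced by a Jordan domain in `ℛ`
of full volume `a` with strictly smaller conductance. -/
theorem jordan_domain_full_volume (τ : ℝ × ℝ → ℝ) (hτ : IsNorm2 τ)
    (a : ℝ) (ha : a ∈ Set.Icc (1 : ℝ) 3)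
    (R : Set (ℝ × ℝ)) (hR : MemR R) (hvol : volume R < ENNReal.ofReal a)
    (lam : Set (ℝ × ℝ)) (hlam : IsRectJordanCurve lam) (hlamsub : lam ⊆ Isq)
    (hhull : R = hullSet lam) :
    ∃ R' : Set (ℝ × ℝ), MemR R' ∧ volume R' = ENNReal.ofReal a ∧
      (∃ lam' : Set (ℝ × ℝ), IsRectJordanCurve lam' ∧ lam' ⊆ Isq ∧ R' = hullSet lam') ∧
      conduct τ R' < conduct τ R := by
  exact main_aux τ hτ a ha R hR hvol
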